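/- Let φ: ℂ×ℝ→ℝ be real-analytic near the origin with φ(0,0)=0, vanishing first derivatives at (0,0), and ∂²φ/∂z∂z̄(0,0) > 0, and set M = {(z,w) ∈ ℂ² : Im w = φ(z, Re w)}, with defining function ρ(z,w) = Im w − φ(z, Re w). Let ψ: ℂ²×ℝ→ℝ be real-analytic near the origin with ψ(0)=0, vanishing first derivatives at 0, and with the 2×2 Hermitian matrix (∂²ψ/∂z_j'∂z̄_k'(0))_{j,k=1,2} invertible (so M' is Levi-nondegenerate at 0), and set M' = {(z₁',z₂',w') ∈ ℂ³ : Im w' = ψ(z₁',z₂',Re w')}, with defining function ρ'(z₁',z₂',w') = Im w' − ψ(z₁',z₂',Re w'). Let H = (H₁,H₂,H₃) be holomorphic near 0 ∈ ℂ² with H(0)=0, injective differential at 0, mapping all points of M near 0 into M', transversal at 0 (i.e. (∂H₃/∂z(0), ∂H₃/∂w(0)) ≠ (0,0)), and 2-nondegenerate at 0: with L := (∂ρ/∂w̄)·∂/∂z̄ − (∂ρ/∂z̄)·∂/∂w̄ and G(z,w) := (∂ρ'/∂z₁', ∂ρ'/∂z₂', ∂ρ'/∂w')(H(z,w), conj H(z,w)),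 the vectors G(0), (LG)(0), (L²G)(0) span ℂ³ while G(0), (LG)(0) do not. An infinitesimal deformation of H is a triple (α,β,γ) of functions holomorphic near 0 ∈ ℂ², vanishing at 0, with Re(α·∂ρ'/∂z₁'(H,conj H) + β·∂ρ'/∂z₂'(H,conj H) + γ·∂ρ'/∂w'(H,conj H)) = 0 at every point of M near 0; hol₀(M') denotes the ℝ-vector space of germs at 0 of holomorphic vector fields X=(X₁,X₂,X₃) near 0 ∈ ℂ³ with X(0)=0 and Re(X₁·∂ρ'/∂z₁' + X₂·∂ρ'/∂z₂' + X₃·∂ρ'/∂w') = 0 at every point of M' near 0. Assume the ℝ-vector space of germs at 0 of infinitesimal deformations of H and hol₀(M') have the same finite ℝ-dimension. Then H is locally rigid: there exist r > 0 and δ > 0 such that for every holomorphic map Ĥ on B_r(0) ⊂ ℂ² with Ĥ(0)=0, mapping M∩B_r(0) into M', transversal and 2-nondegenerate at 0, and satisfying sup_{B_r(0)}|Ĥ − H| < δ, there exist germs at 0 of biholomorphisms σ of (ℂ²,0) with σ(0)=0 and σ(M)⊂M near 0, and σ' of (ℂ³,0) with σ'(0)=0 and σ'(M')⊂M' near 0,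 such that Ĥ∘σ = σ'∘H on a neighborhood of 0. -/

import Mathlib

open Complex Filter Topology Metric

/-- Wirtinger derivative in the complex direction `v`:
`∂_v f = ½(∂f/∂x − i·∂f/∂y)`, where `x`,`y` are the real coordinates along `v`, `iv`. -/
noncomputable def wDer {E F : Type*} [NormedAddCommGroup E] [NormedSpace ℂ E]
    [NormedAddCommGroup F] [NormedSpace ℂ F] (v : E) (f : E → F) (p : E) : F :=
  (2⁻¹ : ℂ) • (fderiv ℝ f p v - Complex.I • fderiv ℝ f p (Complex.I • v))

/-- Conjugate Wirtinger derivative: `∂̄_v f = ½(∂f/∂x + i·∂f/∂y)`. -/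
noncomputable def wDerBar {E F : Type*} [NormedAddCommGroup E] [NormedSpace ℂ E]
    [NormedAddCommGroup F] [NormedSpace ℂ F] (v : E) (f : E → F) (p : E) : F :=
  (2⁻¹ : ℂ) • (fderiv ℝ f p v + Complex.I • fderiv ℝ f p (Complex.I • v))

/-- Wirtinger `z`-derivative for functions on `ℂ × ℝ`. -/
noncomputable def wzPhi (f : ℂ × ℝ → ℂ) (p : ℂ × ℝ) : ℂ :=
  2⁻¹ * (fderiv ℝ f p (1, 0) - Complex.I * fderiv ℝ f p (Complex.I, 0))

/-- Conjugate Wirtinger `z̄`-derivative for functions on `ℂ × ℝ`. -/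
noncomputable def wzBarPhi (f : ℂ × ℝ → ℂ) (p : ℂ × ℝ) : ℂ :=
  2⁻¹ * (fderiv ℝ f p (1, 0) + Complex.I * fderiv ℝ f p (Complex.I, 0))

/-- Wirtinger derivative on `ℂ × ℂ × ℝ` in the direction `v` (with `vI` the direction
`i·v`). -/
noncomputable def wPsi (v vI : ℂ × ℂ × ℝ) (f : ℂ × ℂ × ℝ → ℂ) (p : ℂ × ℂ × ℝ) : ℂ :=
  2⁻¹ * (fderiv ℝ f p v - Complex.I * fderiv ℝ f p vI)

/-- Conjugate Wirtinger derivative on `ℂ × ℂ × ℝ`. -/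
noncomputable def wPsiBar (v vI : ℂ × ℂ × ℝ) (f : ℂ × ℂ × ℝ → ℂ) (p : ℂ × ℂ × ℝ) : ℂ :=
  2⁻¹ * (fderiv ℝ f p v + Complex.I * fderiv ℝ f p vI)

/-- The hypersurface `M = {Im w = φ(z, Re w)} ⊂ ℂ²`. -/
def Mset (φ : ℂ × ℝ → ℝ) : Set (ℂ × ℂ) := {p | p.2.im = φ (p.1, p.2.re)}

/-- The hypersurface `M' = {Im w' = ψ(z₁', z₂', Re w')} ⊂ ℂ³`. -/
def M'set (ψ : ℂ × ℂ × ℝ → ℝ) : Set (ℂ × ℂ × ℂ) :=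
  {q | q.2.2.im = ψ (q.1, q.2.1, q.2.2.re)}

/-- The defining function `ρ(z,w) = Im w − φ(z, Re w)` of `M`, complex-valued. -/
noncomputable def rhoC (φ : ℂ × ℝ → ℝ) : ℂ × ℂ → ℂ :=
  fun p => ((p.2.im - φ (p.1, p.2.re) : ℝ) : ℂ)

/-- The defining function `ρ'` of `M'`, complex-valued. -/
noncomputable def rhoC' (ψ : ℂ × ℂ × ℝ → ℝ) : ℂ × ℂ × ℂ → ℂ :=
  fun q => ((q.2.2.im - ψ (q.1, q.2.1, q.2.2.re) : ℝ) : ℂ)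

/-- The Wirtinger gradient `(∂ρ'/∂z₁', ∂ρ'/∂z₂', ∂ρ'/∂w')` of `ρ'`. -/
noncomputable def gradRho' (ψ : ℂ × ℂ × ℝ → ℝ) : ℂ × ℂ × ℂ → ℂ × ℂ × ℂ := fun q =>
  (wDer ((1 : ℂ), (0 : ℂ), (0 : ℂ)) (rhoC' ψ) q,
   wDer ((0 : ℂ), (1 : ℂ), (0 : ℂ)) (rhoC' ψ) q,
   wDer ((0 : ℂ), (0 : ℂ), (1 : ℂ)) (rhoC' ψ) q)

/-- The Levi matrix `(∂²ψ/∂z_j'∂z̄_k'(0))_{j,k}` of `M'` at `0`. -/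
noncomputable def leviPsi (ψ : ℂ × ℂ × ℝ → ℝ) : Matrix (Fin 2) (Fin 2) ℂ :=
  fun j k =>
    wPsi (![((1 : ℂ), (0 : ℂ), (0 : ℝ)), ((0 : ℂ), (1 : ℂ), (0 : ℝ))] j)
      (![((Complex.I : ℂ), (0 : ℂ), (0 : ℝ)), ((0 : ℂ), (Complex.I : ℂ), (0 : ℝ))] j)
      (fun p =>
        wPsiBar (![((1 : ℂ), (0 : ℂ), (0 : ℝ)), ((0 : ℂ), (1 : ℂ), (0 : ℝ))] k)
          (![((Complex.I : ℂ), (0 : ℂ), (0 : ℝ)), ((0 : ℂ), (Complex.I : ℂ), (0 : ℝ))] k)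
          (fun q => ((ψ q : ℝ) : ℂ)) p) 0

/-- The CR operator `L = (∂ρ/∂w̄)·∂/∂z̄ − (∂ρ/∂z̄)·∂/∂w̄` of `M`. -/
noncomputable def Lop (φ : ℂ × ℝ → ℝ) (G : ℂ × ℂ → ℂ × ℂ × ℂ) :
    ℂ × ℂ → ℂ × ℂ × ℂ := fun p =>
  (wDerBar ((0 : ℂ), (1 : ℂ)) (rhoC φ) p) • wDerBar ((1 : ℂ), (0 : ℂ)) G p
    - (wDerBar ((1 : ℂ), (0 : ℂ)) (rhoC φ) p) • wDerBar ((0 : ℂ), (1 : ℂ)) G p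

/-- Transversality of `H` at `0`. -/
noncomputable def TransversalAt (H : ℂ × ℂ → ℂ × ℂ × ℂ) : Prop :=
  (fderiv ℂ (fun p => (H p).2.2) 0 ((1 : ℂ), (0 : ℂ)),
    fderiv ℂ (fun p => (H p).2.2) 0 ((0 : ℂ), (1 : ℂ))) ≠ (0, 0)

/-- `2`-nondegeneracy of `H` at `0`. -/
noncomputable def TwoNondegAt (φ : ℂ × ℝ → ℝ) (ψ : ℂ × ℂ × ℝ → ℝ)
    (H : ℂ × ℂ → ℂ × ℂ × ℂ) : Prop :=
  Submodule.span ℂ {gradRho' ψ (H 0), Lop φ (fun p => gradRho' ψ (H p)) 0,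
      Lop φ (Lop φ (fun p => gradRho' ψ (H p))) 0} = ⊤
    ∧ Submodule.span ℂ {gradRho' ψ (H 0), Lop φ (fun p => gradRho' ψ (H p)) 0} ≠ ⊤

/-- `α` is an infinitesimal deformation of `H : M → M'`. -/
noncomputable def IsInfDef (φ : ℂ × ℝ → ℝ) (ψ : ℂ × ℂ × ℝ → ℝ)
    (H : ℂ × ℂ → ℂ × ℂ × ℂ) (α : ℂ × ℂ → ℂ × ℂ × ℂ) : Prop :=
  AnalyticAt ℂ α 0 ∧ α 0 = 0 ∧
    ∀ᶠ p in 𝓝 (0 : ℂ × ℂ), p ∈ Mset φ →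
      ((α p).1 * (gradRho' ψ (H p)).1 + (α p).2.1 * (gradRho' ψ (H p)).2.1
        + (α p).2.2 * (gradRho' ψ (H p)).2.2).re = 0

/-- Germs at `0` of infinitesimal deformations of `H`, `𝔥𝔬𝔩₀(H)`. -/
noncomputable def infDefGermSet (φ : ℂ × ℝ → ℝ) (ψ : ℂ × ℂ × ℝ → ℝ)
    (H : ℂ × ℂ → ℂ × ℂ × ℂ) : Set (Filter.Germ (𝓝 (0 : ℂ × ℂ)) (ℂ × ℂ × ℂ)) :=
  {g | ∃ α : ℂ × ℂ → ℂ × ℂ × ℂ,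
    g = (α : Filter.Germ (𝓝 (0 : ℂ × ℂ)) (ℂ × ℂ × ℂ)) ∧ IsInfDef φ ψ H α}

/-- Germs at `0` of infinitesimal automorphisms of `M'` vanishing at `0`, `𝔥𝔬𝔩₀(M')`. -/
noncomputable def holGermSet (ψ : ℂ × ℂ × ℝ → ℝ) :
    Set (Filter.Germ (𝓝 (0 : ℂ × ℂ × ℂ)) (ℂ × ℂ × ℂ)) :=
  {g | ∃ X : ℂ × ℂ × ℂ → ℂ × ℂ × ℂ,
    g = (X : Filter.Germ (𝓝 (0 : ℂ × ℂ × ℂ)) (ℂ × ℂ × ℂ))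
    ∧ AnalyticAt ℂ X 0 ∧ X 0 = 0
    ∧ ∀ᶠ q in 𝓝 (0 : ℂ × ℂ × ℂ), q ∈ M'set ψ →
        ((X q).1 * (gradRho' ψ q).1 + (X q).2.1 * (gradRho' ψ q).2.1
          + (X q).2.2 * (gradRho' ψ q).2.2).re = 0}

/-- A germ at `0` of a biholomorphism of `(ℂᴺ,0)`. -/
def IsBiholGerm {E : Type*} [NormedAddCommGroup E] [NormedSpace ℂ E]
    (σ : E → E) : Prop :=
  AnalyticAt ℂ σ 0 ∧ σ 0 = 0 ∧
    ∃ τ : E → E, AnalyticAt ℂ τ 0 ∧ τ 0 = 0 ∧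
      (∀ᶠ p in 𝓝 (0 : E), τ (σ p) = p) ∧ (∀ᶠ p in 𝓝 (0 : E), σ (τ p) = p)

section PartOfA
open Complex Filter Topology Metric
open scoped ContDiff

/-- Analytic implicit function theorem, packaged. -/
lemma analytic_ift {𝕜 : Type*} [RCLike 𝕜]
    {E₁ : Type*} [NormedAddCommGroup E₁] [NormedSpace 𝕜 E₁] [CompleteSpace E₁]
    {E₂ : Type*} [NormedAddCommGroup E₂] [NormedSpace 𝕜 E₂] [CompleteSpace E₂]
    {F : Type*} [NormedAddCommGroup F] [NormedSpace 𝕜 F] [CompleteSpace F]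
    {f : E₁ × E₂ → F} {u : E₁ × E₂} (hf : AnalyticAt 𝕜 f u) (h0 : f u = 0)
    (hinv : (fderiv 𝕜 f u ∘L .inr 𝕜 E₁ E₂).IsInvertible) :
    ∃ g : E₁ → E₂, AnalyticAt 𝕜 g u.1 ∧ g u.1 = u.2 ∧
      (∀ᶠ v in 𝓝 u, f v = 0 ↔ g v.1 = v.2) ∧ ∀ᶠ x in 𝓝 u.1, f (x, g x) = 0 := by
  have hc : ContDiffAt 𝕜 ω f u := hf.contDiffAt
  have hn : (ω : WithTop ℕ∞) ≠ 0 := by simp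
  refine ⟨hc.implicitFunction hn hinv, ?_, hc.implicitFunction_apply_self hn hinv, ?_, ?_⟩
  · exact (hc.contDiffAt_implicitFunction hn hinv).analyticAt
  · simpa [h0] using hc.eventually_apply_eq_iff_implicitFunction hn hinv
  · simpa [h0] using hc.eventually_apply_implicitFunction hn hinv

/-- Complexification of a real-analytic function in coordinates. -/
lemma complexify {E : Type*} [NormedAddCommGroup E] [NormedSpace ℝ E] {ι : Type*} [Fintype ι]
    (e : ι → E) (l : ι → E →L[ℝ] ℝ) (hel : ∀ x, x = ∑ i, l i x • e i)
    (f : E → ℝ) (hf : AnalyticAt ℝ f 0) :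
    ∃ F : (ι → ℂ) → ℂ, AnalyticAt ℂ F 0 ∧
      ∀ᶠ x in 𝓝 (0 : E), F (fun i => ((l i x : ℝ) : ℂ)) = ((f x : ℝ) : ℂ) := by
  classical
  obtain ⟨p, r, hp⟩ := hf
  let q : FormalMultilinearSeries ℂ (ι → ℂ) ℂ := fun n =>
    ∑ i : Fin n → ι, ((p n (fun m => e (i m)) : ℝ) : ℂ) •
      (ContinuousMultilinearMap.mkPiAlgebraFin ℂ n ℂ).compContinuousLinearMap
        (fun m => ContinuousLinearMap.proj (R := ℂ) (φ := fun _ : ι => ℂ) (i m))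
  have hqapp : ∀ n (v : Fin n → ι → ℂ), q n v =
      ∑ i : Fin n → ι, ((p n (fun m => e (i m)) : ℝ) : ℂ) * ∏ m, v m (i m) := by
    intro n v
    simp [q, List.prod_ofFn]
  have hqe : ∀ n (x : E), q n (fun _ => fun i => ((l i x : ℝ) : ℂ)) =
      ((p n (fun _ => x) : ℝ) : ℂ) := by
    intro n x
    rw [hqapp]
    conv_rhs => rw [show (fun _ : Fin n => x) = (fun _ : Fin n => ∑ i, l i x • e i) from by
      funext _; exact hel x]
    have := (p n).toMultilinearMap.map_sum (fun (_ : Fin n) (i : ι) => l i x • e i)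
    simp only [ContinuousMultilinearMap.coe_coe] at this
    rw [this]
    push_cast
    refine Finset.sum_congr rfl fun i _ => ?_
    rw [(p n).map_smul_univ (fun m => l (i m) x) (fun m => e (i m))]
    simp [mul_comm]
  -- norm bounds
  obtain ⟨K, hK1, hK⟩ : ∃ K : ℝ, 1 ≤ K ∧ ∀ i, ‖e i‖ ≤ K := by
    refine ⟨1 + ∑ i, ‖e i‖, by have := Finset.sum_nonneg (s := Finset.univ) (fun i _ => norm_nonneg (e i)); linarith, fun i => ?_⟩
    have := Finset.single_le_sum (f := fun i => ‖e i‖) (fun i _ => norm_nonneg (e i)) (Finset.mem_univ i)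
    linarith
  have hqn : ∀ n, ‖q n‖ ≤ ‖p n‖ * (Fintype.card ι * K) ^ n := by
    intro n
    refine ContinuousMultilinearMap.opNorm_le_bound (by positivity) fun v => ?_
    rw [hqapp]
    refine (norm_sum_le _ _).trans ?_
    have : ∀ i ∈ (Finset.univ : Finset (Fin n → ι)),
        ‖((p n (fun m => e (i m)) : ℝ) : ℂ) * ∏ m, v m (i m)‖ ≤ (‖p n‖ * K ^ n) * ∏ m, ‖v m‖ := by
      intro i _
      rw [norm_mul, norm_prod, Complex.norm_real]
      refine mul_le_mul ?_ ?_ (by positivity) (by positivity)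
      · refine ((p n).le_opNorm _).trans ?_
        gcongr
        calc ∏ m, ‖e (i m)‖ ≤ ∏ _m : Fin n, K := Finset.prod_le_prod (fun _ _ => norm_nonneg _) (fun m _ => hK _)
          _ = K ^ n := by simp
      · exact Finset.prod_le_prod (fun _ _ => norm_nonneg _) (fun m _ => norm_le_pi_norm (v m) (i m))
    refine (Finset.sum_le_sum this).trans (le_of_eq ?_)
    simp [mul_pow]; ring
  have hrad : 0 < q.radius := by
    have h1 : 0 < p.radius := hp.r_pos.trans_le hp.r_le
    obtain ⟨r', hr'0, hr'⟩ : ∃ r' : NNReal, 0 < r' ∧ (r' : ENNReal) < p.radius := by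
      obtain ⟨r', h⟩ := ENNReal.lt_iff_exists_nnreal_btwn.1 h1
      exact ⟨r', by exact_mod_cast h.1, h.2⟩
    obtain ⟨C, hC, hb⟩ := p.norm_mul_pow_le_of_lt_radius hr'
    let k : NNReal := ⟨Fintype.card ι * K + 1, by positivity⟩
    have hk : 0 < k := by
      have : (0:ℝ) < Fintype.card ι * K + 1 := by positivity
      exact_mod_cast this
    have : ((r' / k : NNReal) : ENNReal) ≤ q.radius := by
      refine q.le_radius_of_bound C fun n => ?_
      have hkk : (k : ℝ) = Fintype.card ι * K + 1 := rfl
      have hk' : (0:ℝ) < k := by exact_mod_cast hk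
      calc ‖q n‖ * ((r' / k : NNReal) : ℝ) ^ n ≤ (‖p n‖ * (k:ℝ) ^ n) * ((r' / k : NNReal) : ℝ) ^ n := by
            gcongr
            refine (hqn n).trans ?_
            gcongr
            rw [hkk]; linarith
        _ = ‖p n‖ * r' ^ n := by
            push_cast; rw [div_pow]; field_simp
        _ ≤ C := hb n
    refine lt_of_lt_of_le ?_ this
    have : 0 < r' / k := by positivity
    exact_mod_cast this
  have hqs := q.hasFPowerSeriesOnBall hrad
  refine ⟨q.sum, hqs.analyticAt, ?_⟩
  have hev : ∀ᶠ x in 𝓝 (0:E), x ∈ Metric.eball (0:E) r := Metric.eball_mem_nhds _ hp.r_pos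
  filter_upwards [hev] with x hx
  have h1 := hp.hasSum hx
  rw [zero_add] at h1
  have h2 : HasSum (fun n => ((p n (fun _ => x) : ℝ) : ℂ)) ((f x : ℝ) : ℂ) := by
    exact_mod_cast h1
  unfold FormalMultilinearSeries.sum
  rw [← h2.tsum_eq]
  exact tsum_congr fun n => hqe n x
end PartOfA

section PartOfB
open Complex Filter Topology Metric
open scoped ContDiff

/-- One variable identity principle from the reals. -/
lemma real_zero_one {F : Type*} [NormedAddCommGroup F] [NormedSpace ℂ F] [CompleteSpace F]
    (f : ℂ → F) (ρ : ℝ) (hf : DifferentiableOn ℂ f (ball 0 ρ))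
    (h : ∀ x : ℝ, |x| < ρ → f x = 0) : ∀ z ∈ ball (0:ℂ) ρ, f z = 0 := by
  intro z hz
  have hρ : 0 < ρ := pos_of_mem_ball hz
  have ha : AnalyticOnNhd ℂ f (ball 0 ρ) := hf.analyticOnNhd isOpen_ball
  refine ha.eqOn_zero_of_preconnected_of_frequently_eq_zero (convex_ball _ _).isPreconnected
    (mem_ball_self hρ) ?_ hz
  have ht : Tendsto (fun n : ℕ => (((ρ / 2) / (n + 1 : ℝ) : ℝ) : ℂ)) atTop (𝓝[≠] 0) := by
    rw [tendsto_nhdsWithin_iff]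
    constructor
    · have : Tendsto (fun n : ℕ => ((ρ / 2) / (n + 1 : ℝ) : ℝ)) atTop (𝓝 0) :=
by
        have := (tendsto_one_div_add_atTop_nhds_zero_nat (𝕜 := ℝ)).const_mul (ρ / 2)
        simpa [div_eq_mul_inv] using this
      have h2 := (Complex.continuous_ofReal.tendsto 0).comp this
      simpa only [Complex.ofReal_zero, Function.comp_def] using h2
    · refine Eventually.of_forall fun n => ?_
      have : (ρ / 2) / (n + 1 : ℝ) ≠ 0 := by positivity
      exact Complex.ofReal_ne_zero.2 this
  refine ht.frequently (Eventually.frequently (Eventually.of_forall fun n => ?_))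
  apply h
  rw [abs_of_nonneg (by positivity), div_lt_iff₀ (by positivity)]
  have : (0:ℝ) ≤ n := by positivity
  nlinarith

lemma real_zero_pi {ι : Type*} [Fintype ι] {F : Type*} [NormedAddCommGroup F] [NormedSpace ℂ F]
    [CompleteSpace F] (f : (ι → ℂ) → F) (ρ : ℝ) (hf : DifferentiableOn ℂ f (ball 0 ρ))
    (h : ∀ x : ι → ℝ, (fun i => (x i : ℂ)) ∈ ball (0 : ι → ℂ) ρ → f (fun i => (x i : ℂ)) = 0) :
    ∀ c ∈ ball (0 : ι → ℂ) ρ, f c = 0 := by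
  classical
  have key : ∀ S : Finset ι, ∀ c ∈ ball (0 : ι → ℂ) ρ, (∀ i ∉ S, (c i).im = 0) → f c = 0 := by
    intro S
    induction S using Finset.induction_on with
    | empty =>
      intro c hc hi
      have : c = fun i => (((c i).re : ℝ) : ℂ) := by
        funext i; apply Complex.ext <;> simp [hi i (by simp)]
      rw [this] at hc ⊢
      exact h _ hc
    | insert j S hj ih =>
      intro c hc hi
      have hρ : 0 < ρ := pos_of_mem_ball hc
      have hmem : ∀ x : ℂ, ‖x‖ < ρ → Function.update c j x ∈ ball (0 : ι → ℂ) ρ := by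
        intro x hx
        rw [mem_ball_zero_iff] at hc ⊢
        rw [pi_norm_lt_iff hρ] at hc ⊢
        intro i
        by_cases hij : i = j
        · subst hij; simpa using hx
        · simpa [Function.update_of_ne hij] using hc i
      have h1 := real_zero_one (fun x => f (Function.update c j x)) ρ ?_ ?_ (c j) ?_
      · simpa using h1
      · refine hf.comp (fun x _ => ?_) (fun x hx => hmem x (by simpa using hx))
        exact (hasFDerivAt_update c x).differentiableAt.differentiableWithinAt
      · intro x hx
        refine ih _ (hmem _ (by simpa using hx)) fun i hiS => ?_
        by_cases hij : i = j
        · subst hij; simp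
        · rw [Function.update_of_ne hij]; exact hi i (by simp [hij, hiS])
      · rw [mem_ball_zero_iff] at hc ⊢
        exact (pi_norm_lt_iff hρ).1 hc j
  intro c hc
  exact key Finset.univ c hc (by simp)

lemma complexify_phi (φ : ℂ × ℝ → ℝ) (hφ : AnalyticAt ℝ φ 0) :
    ∃ Φ : ℂ × ℂ × ℂ → ℂ, AnalyticAt ℂ Φ 0 ∧
      ∀ᶠ x in 𝓝 (0 : ℂ × ℝ), Φ (x.1, star x.1, (x.2 : ℂ)) = ((φ x : ℝ) : ℂ) := by
  obtain ⟨F, hF, hFe⟩ := complexify (ι := Fin 3) (E := ℂ × ℝ) ![(1,0),(I,0),(0,1)]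
    ![reCLM ∘L ContinuousLinearMap.fst ℝ ℂ ℝ, imCLM ∘L ContinuousLinearMap.fst ℝ ℂ ℝ,
      ContinuousLinearMap.snd ℝ ℂ ℝ] (by
        rintro ⟨z, u⟩
        simp [Fin.sum_univ_three]) φ hφ
  let A : ℂ × ℂ × ℂ → (Fin 3 → ℂ) := fun x => ![(x.1 + x.2.1) / 2, (x.1 - x.2.1) / (2 * I), x.2.2]
  have hA : AnalyticAt ℂ A 0 := by
    refine analyticAt_pi_iff.2 fun i => ?_
    refine ContDiffAt.analyticAt ?_
    fin_cases i <;> simp <;> fun_prop (disch := simp)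
  have hA0 : A 0 = 0 := by funext i; fin_cases i <;> simp [A]
  refine ⟨F ∘ A, AnalyticAt.comp (by rwa [hA0]) hA, ?_⟩
  filter_upwards [hFe] with x hx
  rw [← hx]
  simp only [Function.comp]
  congr 1
  funext i
  fin_cases i <;> simp [A, Complex.ext_iff, Complex.div_re, Complex.div_im] <;> ring

lemma complexify_psi (ψ : ℂ × ℂ × ℝ → ℝ) (hψ : AnalyticAt ℝ ψ 0) :
    ∃ Ψ : ℂ × ℂ × ℂ × ℂ × ℂ → ℂ, AnalyticAt ℂ Ψ 0 ∧
      ∀ᶠ x in 𝓝 (0 : ℂ × ℂ × ℝ), Ψ (x.1, x.2.1, star x.1, star x.2.1, (x.2.2 : ℂ))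
        = ((ψ x : ℝ) : ℂ) := by
  obtain ⟨F, hF, hFe⟩ := complexify (ι := Fin 5) (E := ℂ × ℂ × ℝ)
    ![(1,0,0),(I,0,0),(0,1,0),(0,I,0),(0,0,1)]
    ![reCLM ∘L ContinuousLinearMap.fst ℝ ℂ (ℂ × ℝ), imCLM ∘L ContinuousLinearMap.fst ℝ ℂ (ℂ × ℝ),
      reCLM ∘L ContinuousLinearMap.fst ℝ ℂ ℝ ∘L ContinuousLinearMap.snd ℝ ℂ (ℂ × ℝ),
      imCLM ∘L ContinuousLinearMap.fst ℝ ℂ ℝ ∘L ContinuousLinearMap.snd ℝ ℂ (ℂ × ℝ),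
      ContinuousLinearMap.snd ℝ ℂ ℝ ∘L ContinuousLinearMap.snd ℝ ℂ (ℂ × ℝ)] (by
        rintro ⟨z, z2, u⟩
        simp [Fin.sum_univ_five]) ψ hψ
  let A : ℂ × ℂ × ℂ × ℂ × ℂ → (Fin 5 → ℂ) := fun x =>
    ![(x.1 + x.2.2.1) / 2, (x.1 - x.2.2.1) / (2 * I),
      (x.2.1 + x.2.2.2.1) / 2, (x.2.1 - x.2.2.2.1) / (2 * I), x.2.2.2.2]
  have hA : AnalyticAt ℂ A 0 := by
    refine analyticAt_pi_iff.2 fun i => ?_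
    refine ContDiffAt.analyticAt ?_
    fin_cases i <;> simp <;> fun_prop (disch := simp)
  have hA0 : A 0 = 0 := by funext i; fin_cases i <;> simp [A]
  refine ⟨F ∘ A, AnalyticAt.comp (by rwa [hA0]) hA, ?_⟩
  filter_upwards [hFe] with x hx
  rw [← hx]
  simp only [Function.comp]
  congr 1
  funext i
  fin_cases i <;> simp [A, Complex.ext_iff, Complex.div_re, Complex.div_im] <;> ring

/-- Identity principle on the totally real set `χ = z̄`, `u ∈ ℝ`. -/
lemma totreal3 {F : Type*} [NormedAddCommGroup F] [NormedSpace ℂ F] [CompleteSpace F]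
    (g : ℂ × ℂ × ℂ → F) (ρ : ℝ) (hg : DifferentiableOn ℂ g (ball 0 ρ))
    (h : ∀ (z : ℂ) (u : ℝ), (z, star z, (u : ℂ)) ∈ ball (0 : ℂ × ℂ × ℂ) ρ →
      g (z, star z, (u : ℂ)) = 0) :
    ∀ x ∈ ball (0 : ℂ × ℂ × ℂ) (ρ / 2), g x = 0 := by
  let B : (Fin 3 → ℂ) → ℂ × ℂ × ℂ := fun c => (c 0 + I * c 1, c 0 - I * c 1, c 2)
  have hB : Differentiable ℂ B := by simp only [B]; fun_prop
  have hBm : ∀ c ∈ ball (0 : Fin 3 → ℂ) (ρ / 2), B c ∈ ball (0 : ℂ × ℂ × ℂ) ρ := by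
    intro c hc
    have hρ : 0 < ρ / 2 := pos_of_mem_ball hc
    rw [mem_ball_zero_iff, pi_norm_lt_iff hρ] at hc
    have h0 := hc 0
    have h1 := hc 1
    have h2 := hc 2
    have e1 := norm_add_le (c 0) (I * c 1)
    have e2 := norm_sub_le (c 0) (I * c 1)
    simp only [norm_mul, norm_I, one_mul] at e1 e2
    simp only [mem_ball_zero_iff, B, Prod.norm_def, max_lt_iff]
    refine ⟨?_, ?_, ?_⟩ <;> linarith
  have key := real_zero_pi (g ∘ B) (ρ / 2) (hg.comp hB.differentiableOn hBm) (by
    intro x hx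
    have := h (x 0 + I * x 1) (x 2)
    have e : ((x 0 : ℂ) + I * x 1, star ((x 0 : ℂ) + I * x 1), ((x 2 : ℝ) : ℂ)) = B (fun i => (x i : ℂ)) := by
      simp [B]; ring
    rw [e] at this
    exact this (hBm _ hx))
  rintro ⟨z, χ, u⟩ hx
  have hρ : 0 < ρ / 2 := pos_of_mem_ball hx
  have := key ![(z + χ) / 2, (z - χ) / (2 * I), u] ?_
  · convert this using 2
    simp only [B]
    simp
    congr 1
    simp only [Prod.mk.injEq]
    refine ⟨?_, ?_, trivial⟩ <;> field_simp <;> ring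
  · simp only [mem_ball_zero_iff, Prod.norm_def, max_lt_iff] at hx
    rw [mem_ball_zero_iff, pi_norm_lt_iff hρ]
    have e1 := norm_add_le z χ
    have e2 := norm_sub_le z χ
    intro i
    fin_cases i
    · simp; linarith
    · simp; linarith
    · simpa using hx.2.2

lemma totreal5 {F : Type*} [NormedAddCommGroup F] [NormedSpace ℂ F] [CompleteSpace F]
    (g : ℂ × ℂ × ℂ × ℂ × ℂ → F) (ρ : ℝ) (hg : DifferentiableOn ℂ g (ball 0 ρ))
    (h : ∀ (z z2 : ℂ) (u : ℝ), (z, z2, star z, star z2, (u : ℂ)) ∈ ball (0 : ℂ × ℂ × ℂ × ℂ × ℂ) ρ →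
      g (z, z2, star z, star z2, (u : ℂ)) = 0) :
    ∀ x ∈ ball (0 : ℂ × ℂ × ℂ × ℂ × ℂ) (ρ / 2), g x = 0 := by
  let B : (Fin 5 → ℂ) → ℂ × ℂ × ℂ × ℂ × ℂ :=
    fun c => (c 0 + I * c 1, c 2 + I * c 3, c 0 - I * c 1, c 2 - I * c 3, c 4)
  have hB : Differentiable ℂ B := by simp only [B]; fun_prop
  have hBm : ∀ c ∈ ball (0 : Fin 5 → ℂ) (ρ / 2), B c ∈ ball (0 : ℂ × ℂ × ℂ × ℂ × ℂ) ρ := by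
    intro c hc
    have hρ : 0 < ρ / 2 := pos_of_mem_ball hc
    rw [mem_ball_zero_iff, pi_norm_lt_iff hρ] at hc
    have h0 := hc 0
    have h1 := hc 1
    have h2 := hc 2
    have h3 := hc 3
    have h4 := hc 4
    have e1 := norm_add_le (c 0) (I * c 1)
    have e2 := norm_sub_le (c 0) (I * c 1)
    have e3 := norm_add_le (c 2) (I * c 3)
    have e4 := norm_sub_le (c 2) (I * c 3)
    simp only [norm_mul, norm_I, one_mul] at e1 e2 e3 e4
    simp only [mem_ball_zero_iff, B, Prod.norm_def, max_lt_iff]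
    refine ⟨?_, ?_, ?_, ?_, ?_⟩ <;> linarith
  have key := real_zero_pi (g ∘ B) (ρ / 2) (hg.comp hB.differentiableOn hBm) (by
    intro x hx
    have := h (x 0 + I * x 1) (x 2 + I * x 3) (x 4)
    have e : ((x 0 : ℂ) + I * x 1, (x 2 : ℂ) + I * x 3, star ((x 0 : ℂ) + I * x 1),
        star ((x 2 : ℂ) + I * x 3), ((x 4 : ℝ) : ℂ)) = B (fun i => (x i : ℂ)) := by
      simp [B]; constructor <;> ring
    rw [e] at this
    exact this (hBm _ hx))
  rintro ⟨z, z2, χ, χ2, u⟩ hx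
  have hρ : 0 < ρ / 2 := pos_of_mem_ball hx
  have := key ![(z + χ) / 2, (z - χ) / (2 * I), (z2 + χ2) / 2, (z2 - χ2) / (2 * I), u] ?_
  · convert this using 2
    simp only [B]
    simp
    congr 1
    simp only [Prod.mk.injEq]
    refine ⟨?_, ?_, ?_, ?_, trivial⟩ <;> field_simp <;> ring
  · simp only [mem_ball_zero_iff, Prod.norm_def, max_lt_iff] at hx
    rw [mem_ball_zero_iff, pi_norm_lt_iff hρ]
    have e1 := norm_add_le z χ
    have e2 := norm_sub_le z χ
    have e3 := norm_add_le z2 χ2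
    have e4 := norm_sub_le z2 χ2
    intro i
    fin_cases i
    · simp; linarith
    · simp; linarith
    · simp; linarith
    · simp; linarith
    · simpa using hx.2.2.2.2
end PartOfB

section PartOfC
open Complex Filter Topology Metric
open scoped ContDiff

/-- Osgood lemma in two variables. -/
lemma osgood2 (f : ℂ × ℂ → ℂ) (c : ℂ × ℂ) (a b : ℝ) (ha : 0 < a) (hb : 0 < b)
    (hf : ContinuousOn f (closedBall c.1 a ×ˢ closedBall c.2 b))
    (h1 : ∀ w ∈ closedBall c.2 b, DiffContOnCl ℂ (fun z => f (z, w)) (ball c.1 a))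
    (h2 : ∀ z ∈ closedBall c.1 a, DiffContOnCl ℂ (fun w => f (z, w)) (ball c.2 b)) :
    AnalyticAt ℂ f c := by
  obtain ⟨F, hF⟩ := ContinuousMap.exists_restrict_eq
    (Y := ℂ) (s := closedBall c.1 a ×ˢ closedBall c.2 b)
    (isClosed_closedBall.prod isClosed_closedBall) ⟨_, hf.domRestrict⟩
  have hFe : ∀ z ∈ closedBall c.1 a, ∀ w ∈ closedBall c.2 b, F (z, w) = f (z, w) := by
    intro z hz w hw
    have := congrArg (fun g => g ⟨(z, w), ⟨hz, hw⟩⟩) hF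
    simpa using this
  let K := sphere c.1 a
  let Q : C(ℂ, C(K, ℂ)) := ContinuousMap.curry
    ⟨fun x : ℂ × K => F (x.2, x.1), by fun_prop⟩
  have hQ : ∀ w (ζ : K), Q w ζ = F (ζ, w) := fun w ζ => rfl
  let cm : C(ℝ, K) := ⟨fun θ => ⟨circleMap c.1 a θ, circleMap_mem_sphere _ ha.le θ⟩, by
    exact Continuous.subtype_mk (continuous_circleMap _ _) _⟩
  let J : C(K, ℂ) →L[ℂ] ℂ := LinearMap.mkContinuous
    { toFun := fun g => ∫ θ in (0:ℝ)..(2 * Real.pi), deriv (circleMap c.1 a) θ * g (cm θ)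
      map_add' := by
        intro g g'
        rw [← intervalIntegral.integral_add]
        · simp [mul_add]
        · apply Continuous.intervalIntegrable; simp only [deriv_circleMap]; fun_prop
        · apply Continuous.intervalIntegrable; simp only [deriv_circleMap]; fun_prop
      map_smul' := by
        intro k g
        simp only [RingHom.id_apply, smul_eq_mul, ← intervalIntegral.integral_const_mul]
        congr 1; funext θ; simp; ring } (a * |2 * Real.pi - 0|) (by
        intro g
        have := intervalIntegral.norm_integral_le_of_norm_le_const (a := 0) (b := 2 * Real.pi)
          (f := fun θ => deriv (circleMap c.1 a) θ * g (cm θ)) (C := a * ‖g‖) (by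
            intro θ _
            rw [norm_mul]
            have : ‖deriv (circleMap c.1 a) θ‖ = a := by simp [abs_of_pos ha]
            rw [this]
            gcongr
            exact g.norm_coe_le_norm _)
        calc _ ≤ _ := this
          _ = _ := by ring)
  have hJ : ∀ g, J g = ∫ θ in (0:ℝ)..(2 * Real.pi), deriv (circleMap c.1 a) θ * g (cm θ) :=
    fun g => rfl
  -- the analytic curve
  let b' : NNReal := ⟨b, hb.le⟩
  have hQa : AnalyticAt ℂ (fun w => (2 * Real.pi * I : ℂ)⁻¹ • ∮ z in C(c.2, b), (z - w)⁻¹ • Q z) c.2 :=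
    (hasFPowerSeriesOn_cauchy_integral (R := b') (c := c.2) (f := Q)
      (Q.continuous.continuousOn.circleIntegrable hb.le) hb).analyticAt
  set P : ℂ → C(K, ℂ) := fun w => (2 * Real.pi * I : ℂ)⁻¹ • ∮ z in C(c.2, b), (z - w)⁻¹ • Q z with hP
  have hPe : ∀ w ∈ ball c.2 b, ∀ ζ : K, P w ζ = f (ζ, w) := by
    intro w hw ζ
    have hζ : (ζ : ℂ) ∈ closedBall c.1 a := sphere_subset_closedBall ζ.2
    rw [← DiffContOnCl.two_pi_i_inv_smul_circleIntegral_sub_inv_smul (h2 ζ hζ) hw]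
    rw [hP]
    simp only [ContinuousMap.coe_smul, Pi.smul_apply]
    congr 1
    have hcirc : CircleIntegrable (fun z => (z - w)⁻¹ • Q z) c.2 b := by
      apply ContinuousOn.circleIntegrable hb.le
      have hc0 : ContinuousOn (fun z : ℂ => z - w) (sphere c.2 b) := by fun_prop
      refine ContinuousOn.smul (hc0.inv₀ ?_) Q.continuous.continuousOn
      intro x hx h0
      rw [sub_eq_zero] at h0
      subst h0
      rw [mem_ball] at hw; rw [mem_sphere] at hx; linarith
    unfold circleIntegral
    have := ContinuousLinearMap.intervalIntegral_comp_comm (μ := MeasureTheory.volume) (a := 0) (b := 2 * Real.pi)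
      ((ContinuousMap.evalCLM ℂ ζ : C(K, ℂ) →L[ℂ] ℂ)) (hcirc.out)
    simp only [ContinuousMap.evalCLM_apply] at this
    rw [← this]
    refine intervalIntegral.integral_congr fun θ _ => ?_
    simp only [ContinuousMap.coe_smul, Pi.smul_apply, hQ]
    rw [hFe _ hζ _ (circleMap_mem_closedBall _ hb.le _)]
  let u : C(K, ℂ) := ⟨fun ζ => (ζ : ℂ), continuous_subtype_val⟩
  have hunit : ∀ z ∈ ball c.1 a, IsUnit (u - algebraMap ℂ C(K, ℂ) z) := by
    intro z hz
    rw [ContinuousMap.isUnit_iff_forall_ne_zero]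
    intro ζ h0
    simp [u, sub_eq_zero] at h0
    have h3 := ζ.2
    rw [mem_ball] at hz
    have h4 : dist (ζ : ℂ) c.1 = a := h3
    rw [h0] at h4; linarith
  have hinv : ∀ z ∈ ball c.1 a, ∀ ζ : K, Ring.inverse (u - algebraMap ℂ C(K, ℂ) z) ζ = ((ζ : ℂ) - z)⁻¹ := by
    intro z hz ζ
    have := Ring.inverse_mul_cancel _ (hunit z hz)
    have h3 := congrArg (fun g => g ζ) this
    simp [u] at h3
    exact eq_inv_of_mul_eq_one_left h3
  have hrep : ∀ x ∈ ball c.1 a ×ˢ ball c.2 b, f x = (2 * Real.pi * I : ℂ)⁻¹ •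
      J (Ring.inverse (u - algebraMap ℂ C(K, ℂ) x.1) * P x.2) := by
    rintro ⟨z, w⟩ ⟨hz, hw⟩
    rw [← DiffContOnCl.two_pi_i_inv_smul_circleIntegral_sub_inv_smul (h1 w (ball_subset_closedBall hw)) hz]
    congr 1
    rw [hJ]
    unfold circleIntegral
    refine intervalIntegral.integral_congr fun θ _ => ?_
    simp only [ContinuousMap.mul_apply, smul_eq_mul]
    rw [hinv z hz, hPe w hw]
    rfl
  have hmain : AnalyticAt ℂ (fun x : ℂ × ℂ => (2 * Real.pi * I : ℂ)⁻¹ •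
      J (Ring.inverse (u - algebraMap ℂ C(K, ℂ) x.1) * P x.2)) c := by
    refine AnalyticAt.fun_const_smul (c := (2 * Real.pi * I : ℂ)⁻¹) ?_
    refine AnalyticAt.comp (g := J)
      (f := fun x : ℂ × ℂ => Ring.inverse (u - algebraMap ℂ C(K, ℂ) x.1) * P x.2) (J.analyticAt _) ?_
    refine AnalyticAt.mul ?_ ?_
    · obtain ⟨v, hv⟩ := hunit c.1 (mem_ball_self ha)
      have hA := analyticAt_inverse (𝕜 := ℂ) v
      rw [hv] at hA
      refine AnalyticAt.comp (f := fun x : ℂ × ℂ => u - algebraMap ℂ C(K, ℂ) x.1) hA ?_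
      refine analyticAt_const.sub ?_
      have : (fun x : ℂ × ℂ => algebraMap ℂ C(K, ℂ) x.1) = fun x => x.1 • (1 : C(K, ℂ)) := by
        funext x; rw [Algebra.algebraMap_eq_smul_one]
      rw [this]
      exact analyticAt_fst.smul analyticAt_const
    · exact AnalyticAt.comp (f := fun x : ℂ × ℂ => x.2) hQa analyticAt_snd
  refine hmain.congr ?_
  have : ball c.1 a ×ˢ ball c.2 b ∈ 𝓝 c := prod_mem_nhds (ball_mem_nhds _ ha) (ball_mem_nhds _ hb)
  filter_upwards [this] with x hx
  exact (hrep x hx).symm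

/-- Montel-type lemma along an ultrafilter (scalar case). -/
lemma montel_scalar (Ω : Set (ℂ × ℂ)) (hΩ : IsOpen Ω) (f : ℕ → ℂ × ℂ → ℂ)
    (hf : ∀ n, DifferentiableOn ℂ (f n) Ω) (hb : ∀ n, ∀ p ∈ Ω, ‖f n p‖ ≤ 1) (U : Ultrafilter ℕ) :
    ∃ α : ℂ × ℂ → ℂ, AnalyticOnNhd ℂ α Ω ∧
      ∀ p ∈ Ω, Tendsto (fun x : ℕ × (ℂ × ℂ) => f x.1 x.2) ((U : Filter ℕ) ×ˢ 𝓝 p) (𝓝 (α p)) := by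
  have hlim : ∀ p, ∃ y : ℂ, p ∈ Ω → Tendsto (fun n => f n p) U (𝓝 y) := by
    intro p
    by_cases hp : p ∈ Ω
    · have hm : closedBall (0:ℂ) 1 ∈ U.map (fun n => f n p) := by
        rw [Ultrafilter.mem_map]
        filter_upwards with n
        simpa using hb n p hp
      obtain ⟨y, -, hy⟩ := (isCompact_closedBall (0:ℂ) 1).ultrafilter_le_nhds
        (U.map (fun n => f n p)) (le_principal_iff.2 hm)
      exact ⟨y, fun _ => hy⟩
    · exact ⟨0, fun h => absurd h hp⟩
  choose α hα using hlim
  have hlip : ∀ p ∈ Ω, ∃ ρ > 0, ball p ρ ⊆ Ω ∧ ∀ n, ∀ q ∈ ball p ρ, dist (f n q) (f n p) ≤ 2 / ρ * dist q p := by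
    intro p hp
    obtain ⟨ρ, hρ, hs⟩ := Metric.isOpen_iff.1 hΩ p hp
    refine ⟨ρ, hρ, hs, fun n q hq => ?_⟩
    refine Complex.dist_le_div_mul_dist_of_mapsTo_ball ((hf n).mono hs) ?_ hq
    intro x hx
    rw [mem_closedBall]
    have e1 := hb n x (hs hx)
    have e2 := hb n p hp
    calc dist (f n x) (f n p) ≤ ‖f n x‖ + ‖f n p‖ := dist_le_norm_add_norm _ _
      _ ≤ 2 := by linarith
  have hcont : ∀ p ∈ Ω, ContinuousAt α p := by
    intro p hp
    obtain ⟨ρ, hρ, hs, hL⟩ := hlip p hp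
    rw [ContinuousAt, tendsto_iff_dist_tendsto_zero]
    have hz : Tendsto (fun q => 2 / ρ * dist q p) (𝓝 p) (𝓝 0) := by
      have : Continuous fun q => 2 / ρ * dist q p := by fun_prop
      simpa using this.tendsto p
    refine squeeze_zero' (Eventually.of_forall fun _ => dist_nonneg) ?_ hz
    filter_upwards [ball_mem_nhds p hρ] with q hq
    exact le_of_tendsto ((hα q (hs hq)).dist (hα p hp)) (Eventually.of_forall fun n => hL n q hq)
  have hjoint : ∀ p ∈ Ω, Tendsto (fun x : ℕ × (ℂ × ℂ) => f x.1 x.2) ((U : Filter ℕ) ×ˢ 𝓝 p) (𝓝 (α p)) := by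
    intro p hp
    obtain ⟨ρ, hρ, hs, hL⟩ := hlip p hp
    rw [tendsto_iff_dist_tendsto_zero]
    have hz : Tendsto (fun x : ℕ × (ℂ × ℂ) => 2 / ρ * dist x.2 p + dist (f x.1 p) (α p))
        ((U : Filter ℕ) ×ˢ 𝓝 p) (𝓝 0) := by
      have hz1 : Tendsto (fun q => 2 / ρ * dist q p) (𝓝 p) (𝓝 0) := by
        have : Continuous fun q => 2 / ρ * dist q p := by fun_prop
        simpa using this.tendsto p
      have := (hz1.comp tendsto_snd).add
        (((tendsto_iff_dist_tendsto_zero).1 (hα p hp)).comp (tendsto_fst (g := 𝓝 p)))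
      simpa using this
    refine squeeze_zero' (Eventually.of_forall fun _ => dist_nonneg) ?_ hz
    have : ∀ᶠ x : ℕ × (ℂ × ℂ) in (U : Filter ℕ) ×ˢ 𝓝 p, x.2 ∈ ball p ρ :=
      tendsto_snd.eventually (ball_mem_nhds p hρ)
    filter_upwards [this] with x hx
    exact (dist_triangle _ (f x.1 p) _).trans (by gcongr; exact hL _ _ hx)
  refine ⟨α, ?_, hjoint⟩
  have hlu : TendstoLocallyUniformlyOn f α U Ω := by
    rw [tendstoLocallyUniformlyOn_iff_forall_tendsto]
    intro p hp
    have e1 : Tendsto (fun x : ℕ × (ℂ × ℂ) => α x.2) ((U : Filter ℕ) ×ˢ 𝓝[Ω] p) (𝓝 (α p)) :=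
      ((hcont p hp).tendsto.mono_left nhdsWithin_le_nhds).comp tendsto_snd
    have e2 := (hjoint p hp).mono_left (Filter.prod_mono le_rfl (nhdsWithin_le_nhds (s := Ω)))
    exact (e1.prodMk_nhds e2).mono_right (nhds_le_uniformity _)
  intro p hp
  obtain ⟨ρ, hρ, hs⟩ := Metric.isOpen_iff.1 hΩ p hp
  have hsub : closedBall p.1 (ρ / 2) ×ˢ closedBall p.2 (ρ / 2) ⊆ Ω := by
    rintro ⟨z, w⟩ ⟨hz, hw⟩
    apply hs
    rw [mem_closedBall] at hz hw
    rw [mem_ball, Prod.dist_eq, max_lt_iff]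
    constructor
    · simp only at hz ⊢; linarith
    · simp only at hw ⊢; linarith
  refine osgood2 α p (ρ / 2) (ρ / 2) (by positivity) (by positivity)
    (fun x hx => (hcont x (hsub hx)).continuousWithinAt) ?_ ?_
  · intro w hw
    have hopen : IsOpen {z : ℂ | (z, w) ∈ Ω} := hΩ.preimage (by fun_prop)
    have hd : DifferentiableOn ℂ (fun z => α (z, w)) {z : ℂ | (z, w) ∈ Ω} := by
      have h3 : TendstoLocallyUniformlyOn (fun n z => f n (z, w)) (fun z => α (z, w)) U {z : ℂ | (z, w) ∈ Ω} :=
        hlu.comp (fun z : ℂ => (z, w)) (fun z hz => hz) (by fun_prop)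
      refine h3.differentiableOn (Eventually.of_forall fun n => ?_) hopen
      exact (hf n).comp (f := fun z : ℂ => (z, w)) (by fun_prop) (fun z hz => hz)
    refine (hd.mono ?_).diffContOnCl_ball (U := closedBall p.1 (ρ / 2)) le_rfl
    exact fun z hz => hsub ⟨hz, hw⟩
  · intro z hz
    have hopen : IsOpen {w : ℂ | (z, w) ∈ Ω} := hΩ.preimage (by fun_prop)
    have hd : DifferentiableOn ℂ (fun w => α (z, w)) {w : ℂ | (z, w) ∈ Ω} := by
      have h3 : TendstoLocallyUniformlyOn (fun n w => f n (z, w)) (fun w => α (z, w)) U {w : ℂ | (z, w) ∈ Ω} :=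
        hlu.comp (fun w : ℂ => (z, w)) (fun w hw => hw) (by fun_prop)
      refine h3.differentiableOn (Eventually.of_forall fun n => ?_) hopen
      exact (hf n).comp (f := fun w : ℂ => (z, w)) (by fun_prop) (fun w hw => hw)
    refine (hd.mono ?_).diffContOnCl_ball (U := closedBall p.2 (ρ / 2)) le_rfl
    exact fun w hw => hsub ⟨hz, hw⟩

lemma montel (Ω : Set (ℂ × ℂ)) (hΩ : IsOpen Ω) (f : ℕ → ℂ × ℂ → ℂ × ℂ × ℂ)
    (hf : ∀ n, DifferentiableOn ℂ (f n) Ω) (hb : ∀ n, ∀ p ∈ Ω, ‖f n p‖ ≤ 1) (U : Ultrafilter ℕ) :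
    ∃ α : ℂ × ℂ → ℂ × ℂ × ℂ, AnalyticOnNhd ℂ α Ω ∧
      ∀ p ∈ Ω, Tendsto (fun x : ℕ × (ℂ × ℂ) => f x.1 x.2) ((U : Filter ℕ) ×ˢ 𝓝 p) (𝓝 (α p)) := by
  obtain ⟨α1, h1, t1⟩ := montel_scalar Ω hΩ (fun n p => (f n p).1) (fun n => (hf n).fst)
    (fun n p hp => (norm_fst_le _).trans (hb n p hp)) U
  obtain ⟨α2, h2, t2⟩ := montel_scalar Ω hΩ (fun n p => (f n p).2.1) (fun n => (hf n).snd.fst)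
    (fun n p hp => (norm_fst_le _).trans ((norm_snd_le _).trans (hb n p hp))) U
  obtain ⟨α3, h3, t3⟩ := montel_scalar Ω hΩ (fun n p => (f n p).2.2) (fun n => (hf n).snd.snd)
    (fun n p hp => (norm_snd_le _).trans ((norm_snd_le _).trans (hb n p hp))) U
  refine ⟨fun p => (α1 p, α2 p, α3 p), fun p hp => (h1 p hp).prod ((h2 p hp).prod (h3 p hp)), ?_⟩
  intro p hp
  exact (t1 p hp).prodMk_nhds ((t2 p hp).prodMk_nhds (t3 p hp))
end PartOfC

section PartOfD
open Complex Filter Topology Metric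
open scoped ContDiff

set_option linter.unusedSectionVars false
section wirt
variable {E F : Type*} [NormedAddCommGroup E] [NormedSpace ℂ E] [StarAddMonoid E] [StarModule ℂ E]
  [ContinuousStar E] [NormedAddCommGroup F] [NormedSpace ℂ F]

lemma wirt_hasFDerivAt {k : E × E → F} {p : E} (hk : DifferentiableAt ℂ k (p, star p)) :
    ∃ L : E →L[ℝ] F, HasFDerivAt (fun p => k (p, star p)) L p ∧
      ∀ v, L v = fderiv ℂ k (p, star p) (v, star v) := by
  have : StarModule ℝ E := ⟨fun r x => by
    rw [← Complex.coe_smul, star_smul]; simp⟩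
  have h1 : HasFDerivAt k ((fderiv ℂ k (p, star p)).restrictScalars ℝ) (p, star p) :=
    hk.hasFDerivAt.restrictScalars ℝ
  have h2 : HasFDerivAt (fun p : E => (p, star p))
      ((ContinuousLinearMap.id ℝ E).prod ((starL' ℝ : E ≃L[ℝ] E) : E →L[ℝ] E)) p :=
    (hasFDerivAt_id p).prodMk ((starL' ℝ : E ≃L[ℝ] E).hasFDerivAt)
  exact ⟨_, h1.comp p h2, fun v => by simp⟩

lemma wirt_fderiv {k : E × E → F} {p : E} (hk : DifferentiableAt ℂ k (p, star p)) (v : E) :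
    fderiv ℝ (fun p => k (p, star p)) p v = fderiv ℂ k (p, star p) (v, star v) := by
  obtain ⟨L, hL, h⟩ := wirt_hasFDerivAt hk
  rw [hL.fderiv, h]

lemma wDer_eq {k : E × E → F} {p : E} (hk : DifferentiableAt ℂ k (p, star p)) (v : E) :
    wDer v (fun p => k (p, star p)) p = fderiv ℂ k (p, star p) (v, 0) := by
  unfold wDer
  rw [wirt_fderiv hk, wirt_fderiv hk]
  have e1 : ((v, star v) : E × E) = (v, 0) + (0, star v) := by simp
  have e2 : ((I • v, star (I • v)) : E × E) = I • (v, 0) - I • (0, star v) := by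
    simp [star_smul]
  rw [e1, e2, map_add, map_sub, map_smul, map_smul, smul_sub I, smul_smul, smul_smul, I_mul_I]
  module

lemma wDerBar_eq {k : E × E → F} {p : E} (hk : DifferentiableAt ℂ k (p, star p)) (v : E) :
    wDerBar v (fun p => k (p, star p)) p = fderiv ℂ k (p, star p) (0, star v) := by
  unfold wDerBar
  rw [wirt_fderiv hk, wirt_fderiv hk]
  have e1 : ((v, star v) : E × E) = (v, 0) + (0, star v) := by simp
  have e2 : ((I • v, star (I • v)) : E × E) = I • (v, 0) - I • (0, star v) := by
    simp [star_smul]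
  rw [e1, e2, map_add, map_sub, map_smul, map_smul, smul_sub, smul_smul, smul_smul, I_mul_I]
  module

lemma wDer_congr {f g : E → F} {p : E} (h : f =ᶠ[𝓝 p] g) (v : E) : wDer v f p = wDer v g p := by
  unfold wDer; rw [h.fderiv_eq]

lemma wDerBar_congr {f g : E → F} {p : E} (h : f =ᶠ[𝓝 p] g) (v : E) :
    wDerBar v f p = wDerBar v g p := by
  unfold wDerBar; rw [h.fderiv_eq]
end wirt

/-- Complexified defining function of the target. -/
noncomputable def Rc (Ψ : ℂ × ℂ × ℂ × ℂ × ℂ → ℂ) : (ℂ × ℂ × ℂ) × (ℂ × ℂ × ℂ) → ℂ := fun x =>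
  (x.1.2.2 - x.2.2.2) / (2 * I) - Ψ (x.1.1, x.1.2.1, x.2.1, x.2.2.1, (x.1.2.2 + x.2.2.2) / 2)

/-- Complexified defining function of the source. -/
noncomputable def rc (Φ : ℂ × ℂ × ℂ → ℂ) : (ℂ × ℂ) × (ℂ × ℂ) → ℂ := fun x =>
  (x.1.2 - x.2.2) / (2 * I) - Φ (x.1.1, x.2.1, (x.1.2 + x.2.2) / 2)

lemma star_cont_zero {E : Type*} [NormedAddCommGroup E] [StarAddMonoid E] [ContinuousStar E] :
    Tendsto (fun p : E => (p, star p)) (𝓝 0) (𝓝 (0 : E × E)) := by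
  have : Continuous (fun p : E => (p, star p)) := by fun_prop
  have h := this.tendsto 0
  rw [star_zero] at h
  exact h

section target
variable {ψ : ℂ × ℂ × ℝ → ℝ} {Ψ : ℂ × ℂ × ℂ × ℂ × ℂ → ℂ}

lemma Psi_zero (hΨ : ∀ᶠ x in 𝓝 (0 : ℂ × ℂ × ℝ), Ψ (x.1, x.2.1, star x.1, star x.2.1, (x.2.2 : ℂ)) = ((ψ x : ℝ) : ℂ))
    (h0 : ψ 0 = 0) : Ψ 0 = 0 := by
  have := hΨ.self_of_nhds
  simp only [Prod.fst_zero, Prod.snd_zero, star_zero, ofReal_zero, h0] at this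
  exact this

lemma Psi_fderiv (hΨa : AnalyticAt ℂ Ψ 0)
    (hΨ : ∀ᶠ x in 𝓝 (0 : ℂ × ℂ × ℝ), Ψ (x.1, x.2.1, star x.1, star x.2.1, (x.2.2 : ℂ)) = ((ψ x : ℝ) : ℂ))
    (hψa : AnalyticAt ℝ ψ 0) (h1 : fderiv ℝ ψ 0 = 0) : fderiv ℂ Ψ 0 = 0 := by
  have hd : HasFDerivAt Ψ ((fderiv ℂ Ψ 0).restrictScalars ℝ) 0 :=
    hΨa.differentiableAt.hasFDerivAt.restrictScalars ℝ
  have key : ∀ x : ℂ × ℂ × ℝ, fderiv ℂ Ψ 0 (x.1, x.2.1, star x.1, star x.2.1, (x.2.2 : ℂ)) = 0 := by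
    intro x
    have hline : HasDerivAt (fun t : ℝ => ((t • x).1, (t • x).2.1, star (t • x).1, star (t • x).2.1, ((t • x).2.2 : ℂ)))
        (x.1, x.2.1, star x.1, star x.2.1, (x.2.2 : ℂ)) 0 := by
      have : (fun t : ℝ => ((t • x).1, (t • x).2.1, star (t • x).1, star (t • x).2.1, ((t • x).2.2 : ℂ)))
        = fun t : ℝ => t • (x.1, x.2.1, star x.1, star x.2.1, (x.2.2 : ℂ)) := by
        funext t; simp
      rw [this]
      simpa using (hasDerivAt_id (0:ℝ)).smul_const (x.1, x.2.1, star x.1, star x.2.1, (x.2.2 : ℂ))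
    have hd' : HasFDerivAt Ψ ((fderiv ℂ Ψ 0).restrictScalars ℝ)
      (((0:ℝ) • x).1, ((0:ℝ) • x).2.1, star ((0:ℝ) • x).1, star ((0:ℝ) • x).2.1, (((0:ℝ) • x).2.2 : ℂ)) := by
      have : ((((0:ℝ) • x).1, ((0:ℝ) • x).2.1, star ((0:ℝ) • x).1, star ((0:ℝ) • x).2.1, (((0:ℝ) • x).2.2 : ℂ))
        : ℂ × ℂ × ℂ × ℂ × ℂ) = 0 := by simp
      rw [this]; exact hd
    have c1 := hd'.comp_hasDerivAt (0:ℝ) hline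
    have hψd : HasFDerivAt ψ (0 : ℂ × ℂ × ℝ →L[ℝ] ℝ) ((0:ℝ) • x) := by
      rw [zero_smul, ← h1]; exact hψa.differentiableAt.hasFDerivAt
    have hl2 : HasDerivAt (fun t : ℝ => t • x) x 0 := by simpa using (hasDerivAt_id (0:ℝ)).smul_const x
    have c2 := (hψd.comp_hasDerivAt (0:ℝ) hl2).ofReal_comp
    have hev : ∀ᶠ t : ℝ in 𝓝 0, Ψ ((t • x).1, (t • x).2.1, star (t • x).1, star (t • x).2.1, ((t • x).2.2 : ℂ))
        = ((ψ (t • x) : ℝ) : ℂ) := by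
      have : Tendsto (fun t : ℝ => t • x) (𝓝 0) (𝓝 0) := by
        have : Continuous fun t : ℝ => t • x := by fun_prop
        simpa using this.tendsto 0
      exact this.eventually hΨ
    have c3 := c1.congr_of_eventuallyEq (f₁ := fun t => ((ψ (t • x) : ℝ) : ℂ)) (by
      filter_upwards [hev] with t ht; exact ht.symm)
    have := c3.unique c2
    simpa using this
  have k1 := key (1, 0, 0)
  have k2 := key (I, 0, 0)
  have k3 := key (0, 1, 0)
  have k4 := key (0, I, 0)
  have k5 := key (0, 0, 1)
  simp at k1 k2 k3 k4 k5
  ext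
  · change fderiv ℂ Ψ 0 (1, 0, 0, 0, 0) = 0
    have : ((1, 0, 0, 0, 0) : ℂ × ℂ × ℂ × ℂ × ℂ) = (2⁻¹ : ℂ) • ((1, 0, 1, 0, 0) - I • (I, 0, -I, 0, 0)) := by
      simp; norm_num
    rw [this, map_smul, map_sub, map_smul, k1, k2]; simp
  · change fderiv ℂ Ψ 0 (0, 1, 0, 0, 0) = 0
    have : ((0, 1, 0, 0, 0) : ℂ × ℂ × ℂ × ℂ × ℂ) = (2⁻¹ : ℂ) • ((0, 1, 0, 1, 0) - I • (0, I, 0, -I, 0)) := by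
      simp; norm_num
    rw [this, map_smul, map_sub, map_smul, k3, k4]; simp
  · change fderiv ℂ Ψ 0 (0, 0, 1, 0, 0) = 0
    have : ((0, 0, 1, 0, 0) : ℂ × ℂ × ℂ × ℂ × ℂ) = (2⁻¹ : ℂ) • ((1, 0, 1, 0, 0) + I • (I, 0, -I, 0, 0)) := by
      simp; norm_num
    rw [this, map_smul, map_add, map_smul, k1, k2]; simp
  · change fderiv ℂ Ψ 0 (0, 0, 0, 1, 0) = 0
    have : ((0, 0, 0, 1, 0) : ℂ × ℂ × ℂ × ℂ × ℂ) = (2⁻¹ : ℂ) • ((0, 1, 0, 1, 0) + I • (0, I, 0, -I, 0)) := by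
      simp; norm_num
    rw [this, map_smul, map_add, map_smul, k3, k4]; simp
  · simp [k5]

lemma Rc_analytic (hΨa : AnalyticAt ℂ Ψ 0) : AnalyticAt ℂ (Rc Ψ) 0 := by
  unfold Rc
  have h1 : AnalyticAt ℂ (fun x : (ℂ × ℂ × ℂ) × (ℂ × ℂ × ℂ) => (x.1.2.2 - x.2.2.2) / (2 * I)) 0 :=
    ContDiffAt.analyticAt (by fun_prop (disch := simp))
  have h2 : AnalyticAt ℂ (fun x : (ℂ × ℂ × ℂ) × (ℂ × ℂ × ℂ) =>
      (x.1.1, x.1.2.1, x.2.1, x.2.2.1, (x.1.2.2 + x.2.2.2) / 2)) 0 :=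
    ContDiffAt.analyticAt (by fun_prop (disch := simp))
  refine h1.sub (AnalyticAt.comp (g := Ψ) ?_ h2)
  have e : ((0 : (ℂ × ℂ × ℂ) × (ℂ × ℂ × ℂ)).1.2.2 + (0 : (ℂ × ℂ × ℂ) × (ℂ × ℂ × ℂ)).2.2.2) / 2 = 0 := by simp
  rw [e]
  exact hΨa

lemma Rc_zero (h0 : Ψ 0 = 0) : Rc Ψ 0 = 0 := by
  unfold Rc
  have : ((0, 0, 0, 0, 0) : ℂ × ℂ × ℂ × ℂ × ℂ) = 0 := rfl
  simp [this, h0]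

lemma Rc_fderiv (hΨa : AnalyticAt ℂ Ψ 0) (h1 : fderiv ℂ Ψ 0 = 0) (v : (ℂ × ℂ × ℂ) × (ℂ × ℂ × ℂ)) :
    fderiv ℂ (Rc Ψ) 0 v = (v.1.2.2 - v.2.2.2) / (2 * I) := by
  let l : (ℂ × ℂ × ℂ) × (ℂ × ℂ × ℂ) →L[ℂ] ℂ := LinearMap.toContinuousLinearMap
    { toFun := fun x => (x.1.2.2 - x.2.2.2) / (2 * I)
      map_add' := by intro x y; simp; ring
      map_smul' := by intro c x; simp; ring }
  let m : (ℂ × ℂ × ℂ) × (ℂ × ℂ × ℂ) →L[ℂ] ℂ × ℂ × ℂ × ℂ × ℂ := LinearMap.toContinuousLinearMap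
    { toFun := fun x => (x.1.1, x.1.2.1, x.2.1, x.2.2.1, (x.1.2.2 + x.2.2.2) / 2)
      map_add' := by intro x y; simp; ring
      map_smul' := by intro c x; simp; ring }
  have h2 : HasFDerivAt Ψ (0 : _ →L[ℂ] ℂ) (m 0) := by
    rw [map_zero, ← h1]; exact hΨa.differentiableAt.hasFDerivAt
  have h3 : HasFDerivAt (Rc Ψ) (l - (0 : _ →L[ℂ] ℂ).comp m) 0 :=
    l.hasFDerivAt.sub (h2.comp 0 m.hasFDerivAt)
  rw [h3.fderiv]
  simp [l]

lemma Rc_diag (hΨ : ∀ᶠ x in 𝓝 (0 : ℂ × ℂ × ℝ), Ψ (x.1, x.2.1, star x.1, star x.2.1, (x.2.2 : ℂ)) = ((ψ x : ℝ) : ℂ)) :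
    ∀ᶠ q in 𝓝 (0 : ℂ × ℂ × ℂ), Rc Ψ (q, star q) = rhoC' ψ q := by
  have ht : Tendsto (fun q : ℂ × ℂ × ℂ => (q.1, q.2.1, q.2.2.re)) (𝓝 0) (𝓝 0) := by
    have : Continuous (fun q : ℂ × ℂ × ℂ => (q.1, q.2.1, q.2.2.re)) := by fun_prop
    exact this.tendsto 0
  filter_upwards [ht.eventually hΨ] with q hq
  unfold Rc rhoC'
  have e : (q.2.2 + star q.2.2) / 2 = (q.2.2.re : ℂ) := by
    apply Complex.ext <;> simp
  have e2 : (q.2.2 - star q.2.2) / (2 * I) = (q.2.2.im : ℂ) := by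
    apply Complex.ext <;> simp [Complex.div_re, Complex.div_im]; ring
  simp only [Prod.snd_star, Prod.fst_star]
  rw [e, e2, hq]
  push_cast
  rfl

/-- Functions vanishing on the target hypersurface vanish on its complexification. -/
lemma Rc_nullst (hΨa : AnalyticAt ℂ Ψ 0) (h0 : Ψ 0 = 0)
    (hΨ : ∀ᶠ x in 𝓝 (0 : ℂ × ℂ × ℝ), Ψ (x.1, x.2.1, star x.1, star x.2.1, (x.2.2 : ℂ)) = ((ψ x : ℝ) : ℂ))
    (J : (ℂ × ℂ × ℂ) × (ℂ × ℂ × ℂ) → ℂ) (hJ : ∀ᶠ x in 𝓝 0, DifferentiableAt ℂ J x)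
    (hJ0 : ∀ᶠ q in 𝓝 (0 : ℂ × ℂ × ℂ), q ∈ M'set ψ → J (q, star q) = 0) :
    ∀ᶠ x in 𝓝 (0 : (ℂ × ℂ × ℂ) × (ℂ × ℂ × ℂ)), Rc Ψ x = 0 → J x = 0 := by
  let m : ℂ × ℂ × ℂ × ℂ × ℂ → (ℂ × ℂ × ℂ) × (ℂ × ℂ × ℂ) := fun y =>
    ((y.1, y.2.1, y.2.2.2.2 + I * Ψ y), (y.2.2.1, y.2.2.2.1, y.2.2.2.2 - I * Ψ y))
  have hm : AnalyticAt ℂ m 0 := by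
    have h3 : ContDiffAt ℂ ω Ψ 0 := hΨa.contDiffAt
    exact ContDiffAt.analyticAt (by fun_prop)
  have hm0 : m 0 = 0 := by simp [m, h0]
  have hmt : Tendsto m (𝓝 0) (𝓝 0) := by
    have := hm.continuousAt.tendsto; rwa [hm0] at this
  have hg : ∀ᶠ y in 𝓝 0, DifferentiableAt ℂ (J ∘ m) y := by
    filter_upwards [hmt.eventually hJ, hm.eventually_analyticAt] with y h1 h2
    exact h1.comp y h2.differentiableAt
  have ht5 : Tendsto (fun y : ℂ × ℂ × ℂ × ℂ × ℂ => (y.1, y.2.1, y.2.2.2.2.re)) (𝓝 0) (𝓝 (0 : ℂ × ℂ × ℝ)) := by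
    have : Continuous (fun y : ℂ × ℂ × ℂ × ℂ × ℂ => (y.1, y.2.1, y.2.2.2.2.re)) := by fun_prop
    exact this.tendsto 0
  have hmt1 : Tendsto (fun y => (m y).1) (𝓝 0) (𝓝 0) := by
    have := (continuous_fst.tendsto (0 : (ℂ × ℂ × ℂ) × (ℂ × ℂ × ℂ))).comp hmt
    exact this
  obtain ⟨ρ, hρ, hb⟩ := Metric.eventually_nhds_iff_ball.1
    ((hg.and (ht5.eventually hΨ)).and (hmt1.eventually hJ0))
  have key := totreal5 (J ∘ m) ρ (fun y hy => (hb y hy).1.1.differentiableWithinAt) (by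
    intro z z2 u hy
    obtain ⟨⟨-, h5⟩, h6⟩ := hb _ hy
    simp only [ofReal_re] at h5
    have e1 : (m (z, z2, star z, star z2, (u : ℂ))).1 = (z, z2, (u : ℂ) + I * (ψ (z, z2, u) : ℂ)) := by
      simp only [m]; rw [h5]
    rw [e1] at h6
    have h7 := h6 (by simp [M'set])
    rw [← h7]
    simp only [Function.comp]
    congr 1
    rw [← e1]
    simp only [m]
    rw [h5]
    ext <;> simp [sub_eq_add_neg])
  have hn : Tendsto (fun x : (ℂ × ℂ × ℂ) × (ℂ × ℂ × ℂ) => (x.1.1, x.1.2.1, x.2.1, x.2.2.1, (x.1.2.2 + x.2.2.2) / 2))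
      (𝓝 0) (𝓝 0) := by
    have : Continuous (fun x : (ℂ × ℂ × ℂ) × (ℂ × ℂ × ℂ) => (x.1.1, x.1.2.1, x.2.1, x.2.2.1, (x.1.2.2 + x.2.2.2) / 2)) := by
      fun_prop
    have h := this.tendsto 0
    have e : ((0 : (ℂ × ℂ × ℂ) × (ℂ × ℂ × ℂ)).1.2.2 + (0 : (ℂ × ℂ × ℂ) × (ℂ × ℂ × ℂ)).2.2.2) / 2 = 0 := by simp
    rw [e] at h
    exact h
  filter_upwards [hn.eventually (ball_mem_nhds _ (by positivity : 0 < ρ / 2))] with x hx hR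
  have h8 := key _ hx
  simp only [Function.comp] at h8
  rw [← h8]
  congr 1
  unfold Rc at hR
  rw [sub_eq_zero] at hR
  simp only [m, ← hR]
  have eI : I * ((x.1.2.2 - x.2.2.2) / (2 * I)) = (x.1.2.2 - x.2.2.2) / 2 := by
    field_simp
  rw [eI]
  ext <;> simp <;> ring

lemma gradRho_eq (hΨa : AnalyticAt ℂ Ψ 0)
    (hΨ : ∀ᶠ x in 𝓝 (0 : ℂ × ℂ × ℝ), Ψ (x.1, x.2.1, star x.1, star x.2.1, (x.2.2 : ℂ)) = ((ψ x : ℝ) : ℂ)) :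
    ∀ᶠ q in 𝓝 (0 : ℂ × ℂ × ℂ), gradRho' ψ q =
      (fderiv ℂ (Rc Ψ) (q, star q) ((1, 0, 0), 0), fderiv ℂ (Rc Ψ) (q, star q) ((0, 1, 0), 0),
        fderiv ℂ (Rc Ψ) (q, star q) ((0, 0, 1), 0)) := by
  have h1 := star_cont_zero.eventually (Rc_analytic hΨa).eventually_analyticAt
  filter_upwards [h1, (Rc_diag hΨ).eventually_nhds] with q hq hq2
  have hd := hq.differentiableAt
  have hc : rhoC' ψ =ᶠ[𝓝 q] fun q => Rc Ψ (q, star q) := by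
    filter_upwards [hq2] with x hx; exact hx.symm
  unfold gradRho'
  rw [wDer_congr hc, wDer_congr hc, wDer_congr hc, wDer_eq hd, wDer_eq hd, wDer_eq hd]

lemma grad_pair (hΨa : AnalyticAt ℂ Ψ 0)
    (hΨ : ∀ᶠ x in 𝓝 (0 : ℂ × ℂ × ℝ), Ψ (x.1, x.2.1, star x.1, star x.2.1, (x.2.2 : ℂ)) = ((ψ x : ℝ) : ℂ)) :
    ∀ᶠ q in 𝓝 (0 : ℂ × ℂ × ℂ), ∀ v : ℂ × ℂ × ℂ,
      v.1 * (gradRho' ψ q).1 + v.2.1 * (gradRho' ψ q).2.1 + v.2.2 * (gradRho' ψ q).2.2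
        = fderiv ℂ (Rc Ψ) (q, star q) (v, 0) := by
  filter_upwards [gradRho_eq hΨa hΨ] with q hq v
  rw [hq]
  have : ((v, 0) : (ℂ × ℂ × ℂ) × (ℂ × ℂ × ℂ)) = v.1 • ((1, 0, 0), 0) + v.2.1 • ((0, 1, 0), 0) + v.2.2 • ((0, 0, 1), 0) := by
    ext <;> simp
  rw [this, map_add, map_add, map_smul, map_smul, map_smul]
  simp

/-- On the diagonal, the real derivative is twice the real part of the pairing. -/
lemma diag_real (hΨa : AnalyticAt ℂ Ψ 0)
    (hΨ : ∀ᶠ x in 𝓝 (0 : ℂ × ℂ × ℝ), Ψ (x.1, x.2.1, star x.1, star x.2.1, (x.2.2 : ℂ)) = ((ψ x : ℝ) : ℂ)) :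
    ∀ᶠ q in 𝓝 (0 : ℂ × ℂ × ℂ), ∀ v : ℂ × ℂ × ℂ,
      fderiv ℂ (Rc Ψ) (q, star q) (v, star v) =
        ((2 * (v.1 * (gradRho' ψ q).1 + v.2.1 * (gradRho' ψ q).2.1 + v.2.2 * (gradRho' ψ q).2.2).re : ℝ) : ℂ) := by
  have h1 := star_cont_zero.eventually (Rc_analytic hΨa).eventually_analyticAt
  filter_upwards [h1, (Rc_diag hΨ).eventually_nhds, grad_pair hΨa hΨ] with q hq hq2 hg v
  rw [hg]
  have hd := hq.differentiableAt
  obtain ⟨L, hL, hLv⟩ := wirt_hasFDerivAt hd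
  have him : ∀ v, (fderiv ℂ (Rc Ψ) (q, star q) (v, star v)).im = 0 := by
    intro v
    rw [← hLv]
    have h2 : HasFDerivAt (fun q => (Rc Ψ (q, star q)).im) (imCLM ∘L L) q :=
      imCLM.hasFDerivAt.comp q hL
    have h3 : HasFDerivAt (fun q => (Rc Ψ (q, star q)).im) (0 : ℂ × ℂ × ℂ →L[ℝ] ℝ) q := by
      refine (hasFDerivAt_const (0:ℝ) q).congr_of_eventuallyEq ?_
      filter_upwards [hq2] with x hx
      rw [hx]; simp [rhoC']
    have := congrArg (fun l => l v) (h2.unique h3)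
    simpa using this
  set A := fderiv ℂ (Rc Ψ) (q, star q) with hA
  have e1 : ((v, star v) : (ℂ × ℂ × ℂ) × (ℂ × ℂ × ℂ)) = (v, 0) + (0, star v) := by simp
  have e2 : ((I • v, star (I • v)) : (ℂ × ℂ × ℂ) × (ℂ × ℂ × ℂ)) = I • (v, 0) - I • (0, star v) := by
    ext <;> simp
  have i1 := him v
  have i2 := him (I • v)
  rw [e1, map_add] at i1
  rw [e2, map_sub, map_smul, map_smul] at i2
  rw [e1, map_add]
  simp at i1 i2
  apply Complex.ext
  · simp; linarith
  · simpa using i1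
end target

section source
variable {φ : ℂ × ℝ → ℝ} {Φ : ℂ × ℂ × ℂ → ℂ}

lemma Phi_zero (hΦ : ∀ᶠ x in 𝓝 (0 : ℂ × ℝ), Φ (x.1, star x.1, (x.2 : ℂ)) = ((φ x : ℝ) : ℂ))
    (h0 : φ 0 = 0) : Φ 0 = 0 := by
  have := hΦ.self_of_nhds
  simp only [Prod.fst_zero, Prod.snd_zero, star_zero, ofReal_zero, h0] at this
  exact this

lemma rc_analytic (hΦa : AnalyticAt ℂ Φ 0) : AnalyticAt ℂ (rc Φ) 0 := by
  unfold rc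
  have h1 : AnalyticAt ℂ (fun x : (ℂ × ℂ) × (ℂ × ℂ) => (x.1.2 - x.2.2) / (2 * I)) 0 :=
    ContDiffAt.analyticAt (by fun_prop (disch := simp))
  have h2 : AnalyticAt ℂ (fun x : (ℂ × ℂ) × (ℂ × ℂ) => (x.1.1, x.2.1, (x.1.2 + x.2.2) / 2)) 0 :=
    ContDiffAt.analyticAt (by fun_prop (disch := simp))
  refine h1.sub (AnalyticAt.comp (g := Φ) ?_ h2)
  have e : ((0 : (ℂ × ℂ) × (ℂ × ℂ)).1.2 + (0 : (ℂ × ℂ) × (ℂ × ℂ)).2.2) / 2 = 0 := by simp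
  rw [e]
  exact hΦa

lemma rc_diag (hΦ : ∀ᶠ x in 𝓝 (0 : ℂ × ℝ), Φ (x.1, star x.1, (x.2 : ℂ)) = ((φ x : ℝ) : ℂ)) :
    ∀ᶠ q in 𝓝 (0 : ℂ × ℂ), rc Φ (q, star q) = rhoC φ q := by
  have ht : Tendsto (fun q : ℂ × ℂ => (q.1, q.2.re)) (𝓝 0) (𝓝 0) := by
    have : Continuous (fun q : ℂ × ℂ => (q.1, q.2.re)) := by fun_prop
    exact this.tendsto 0
  filter_upwards [ht.eventually hΦ] with q hq
  unfold rc rhoC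
  have e : (q.2 + star q.2) / 2 = (q.2.re : ℂ) := by
    apply Complex.ext <;> simp
  have e2 : (q.2 - star q.2) / (2 * I) = (q.2.im : ℂ) := by
    apply Complex.ext <;> simp [Complex.div_re, Complex.div_im]; ring
  simp only [Prod.snd_star, Prod.fst_star]
  rw [e, e2, hq]
  push_cast
  rfl

lemma Phi_fderiv (hΦa : AnalyticAt ℂ Φ 0)
    (hΦ : ∀ᶠ x in 𝓝 (0 : ℂ × ℝ), Φ (x.1, star x.1, (x.2 : ℂ)) = ((φ x : ℝ) : ℂ))
    (hφa : AnalyticAt ℝ φ 0) (h1 : fderiv ℝ φ 0 = 0) : fderiv ℂ Φ 0 = 0 := by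
  have hd : HasFDerivAt Φ ((fderiv ℂ Φ 0).restrictScalars ℝ) 0 :=
    hΦa.differentiableAt.hasFDerivAt.restrictScalars ℝ
  have key : ∀ x : ℂ × ℝ, fderiv ℂ Φ 0 (x.1, star x.1, (x.2 : ℂ)) = 0 := by
    intro x
    have hline : HasDerivAt (fun t : ℝ => ((t • x).1, star (t • x).1, ((t • x).2 : ℂ)))
        (x.1, star x.1, (x.2 : ℂ)) 0 := by
      have : (fun t : ℝ => ((t • x).1, star (t • x).1, ((t • x).2 : ℂ)))
        = fun t : ℝ => t • (x.1, star x.1, (x.2 : ℂ)) := by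
        funext t; simp
      rw [this]
      simpa using (hasDerivAt_id (0:ℝ)).smul_const (x.1, star x.1, (x.2 : ℂ))
    have hd' : HasFDerivAt Φ ((fderiv ℂ Φ 0).restrictScalars ℝ)
      (((0:ℝ) • x).1, star ((0:ℝ) • x).1, (((0:ℝ) • x).2 : ℂ)) := by
      have : ((((0:ℝ) • x).1, star ((0:ℝ) • x).1, (((0:ℝ) • x).2 : ℂ))
        : ℂ × ℂ × ℂ) = 0 := by simp
      rw [this]; exact hd
    have c1 := hd'.comp_hasDerivAt (0:ℝ) hline
    have hψd : HasFDerivAt φ (0 : ℂ × ℝ →L[ℝ] ℝ) ((0:ℝ) • x) := by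
      rw [zero_smul, ← h1]; exact hφa.differentiableAt.hasFDerivAt
    have hl2 : HasDerivAt (fun t : ℝ => t • x) x 0 := by simpa using (hasDerivAt_id (0:ℝ)).smul_const x
    have c2 := (hψd.comp_hasDerivAt (0:ℝ) hl2).ofReal_comp
    have hev : ∀ᶠ t : ℝ in 𝓝 0, Φ ((t • x).1, star (t • x).1, ((t • x).2 : ℂ))
        = ((φ (t • x) : ℝ) : ℂ) := by
      have : Tendsto (fun t : ℝ => t • x) (𝓝 0) (𝓝 0) := by
        have : Continuous fun t : ℝ => t • x := by fun_prop
        simpa using this.tendsto 0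
      exact this.eventually hΦ
    have c3 := c1.congr_of_eventuallyEq (f₁ := fun t => ((φ (t • x) : ℝ) : ℂ)) (by
      filter_upwards [hev] with t ht; exact ht.symm)
    have := c3.unique c2
    simpa using this
  have k1 := key (1, 0)
  have k2 := key (I, 0)
  have k5 := key (0, 1)
  simp at k1 k2 k5
  ext
  · change fderiv ℂ Φ 0 (1, 0, 0) = 0
    have : ((1, 0, 0) : ℂ × ℂ × ℂ) = (2⁻¹ : ℂ) • ((1, 1, 0) - I • (I, -I, 0)) := by
      simp; norm_num
    rw [this, map_smul, map_sub, map_smul, k1, k2]; simp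
  · change fderiv ℂ Φ 0 (0, 1, 0) = 0
    have : ((0, 1, 0) : ℂ × ℂ × ℂ) = (2⁻¹ : ℂ) • ((1, 1, 0) + I • (I, -I, 0)) := by
      simp; norm_num
    rw [this, map_smul, map_add, map_smul, k1, k2]; simp
  · simp [k5]

/-- Existence of the auxiliary function `U` with `U + iΦ(z,χ,U) = w`. -/
lemma exists_U (hΦa : AnalyticAt ℂ Φ 0) (h0 : Φ 0 = 0) (h1 : fderiv ℂ Φ 0 = 0) :
    ∃ U : ℂ × ℂ × ℂ → ℂ, AnalyticAt ℂ U 0 ∧ U 0 = 0 ∧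
      ∀ᶠ x in 𝓝 (0 : ℂ × ℂ × ℂ), U x + I * Φ (x.1, x.2.1, U x) = x.2.2 := by
  let f : (ℂ × ℂ × ℂ) × ℂ → ℂ := fun y => y.2 + I * Φ (y.1.1, y.1.2.1, y.2) - y.1.2.2
  let m : (ℂ × ℂ × ℂ) × ℂ → ℂ × ℂ × ℂ := fun y => (y.1.1, y.1.2.1, y.2)
  have hm : ContDiff ℂ ω m := by simp only [m]; fun_prop
  have hm0 : m 0 = 0 := rfl
  have hΦm : AnalyticAt ℂ (fun y => Φ (m y)) 0 := AnalyticAt.comp (g := Φ) (by rwa [hm0]) hm.contDiffAt.analyticAt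
  have hfa : AnalyticAt ℂ f 0 := by
    have : ContDiffAt ℂ ω (fun y => Φ (m y)) 0 := hΦm.contDiffAt
    refine ContDiffAt.analyticAt ?_
    exact (contDiffAt_snd.add (contDiffAt_const.mul this)).sub (by fun_prop)
  have hf0 : f 0 = 0 := by
    change (0:ℂ) + I * Φ 0 - 0 = 0
    rw [h0]; simp
  have hΦd : HasFDerivAt Φ (0 : _ →L[ℂ] ℂ) (m 0) := by
    rw [hm0, ← h1]; exact hΦa.differentiableAt.hasFDerivAt
  have hfd : HasFDerivAt f (ContinuousLinearMap.snd ℂ (ℂ × ℂ × ℂ) ℂ + I • (0 : ℂ × ℂ × ℂ →L[ℂ] ℂ).comp (fderiv ℂ m 0)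
      - (ContinuousLinearMap.snd ℂ ℂ ℂ ∘L ContinuousLinearMap.snd ℂ ℂ (ℂ × ℂ) ∘L ContinuousLinearMap.fst ℂ (ℂ × ℂ × ℂ) ℂ)) 0 := by
    refine HasFDerivAt.sub (HasFDerivAt.add ?_ ?_) ?_
    · exact hasFDerivAt_snd
    · exact (hΦd.comp 0 (hm.differentiable (by simp) 0).hasFDerivAt).const_mul I
    · exact (ContinuousLinearMap.snd ℂ ℂ ℂ ∘L ContinuousLinearMap.snd ℂ ℂ (ℂ × ℂ) ∘L ContinuousLinearMap.fst ℂ (ℂ × ℂ × ℂ) ℂ).hasFDerivAt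
  obtain ⟨U, hU, hU0, -, hU2⟩ := analytic_ift (u := (0 : (ℂ × ℂ × ℂ) × ℂ)) hfa hf0 (by
    have : fderiv ℂ f 0 ∘L .inr ℂ (ℂ × ℂ × ℂ) ℂ = ContinuousLinearMap.id ℂ ℂ := by
      rw [hfd.fderiv]; ext; simp
    rw [this]
    exact ContinuousLinearMap.IsInvertible.of_inverse (g := ContinuousLinearMap.id ℂ ℂ) (by simp) (by simp))
  refine ⟨U, hU, hU0, ?_⟩
  filter_upwards [hU2] with x hx
  simpa [f, sub_eq_zero] using hx

/-- Segre function. -/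
noncomputable def Tc (Φ U : ℂ × ℂ × ℂ → ℂ) : ℂ × ℂ × ℂ → ℂ := fun x => x.2.2 - 2 * I * Φ (x.1, x.2.1, U x)

lemma PhiU_analytic {U : ℂ × ℂ × ℂ → ℂ} (hΦa : AnalyticAt ℂ Φ 0) (hU : AnalyticAt ℂ U 0) (hU0 : U 0 = 0) :
    AnalyticAt ℂ (fun x : ℂ × ℂ × ℂ => Φ (x.1, x.2.1, U x)) 0 := by
  have h1 : ContDiffAt ℂ ω U 0 := hU.contDiffAt
  refine AnalyticAt.comp (g := Φ) (f := fun x : ℂ × ℂ × ℂ => (x.1, x.2.1, U x)) ?_ ?_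
  · rw [hU0]; exact hΦa
  · exact ContDiffAt.analyticAt (by fun_prop)

lemma Tc_analytic {U : ℂ × ℂ × ℂ → ℂ} (hΦa : AnalyticAt ℂ Φ 0) (hU : AnalyticAt ℂ U 0) (hU0 : U 0 = 0) :
    AnalyticAt ℂ (Tc Φ U) 0 := by
  have h2 : ContDiffAt ℂ ω (fun x : ℂ × ℂ × ℂ => Φ (x.1, x.2.1, U x)) 0 := (PhiU_analytic hΦa hU hU0).contDiffAt
  refine ContDiffAt.analyticAt ?_
  unfold Tc
  exact ContDiffAt.sub (by fun_prop) (contDiffAt_const.mul h2)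

lemma Tc_zero {U : ℂ × ℂ × ℂ → ℂ} (h0 : Φ 0 = 0) (hU0 : U 0 = 0) : Tc Φ U 0 = 0 := by
  unfold Tc
  rw [hU0]
  have : Φ ((0 : ℂ × ℂ × ℂ).1, (0 : ℂ × ℂ × ℂ).2.1, 0) = 0 := h0
  rw [this]; simp

lemma rc_Tc {U : ℂ × ℂ × ℂ → ℂ} (x : ℂ × ℂ × ℂ) (hU : U x + I * Φ (x.1, x.2.1, U x) = x.2.2) :
    rc Φ ((x.1, x.2.2), (x.2.1, Tc Φ U x)) = 0 := by
  unfold rc Tc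
  simp only
  have : (x.2.2 + (x.2.2 - 2 * I * Φ (x.1, x.2.1, U x))) / 2 = U x := by
    linear_combination (-1 : ℂ) * hU
  rw [this]
  field_simp; ring

/-- Functions vanishing on the source hypersurface vanish on its complexification, uniformly. -/
lemma refl_uniform {U : ℂ × ℂ × ℂ → ℂ} (hΦa : AnalyticAt ℂ Φ 0) (h0 : Φ 0 = 0)
    (hΦ : ∀ᶠ x in 𝓝 (0 : ℂ × ℝ), Φ (x.1, star x.1, (x.2 : ℂ)) = ((φ x : ℝ) : ℂ))
    (hUa : AnalyticAt ℂ U 0) (hU0 : U 0 = 0)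
    (hU : ∀ᶠ x in 𝓝 (0 : ℂ × ℂ × ℂ), U x + I * Φ (x.1, x.2.1, U x) = x.2.2) (r1 : ℝ) (hr1 : 0 < r1) :
    ∃ ε > 0, ∀ k : (ℂ × ℂ) × (ℂ × ℂ) → ℂ, DifferentiableOn ℂ k (ball 0 r1) →
      (∀ p ∈ Mset φ ∩ ball 0 r1, k (p, star p) = 0) →
      ∀ x ∈ ball (0 : ℂ × ℂ × ℂ) ε, k ((x.1, x.2.2), (x.2.1, Tc Φ U x)) = 0 := by
  let m : ℂ × ℂ × ℂ → (ℂ × ℂ) × (ℂ × ℂ) := fun y => ((y.1, y.2.2 + I * Φ y), (y.2.1, y.2.2 - I * Φ y))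
  have hm : AnalyticAt ℂ m 0 := by
    have h3 : ContDiffAt ℂ ω Φ 0 := hΦa.contDiffAt
    exact ContDiffAt.analyticAt (by fun_prop)
  have hm0 : m 0 = 0 := by simp [m, h0]
  have hmt : Tendsto m (𝓝 0) (𝓝 0) := by
    have := hm.continuousAt.tendsto; rwa [hm0] at this
  have ht5 : Tendsto (fun y : ℂ × ℂ × ℂ => (y.1, y.2.2.re)) (𝓝 0) (𝓝 (0 : ℂ × ℝ)) := by
    have : Continuous (fun y : ℂ × ℂ × ℂ => (y.1, y.2.2.re)) := by fun_prop
    exact this.tendsto 0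
  obtain ⟨ρ, hρ, hb⟩ := Metric.eventually_nhds_iff_ball.1
    ((hm.eventually_analyticAt.and (ht5.eventually hΦ)).and (hmt.eventually (ball_mem_nhds _ hr1)))
  have hn : Tendsto (fun x : ℂ × ℂ × ℂ => (x.1, x.2.1, U x)) (𝓝 0) (𝓝 0) := by
    have : ContinuousAt U 0 := hUa.continuousAt
    have : ContinuousAt (fun x : ℂ × ℂ × ℂ => (x.1, x.2.1, U x)) 0 := by fun_prop
    have h := this.tendsto
    rw [hU0] at h
    exact h
  obtain ⟨ε, hε, hb2⟩ := Metric.eventually_nhds_iff_ball.1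
    ((hn.eventually (ball_mem_nhds _ (by positivity : 0 < ρ / 2))).and hU)
  refine ⟨ε, hε, fun k hk hk0 x hx => ?_⟩
  have key := totreal3 (k ∘ m) ρ (hk.comp
    (fun y hy => (hb y hy).1.1.differentiableAt.differentiableWithinAt) (fun y hy => (hb y hy).2)) (by
    intro z u hy
    obtain ⟨⟨-, h5⟩, h6⟩ := hb _ hy
    simp only [ofReal_re] at h5
    have e1 : m (z, star z, (u : ℂ)) = ((z, (u : ℂ) + I * (φ (z, u) : ℂ)), star (z, (u : ℂ) + I * (φ (z, u) : ℂ))) := by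
      simp only [m]; rw [h5]
      ext <;> simp [sub_eq_add_neg]
    simp only [Function.comp]
    rw [e1]
    apply hk0
    refine ⟨by simp [Mset], ?_⟩
    rw [e1] at h6
    rw [dist_zero_right] at h6
    rw [mem_ball_zero_iff]
    exact (norm_fst_le _).trans_lt h6)
  obtain ⟨h7, h8⟩ := hb2 x hx
  have h9 := key _ h7
  simp only [Function.comp] at h9
  rw [← h9]
  congr 1
  simp only [m, Tc, h8]
  congr 2
  linear_combination (-1 : ℂ) * h8
end source
end PartOfD

section PartOfE
open Complex Filter Topology Metric
open scoped ContDiff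

lemma analytic_of_diff_scalar (f : ℂ × ℂ → ℂ) (c : ℂ × ℂ) (h : ∀ᶠ x in 𝓝 c, DifferentiableAt ℂ f x) :
    AnalyticAt ℂ f c := by
  obtain ⟨ρ, hρ, hb⟩ := Metric.eventually_nhds_iff_ball.1 h
  have hsub : ∀ z ∈ closedBall c.1 (ρ / 2), ∀ w ∈ closedBall c.2 (ρ / 2), DifferentiableAt ℂ f (z, w) := by
    intro z hz w hw
    apply hb
    rw [mem_closedBall] at hz hw
    rw [mem_ball, Prod.dist_eq, max_lt_iff]
    constructor
    · simp only; linarith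
    · simp only; linarith
  refine osgood2 f c (ρ / 2) (ρ / 2) (by positivity) (by positivity)
    (fun x hx => (hsub x.1 hx.1 x.2 hx.2).continuousAt.continuousWithinAt) ?_ ?_
  · intro w hw
    refine DifferentiableOn.diffContOnCl_ball (U := closedBall c.1 (ρ / 2)) ?_ le_rfl
    intro z hz
    have := hsub z hz w hw
    exact (this.comp z (f := fun z : ℂ => (z, w)) (by fun_prop)).differentiableWithinAt
  · intro z hz
    refine DifferentiableOn.diffContOnCl_ball (U := closedBall c.2 (ρ / 2)) ?_ le_rfl
    intro w hw
    have := hsub z hz w hw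
    exact (this.comp w (f := fun w : ℂ => (z, w)) (by fun_prop)).differentiableWithinAt

lemma analytic_of_diff (f : ℂ × ℂ → ℂ × ℂ × ℂ) (c : ℂ × ℂ) (h : ∀ᶠ x in 𝓝 c, DifferentiableAt ℂ f x) :
    AnalyticAt ℂ f c := by
  have h1 := analytic_of_diff_scalar (fun x => (f x).1) c (by filter_upwards [h] with x hx; exact hx.fst)
  have h2 := analytic_of_diff_scalar (fun x => (f x).2.1) c (by filter_upwards [h] with x hx; exact hx.snd.fst)
  have h3 := analytic_of_diff_scalar (fun x => (f x).2.2) c (by filter_upwards [h] with x hx; exact hx.snd.snd)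
  exact h1.prod (h2.prod h3)

/-- The conjugate function. -/
noncomputable def cj {E F : Type*} [Star E] [Star F] (f : E → F) : E → F := fun q => star (f (star q))

lemma cj_analytic {f : ℂ × ℂ → ℂ × ℂ × ℂ} {c : ℂ × ℂ} (h : AnalyticAt ℂ f c) :
    AnalyticAt ℂ (cj f) (star c) := by
  apply analytic_of_diff
  have ht : Tendsto (fun q : ℂ × ℂ => star q) (𝓝 (star c)) (𝓝 c) := by
    have := (continuous_star (R := ℂ × ℂ)).tendsto (star c)
    rwa [star_star] at this
  filter_upwards [ht.eventually h.eventually_analyticAt] with x hx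
  have := hx.differentiableAt.star_star
  rw [star_star] at this
  exact this

lemma fderiv_apply_analytic {E F : Type*} [NormedAddCommGroup E] [NormedSpace ℂ E]
    [NormedAddCommGroup F] [NormedSpace ℂ F] [CompleteSpace F] {f : E → F} {x : E} (hf : AnalyticAt ℂ f x) (v : E) :
    AnalyticAt ℂ (fun y => fderiv ℂ f y v) x :=
  ((ContinuousLinearMap.apply ℂ F v).analyticAt _).comp hf.fderiv

section nondeg
variable {φ : ℂ × ℝ → ℝ} {Φ : ℂ × ℂ × ℂ → ℂ}

/-- Polarized CR operator. -/
noncomputable def LL (Φ : ℂ × ℂ × ℂ → ℂ) (k : (ℂ × ℂ) × (ℂ × ℂ) → ℂ × ℂ × ℂ) :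
    (ℂ × ℂ) × (ℂ × ℂ) → ℂ × ℂ × ℂ := fun x =>
  fderiv ℂ (rc Φ) x (0, (0, 1)) • fderiv ℂ k x (0, (1, 0))
    - fderiv ℂ (rc Φ) x (0, (1, 0)) • fderiv ℂ k x (0, (0, 1))

lemma LL_analytic (hΦa : AnalyticAt ℂ Φ 0) {k : (ℂ × ℂ) × (ℂ × ℂ) → ℂ × ℂ × ℂ} (hk : AnalyticAt ℂ k 0) :
    AnalyticAt ℂ (LL Φ k) 0 :=
  ((fderiv_apply_analytic (rc_analytic hΦa) _).smul (fderiv_apply_analytic hk _)).sub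
    ((fderiv_apply_analytic (rc_analytic hΦa) _).smul (fderiv_apply_analytic hk _))

lemma Lop_eq (hΦa : AnalyticAt ℂ Φ 0)
    (hΦ : ∀ᶠ x in 𝓝 (0 : ℂ × ℝ), Φ (x.1, star x.1, (x.2 : ℂ)) = ((φ x : ℝ) : ℂ))
    {k : (ℂ × ℂ) × (ℂ × ℂ) → ℂ × ℂ × ℂ} (hk : AnalyticAt ℂ k 0) {G : ℂ × ℂ → ℂ × ℂ × ℂ}
    (hG : ∀ᶠ p in 𝓝 0, G p = k (p, star p)) :
    ∀ᶠ p in 𝓝 0, Lop φ G p = LL Φ k (p, star p) := by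
  filter_upwards [star_cont_zero.eventually (rc_analytic hΦa).eventually_analyticAt,
    star_cont_zero.eventually hk.eventually_analyticAt, (rc_diag hΦ).eventually_nhds, hG.eventually_nhds]
    with p h1 h2 h3 h4
  have hc : rhoC φ =ᶠ[𝓝 p] fun q => rc Φ (q, star q) := by
    filter_upwards [h3] with x hx; exact hx.symm
  have hc2 : G =ᶠ[𝓝 p] fun q => k (q, star q) := h4
  unfold Lop LL
  rw [wDerBar_congr hc, wDerBar_congr hc, wDerBar_congr hc2, wDerBar_congr hc2,
    wDerBar_eq h1.differentiableAt, wDerBar_eq h1.differentiableAt,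
    wDerBar_eq h2.differentiableAt, wDerBar_eq h2.differentiableAt]
  have e1 : star ((0, 1) : ℂ × ℂ) = (0, 1) := by ext <;> simp
  have e2 : star ((1, 0) : ℂ × ℂ) = (1, 0) := by ext <;> simp
  rw [e1, e2]

lemma LL_curve (hΦa : AnalyticAt ℂ Φ 0) {θ : ℂ → ℂ} (hθ : AnalyticAt ℂ θ 0) (hθ0 : θ 0 = 0)
    (hr : ∀ᶠ s in 𝓝 (0:ℂ), rc Φ (0, (s, θ s)) = 0)
    {k : (ℂ × ℂ) × (ℂ × ℂ) → ℂ × ℂ × ℂ} (hk : AnalyticAt ℂ k 0) (l : ℂ × ℂ × ℂ →L[ℂ] ℂ)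
    (hl : ∀ᶠ s in 𝓝 (0:ℂ), l (k (0, (s, θ s))) = 0) :
    ∀ᶠ s in 𝓝 (0:ℂ), l (LL Φ k (0, (s, θ s))) = 0 := by
  have ht : Tendsto (fun s : ℂ => (((0, 0), (s, θ s)) : (ℂ × ℂ) × (ℂ × ℂ))) (𝓝 0) (𝓝 0) := by
    have h1 : ContinuousAt θ 0 := hθ.continuousAt
    have : ContinuousAt (fun s : ℂ => (((0, 0), (s, θ s)) : (ℂ × ℂ) × (ℂ × ℂ))) 0 := by fun_prop
    have h := this.tendsto
    rw [hθ0] at h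
    exact h
  filter_upwards [ht.eventually (rc_analytic hΦa).eventually_analyticAt,
    ht.eventually hk.eventually_analyticAt, hr.eventually_nhds, hl.eventually_nhds, hθ.eventually_analyticAt]
    with s h1 h2 h3 h4 h5
  have hγ : HasDerivAt (fun s : ℂ => (((0, 0), (s, θ s)) : (ℂ × ℂ) × (ℂ × ℂ))) ((0, 0), (1, deriv θ s)) s :=
    (hasDerivAt_const s ((0, 0) : ℂ × ℂ)).prodMk ((hasDerivAt_id s).prodMk h5.differentiableAt.hasDerivAt)
  have d1 := h1.differentiableAt.hasFDerivAt.comp_hasDerivAt s hγ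
  have d2 := l.hasFDerivAt.comp_hasDerivAt s (h2.differentiableAt.hasFDerivAt.comp_hasDerivAt s hγ)
  have z1 : HasDerivAt (rc Φ ∘ fun s : ℂ => (((0, 0), (s, θ s)) : (ℂ × ℂ) × (ℂ × ℂ))) 0 s := by
    refine (hasDerivAt_const s (0:ℂ)).congr_of_eventuallyEq ?_
    filter_upwards [h3] with x hx; exact hx
  have z2 : HasDerivAt (l ∘ k ∘ fun s : ℂ => (((0, 0), (s, θ s)) : (ℂ × ℂ) × (ℂ × ℂ))) 0 s := by
    refine (hasDerivAt_const s (0:ℂ)).congr_of_eventuallyEq ?_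
    filter_upwards [h4] with x hx; exact hx
  have u1 := d1.unique z1
  have u2 := d2.unique z2
  have e : (((0, 0), (1, deriv θ s)) : (ℂ × ℂ) × (ℂ × ℂ)) = (0, (1, 0)) + deriv θ s • (0, (0, 1)) := by
    ext <;> simp
  rw [e, map_add, map_smul] at u1 u2
  rw [map_add, map_smul] at u2
  simp only [smul_eq_mul] at u1 u2
  unfold LL
  rw [map_sub, map_smul, map_smul]
  simp only [smul_eq_mul]
  change fderiv ℂ (rc Φ) ((0,0), (s, θ s)) _ * _ - fderiv ℂ (rc Φ) ((0,0), (s, θ s)) _ * _ = 0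
  linear_combination (fderiv ℂ (rc Φ) ((0,0), (s, θ s)) (0, (0, 1))) * u2 -
    (l (fderiv ℂ k ((0,0), (s, θ s)) (0, (0, 1)))) * u1

lemma N0 {ψ : ℂ × ℂ × ℝ → ℝ} {Ψ : ℂ × ℂ × ℂ × ℂ × ℂ → ℂ} {H : ℂ × ℂ → ℂ × ℂ × ℂ}
    (hΦa : AnalyticAt ℂ Φ 0)
    (hΦ : ∀ᶠ x in 𝓝 (0 : ℂ × ℝ), Φ (x.1, star x.1, (x.2 : ℂ)) = ((φ x : ℝ) : ℂ))
    (hΨa : AnalyticAt ℂ Ψ 0)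
    (hΨ : ∀ᶠ x in 𝓝 (0 : ℂ × ℂ × ℝ), Ψ (x.1, x.2.1, star x.1, star x.2.1, (x.2.2 : ℂ)) = ((ψ x : ℝ) : ℂ))
    (hHa : AnalyticAt ℂ H 0) (hH0 : H 0 = 0)
    (hnd : TwoNondegAt φ ψ H)
    {θ : ℂ → ℂ} (hθ : AnalyticAt ℂ θ 0) (hθ0 : θ 0 = 0)
    (hr : ∀ᶠ s in 𝓝 (0:ℂ), rc Φ (0, (s, θ s)) = 0) (d : ℂ × ℂ × ℂ)
    (hd : ∀ᶠ s in 𝓝 (0:ℂ), fderiv ℂ (Rc Ψ) (0, cj H (s, θ s)) (d, 0) = 0) : d = 0 := by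
  have hHs : AnalyticAt ℂ (cj H) 0 := by simpa using cj_analytic hHa
  have hHs0 : cj H 0 = 0 := by simp [cj, hH0]
  let m : (ℂ × ℂ) × (ℂ × ℂ) → (ℂ × ℂ × ℂ) × (ℂ × ℂ × ℂ) := fun x => (H x.1, cj H x.2)
  have hm : AnalyticAt ℂ m 0 := by
    refine AnalyticAt.prod ?_ ?_
    · exact AnalyticAt.comp (g := H) (f := Prod.fst) (x := (0 : (ℂ × ℂ) × (ℂ × ℂ))) hHa analyticAt_fst
    · exact AnalyticAt.comp (g := cj H) (f := Prod.snd) (x := (0 : (ℂ × ℂ) × (ℂ × ℂ))) hHs analyticAt_snd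
  have hm0 : m 0 = 0 := by simp [m, hH0, hHs0]
  let K : (ℂ × ℂ) × (ℂ × ℂ) → ℂ × ℂ × ℂ := fun x =>
    (fderiv ℂ (Rc Ψ) (m x) ((1, 0, 0), 0), fderiv ℂ (Rc Ψ) (m x) ((0, 1, 0), 0), fderiv ℂ (Rc Ψ) (m x) ((0, 0, 1), 0))
  have hKc : ∀ v, AnalyticAt ℂ (fun x => fderiv ℂ (Rc Ψ) (m x) v) 0 := fun v =>
    AnalyticAt.comp (g := fun y => fderiv ℂ (Rc Ψ) y v) (f := m)
      (by rw [hm0]; exact fderiv_apply_analytic (Rc_analytic hΨa) v) hm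
  have hK : AnalyticAt ℂ K 0 := (hKc _).prod ((hKc _).prod (hKc _))
  have hG : ∀ᶠ p in 𝓝 0, gradRho' ψ (H p) = K (p, star p) := by
    have ht : Tendsto H (𝓝 0) (𝓝 0) := by have := hHa.continuousAt.tendsto; rwa [hH0] at this
    filter_upwards [ht.eventually (gradRho_eq hΨa hΨ)] with p hp
    rw [hp]
    simp [K, m, cj]
  have hG1 := Lop_eq hΦa hΦ hK hG
  have hK1 := LL_analytic hΦa hK
  have hG2 := Lop_eq hΦa hΦ hK1 hG1
  have hK2 := LL_analytic hΦa hK1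
  let l : ℂ × ℂ × ℂ →L[ℂ] ℂ := LinearMap.toContinuousLinearMap
    { toFun := fun x => d.1 * x.1 + d.2.1 * x.2.1 + d.2.2 * x.2.2
      map_add' := by intro x y; simp; ring
      map_smul' := by intro c x; simp; ring }
  have hlv : ∀ x, l x = d.1 * x.1 + d.2.1 * x.2.1 + d.2.2 * x.2.2 := fun x => rfl
  have c0 : ∀ᶠ s in 𝓝 (0:ℂ), l (K (0, (s, θ s))) = 0 := by
    filter_upwards [hd] with s hs
    rw [← hs, hlv]
    have : ((d, 0) : (ℂ × ℂ × ℂ) × (ℂ × ℂ × ℂ)) = d.1 • ((1, 0, 0), 0) + d.2.1 • ((0, 1, 0), 0) + d.2.2 • ((0, 0, 1), 0) := by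
      ext <;> simp
    rw [this, map_add, map_add, map_smul, map_smul, map_smul]
    simp [K, m, hH0]
  have c1 := LL_curve hΦa hθ hθ0 hr hK l c0
  have c2 := LL_curve hΦa hθ hθ0 hr hK1 l c1
  have z0 := c0.self_of_nhds
  have z1 := c1.self_of_nhds
  have z2 := c2.self_of_nhds
  have g0 := hG.self_of_nhds
  have g1 := hG1.self_of_nhds
  have g2 := hG2.self_of_nhds
  rw [hθ0] at z0 z1 z2
  rw [star_zero] at g0 g1 g2
  have hle : Submodule.span ℂ {gradRho' ψ (H 0), Lop φ (fun p => gradRho' ψ (H p)) 0,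
      Lop φ (Lop φ (fun p => gradRho' ψ (H p))) 0} ≤ LinearMap.ker (l : ℂ × ℂ × ℂ →ₗ[ℂ] ℂ) := by
    rw [Submodule.span_le]
    rintro x (rfl | rfl | rfl)
    · rw [g0]; exact z0
    · rw [g1]; exact z1
    · rw [g2]; exact z2
  rw [hnd.1] at hle
  have hz : ∀ x, l x = 0 := fun x => hle (Submodule.mem_top (x := x))
  have d1 := hz (1, 0, 0)
  have d2 := hz (0, 1, 0)
  have d3 := hz (0, 0, 1)
  simp [hlv] at d1 d2 d3
  ext <;> simp [d1, d2, d3]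
end nondeg
end PartOfE

section PartOfF
open Complex Filter Topology Metric
open scoped ContDiff

/-- abstract finite-nondegeneracy propagation -/
lemma N_abs {P : Type*} [NormedAddCommGroup P] [NormedSpace ℂ P]
    (q : P × ℂ → ((ℂ × ℂ × ℂ) →L[ℂ] ℂ)) (hq : AnalyticAt ℂ q 0)
    (h : ∀ d, (∀ᶠ s in 𝓝 (0:ℂ), q (0, s) d = 0) → d = 0) :
    ∃ ε > (0:ℝ), ∀ᶠ p in 𝓝 (0:P), ∀ s0 ∈ ball (0:ℂ) ε, ∀ d ≠ 0, ∃ᶠ s in 𝓝 s0, q (p, s) d ≠ 0 := by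
  obtain ⟨ε, hε, hball⟩ := Metric.eventually_nhds_iff_ball.1 hq.eventually_analyticAt
  refine ⟨ε, hε, ?_⟩
  have key : ∀ᶠ p in 𝓝 (0:P), ∀ d ∈ sphere (0 : ℂ × ℂ × ℂ) 1, ∃ s ∈ ball (0:ℂ) ε, q (p, s) d ≠ 0 := by
    refine IsCompact.eventually_forall_of_forall_eventually (isCompact_sphere _ _) ?_
    intro d hd
    have hd0 : d ≠ 0 := by
      rintro rfl
      simp at hd
    have h1 : ∃ᶠ s in 𝓝 (0:ℂ), q (0, s) d ≠ 0 := by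
      intro hcon
      exact hd0 (h d (by simpa using hcon))
    obtain ⟨s, hs, hsε⟩ := (h1.and_eventually (ball_mem_nhds (0:ℂ) hε)).exists
    have hcq : ContinuousAt q (0, s) := (hball (0, s) (by
      rw [mem_ball_zero_iff, Prod.norm_mk] ; simpa [hε] using hsε)).continuousAt
    have hc : ContinuousAt (fun x : P × (ℂ × ℂ × ℂ) => q (x.1, s) x.2) (0, d) := by
      have h1 : ContinuousAt (fun x : P × (ℂ × ℂ × ℂ) => q (x.1, s)) (0, d) :=
        ContinuousAt.comp (f := fun x : P × (ℂ × ℂ × ℂ) => (x.1, s)) (g := q) hcq (by fun_prop)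
      exact h1.clm_apply continuousAt_snd
    filter_upwards [hc.eventually_ne hs] with x hx
    exact ⟨s, hsε, hx⟩
  filter_upwards [key, ball_mem_nhds (0:P) hε] with p hp hpε s0 hs0 d hd hcon
  obtain ⟨s, hs, hsd⟩ := hp ((‖d‖⁻¹ : ℂ) • d) (by
    rw [mem_sphere_zero_iff_norm, norm_smul]; simp [hd])
  have han : AnalyticOnNhd ℂ (fun s => q (p, s) d) (ball 0 ε) := by
    intro t ht
    have h2 : AnalyticAt ℂ q (p, t) := hball _ (by
      rw [mem_ball_zero_iff, Prod.norm_mk]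
      rw [mem_ball_zero_iff] at ht hpε
      exact max_lt hpε ht)
    have h3 : AnalyticAt ℂ (fun s => q (p, s)) t :=
      AnalyticAt.comp (g := q) (f := fun s => (p, s)) h2 (analyticAt_const.prod analyticAt_id)
    exact (ContinuousLinearMap.apply ℂ ℂ d).analyticAt _ |>.comp h3
  have := han.eqOn_zero_of_preconnected_of_eventuallyEq_zero (convex_ball _ _).isPreconnected hs0
    (by filter_upwards [hcon] with t ht; simpa using ht) hs
  apply hsd
  rw [map_smul]
  simp only at this
  rw [this]; simp
end PartOfF

section PartOfG
open Complex Filter Topology Metric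
open scoped ContDiff

structure Setup (φ : ℂ × ℝ → ℝ) (ψ : ℂ × ℂ × ℝ → ℝ) (H : ℂ × ℂ → ℂ × ℂ × ℂ)
    (Φ : ℂ × ℂ × ℂ → ℂ) (Ψ : ℂ × ℂ × ℂ × ℂ × ℂ → ℂ) (U : ℂ × ℂ × ℂ → ℂ) : Prop where
  hΦa : AnalyticAt ℂ Φ 0
  hΦ0 : Φ 0 = 0
  hΦ1 : fderiv ℂ Φ 0 = 0
  hΦ : ∀ᶠ x in 𝓝 (0 : ℂ × ℝ), Φ (x.1, star x.1, (x.2 : ℂ)) = ((φ x : ℝ) : ℂ)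
  hUa : AnalyticAt ℂ U 0
  hU0 : U 0 = 0
  hU : ∀ᶠ x in 𝓝 (0 : ℂ × ℂ × ℂ), U x + I * Φ (x.1, x.2.1, U x) = x.2.2
  hΨa : AnalyticAt ℂ Ψ 0
  hΨ0 : Ψ 0 = 0
  hΨ1 : fderiv ℂ Ψ 0 = 0
  hΨ : ∀ᶠ x in 𝓝 (0 : ℂ × ℂ × ℝ), Ψ (x.1, x.2.1, star x.1, star x.2.1, (x.2.2 : ℂ)) = ((ψ x : ℝ) : ℂ)
  hHa : AnalyticAt ℂ H 0
  hH0 : H 0 = 0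
  hHmap : ∀ᶠ p in 𝓝 (0 : ℂ × ℂ), p ∈ Mset φ → H p ∈ M'set ψ
  hHtr : TransversalAt H
  hnd : TwoNondegAt φ ψ H

variable {φ : ℂ × ℝ → ℝ} {ψ : ℂ × ℂ × ℝ → ℝ} {H : ℂ × ℂ → ℂ × ℂ × ℂ}
    {Φ : ℂ × ℂ × ℂ → ℂ} {Ψ : ℂ × ℂ × ℂ × ℂ × ℂ → ℂ} {U : ℂ × ℂ × ℂ → ℂ}

noncomputable abbrev pr21 : ℂ × ℂ × ℂ →L[ℂ] ℂ := (ContinuousLinearMap.fst ℂ ℂ ℂ).comp (ContinuousLinearMap.snd ℂ ℂ (ℂ × ℂ))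
noncomputable abbrev pr22 : ℂ × ℂ × ℂ →L[ℂ] ℂ := (ContinuousLinearMap.snd ℂ ℂ ℂ).comp (ContinuousLinearMap.snd ℂ ℂ (ℂ × ℂ))

lemma cj_diff {h : ℂ × ℂ → ℂ × ℂ × ℂ} {q : ℂ × ℂ} (hh : DifferentiableAt ℂ h (star q)) :
    DifferentiableAt ℂ (cj h) q := by
  have := hh.star_star
  rw [star_star] at this
  exact this

lemma Setup.refl_map (S : Setup φ ψ H Φ Ψ U) : ∃ c1 > (0:ℝ), ∀ r1 > (0:ℝ), ∃ ε > (0:ℝ),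
    ∀ h : ℂ × ℂ → ℂ × ℂ × ℂ, DifferentiableOn ℂ h (ball 0 r1) →
      (∀ p ∈ Mset φ ∩ ball 0 r1, h p ∈ M'set ψ) → (∀ p ∈ ball (0 : ℂ × ℂ) r1, ‖h p‖ < c1) →
      ∀ x ∈ ball (0 : ℂ × ℂ × ℂ) ε, Rc Ψ (h (x.1, x.2.2), cj h (x.2.1, Tc Φ U x)) = 0 := by
  obtain ⟨c, hc, hcb⟩ := Metric.eventually_nhds_iff_ball.1 (Rc_analytic S.hΨa).eventually_analyticAt
  obtain ⟨c', hc', hcb'⟩ := Metric.eventually_nhds_iff_ball.1 (Rc_diag S.hΨ)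
  refine ⟨min c c', lt_min hc hc', fun r1 hr1 => ?_⟩
  obtain ⟨ε, hε, hrefl⟩ := refl_uniform S.hΦa S.hΦ0 S.hΦ S.hUa S.hU0 S.hU r1 hr1
  refine ⟨ε, hε, fun h hd hM hb x hx => ?_⟩
  refine hrefl (fun y => Rc Ψ (h y.1, cj h y.2)) ?_ ?_ x hx
  · intro y hy
    rw [mem_ball_zero_iff] at hy
    have h1 : y.1 ∈ ball (0 : ℂ × ℂ) r1 := by
      rw [mem_ball_zero_iff]; exact (norm_fst_le y).trans_lt hy
    have h2 : star y.2 ∈ ball (0 : ℂ × ℂ) r1 := by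
      rw [mem_ball_zero_iff, norm_star]; exact (norm_snd_le y).trans_lt hy
    have hd1 : DifferentiableAt ℂ h y.1 := (hd _ h1).differentiableAt (isOpen_ball.mem_nhds h1)
    have hd2 : DifferentiableAt ℂ (cj h) y.2 := cj_diff ((hd _ h2).differentiableAt (isOpen_ball.mem_nhds h2))
    have hR : DifferentiableAt ℂ (Rc Ψ) (h y.1, cj h y.2) := by
      refine (hcb _ ?_).differentiableAt
      rw [mem_ball_zero_iff, Prod.norm_mk]
      refine max_lt ((hb _ h1).trans_le (min_le_left _ _)) ?_
      simp only [cj, norm_star]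
      exact (hb _ h2).trans_le (min_le_left _ _)
    refine DifferentiableAt.differentiableWithinAt ?_
    refine DifferentiableAt.comp (g := Rc Ψ) (f := fun y : (ℂ × ℂ) × (ℂ × ℂ) => (h y.1, cj h y.2)) y hR ?_
    exact (DifferentiableAt.comp (g := h) y hd1 differentiableAt_fst).prodMk (DifferentiableAt.comp (g := cj h) y hd2 differentiableAt_snd)
  · intro p hp
    have := hM p hp
    have hq := hcb' (h p) (by rw [mem_ball_zero_iff]; exact (hb _ hp.2).trans_le (min_le_right _ _))
    simp only [cj, star_star]
    rw [hq]
    have h3 : (h p).2.2.im = ψ ((h p).1, (h p).2.1, (h p).2.2.re) := this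
    simp [rhoC', h3]

lemma Setup.refl_H (S : Setup φ ψ H Φ Ψ U) : ∀ᶠ x in 𝓝 (0 : ℂ × ℂ × ℂ),
    Rc Ψ (H (x.1, x.2.2), cj H (x.2.1, Tc Φ U x)) = 0 := by
  obtain ⟨c1, hc1, hr⟩ := S.refl_map
  have ht : Tendsto H (𝓝 0) (𝓝 0) := by have := S.hHa.continuousAt.tendsto; rwa [S.hH0] at this
  obtain ⟨r1, hr1, hb⟩ := Metric.eventually_nhds_iff_ball.1
    (S.hHa.eventually_analyticAt.and (S.hHmap.and (ht.eventually (ball_mem_nhds 0 hc1))))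
  obtain ⟨ε, hε, h⟩ := hr r1 hr1
  filter_upwards [ball_mem_nhds _ hε] with x hx
  refine h H (fun p hp => (hb p hp).1.differentiableAt.differentiableWithinAt) (fun p hp => (hb p hp.2).2.1 hp.1)
    (fun p hp => ?_) x hx
  simpa using (hb p hp).2.2

lemma Setup.Tc_deriv (S : Setup φ ψ H Φ Ψ U) (v : ℂ × ℂ × ℂ) : fderiv ℂ (Tc Φ U) 0 v = v.2.2 := by
  have h1 : HasFDerivAt (fun x : ℂ × ℂ × ℂ => (x.1, x.2.1, U x))
      ((ContinuousLinearMap.fst ℂ ℂ (ℂ × ℂ)).prod (pr21.prod (fderiv ℂ U 0))) 0 := by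
    refine hasFDerivAt_fst.prodMk (HasFDerivAt.prodMk ?_ S.hUa.differentiableAt.hasFDerivAt)
    exact pr21.hasFDerivAt
  have h2 : HasFDerivAt Φ (0 : ℂ × ℂ × ℂ →L[ℂ] ℂ) ((fun x : ℂ × ℂ × ℂ => (x.1, x.2.1, U x)) 0) := by
    have e : ((fun x : ℂ × ℂ × ℂ => (x.1, x.2.1, U x)) 0) = 0 := by simp [S.hU0]
    rw [e, ← S.hΦ1]; exact S.hΦa.differentiableAt.hasFDerivAt
  have h3 := h2.comp (0 : ℂ × ℂ × ℂ) h1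
  have h4 : HasFDerivAt (fun x : ℂ × ℂ × ℂ => x.2.2) pr22 0 :=
    pr22.hasFDerivAt
  have h5 := h4.sub (h3.const_mul (2 * I))
  have h6 : HasFDerivAt (Tc Φ U) _ 0 := h5
  rw [h6.fderiv]; simp

lemma Setup.cjH_analytic (S : Setup φ ψ H Φ Ψ U) : AnalyticAt ℂ (cj H) 0 := by
  simpa using cj_analytic S.hHa

lemma Setup.cjH_zero (S : Setup φ ψ H Φ Ψ U) : cj H 0 = 0 := by simp [cj, S.hH0]

lemma Setup.Tc_an (S : Setup φ ψ H Φ Ψ U) : AnalyticAt ℂ (Tc Φ U) 0 := Tc_analytic S.hΦa S.hUa S.hU0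
lemma Setup.Tc_0 (S : Setup φ ψ H Φ Ψ U) : Tc Φ U 0 = 0 := Tc_zero S.hΦ0 S.hU0

lemma Setup.fderiv_refl (S : Setup φ ψ H Φ Ψ U) (v : ℂ × ℂ × ℂ) :
    (fderiv ℂ H 0 (v.1, v.2.2)).2.2 = (fderiv ℂ (cj H) 0 (v.2.1, v.2.2)).2.2 := by
  let L1 : ℂ × ℂ × ℂ →L[ℂ] ℂ × ℂ := (ContinuousLinearMap.fst ℂ ℂ (ℂ × ℂ)).prod pr22
  have h1 : HasFDerivAt (fun x : ℂ × ℂ × ℂ => H (x.1, x.2.2)) ((fderiv ℂ H 0).comp L1) 0 :=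
    HasFDerivAt.comp (g := H) (f := fun x : ℂ × ℂ × ℂ => (x.1, x.2.2)) 0 S.hHa.differentiableAt.hasFDerivAt L1.hasFDerivAt
  have h2' : HasFDerivAt (fun x : ℂ × ℂ × ℂ => (x.2.1, Tc Φ U x)) (pr21.prod (fderiv ℂ (Tc Φ U) 0)) 0 :=
    HasFDerivAt.prodMk pr21.hasFDerivAt S.Tc_an.differentiableAt.hasFDerivAt
  have h2 := HasFDerivAt.comp (g := cj H) (f := fun x : ℂ × ℂ × ℂ => (x.2.1, Tc Φ U x)) 0
    (g' := fderiv ℂ (cj H) 0) (by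
      have e : ((fun x : ℂ × ℂ × ℂ => (x.2.1, Tc Φ U x)) 0) = 0 := by simp [S.Tc_0]
      simp only at e
      rw [e]; exact S.cjH_analytic.differentiableAt.hasFDerivAt) h2'
  have h3 := h1.prodMk h2
  have h4 := HasFDerivAt.comp (g := Rc Ψ) (g' := fderiv ℂ (Rc Ψ) 0) 0 (by
      have e : (fun x : ℂ × ℂ × ℂ => (H (x.1, x.2.2), (cj H ∘ fun x : ℂ × ℂ × ℂ => (x.2.1, Tc Φ U x)) x)) 0 = 0 := by
        change (H 0, cj H (0, Tc Φ U 0)) = 0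
        rw [S.hH0, S.Tc_0, show ((0:ℂ),(0:ℂ)) = 0 from rfl, S.cjH_zero]; rfl
      simp only at e
      rw [e]; exact (Rc_analytic S.hΨa).differentiableAt.hasFDerivAt) h3
  have h5 := h4.congr_of_eventuallyEq (f₁ := fun _ => (0:ℂ)) (by
    filter_upwards [S.refl_H] with x hx using hx.symm)
  have h6 := h5.unique (hasFDerivAt_const _ _)
  have h7 := congrArg (fun L => L v) h6
  simp only [ContinuousLinearMap.comp_apply, zero_apply] at h7
  rw [Rc_fderiv S.hΨa S.hΨ1] at h7
  simp [S.Tc_deriv, L1] at h7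
  linear_combination h7

lemma cj_fderiv {h : ℂ × ℂ → ℂ × ℂ × ℂ} (hh : DifferentiableAt ℂ h 0) (v : ℂ × ℂ) :
    fderiv ℂ (cj h) 0 v = star (fderiv ℂ h 0 (star v)) := by
  have h1 : HasFDerivAt h (fderiv ℂ h 0) (star (0 : ℂ × ℂ)) := by simpa using hh.hasFDerivAt
  have h2 := h1.star_star
  simp only [star_zero] at h2
  have h3 : HasFDerivAt (cj h) _ 0 := h2
  rw [h3.fderiv]
  rfl

lemma Setup.dw_ne (S : Setup φ ψ H Φ Ψ U) : (fderiv ℂ (cj H) 0 (0, 1)).2.2 ≠ 0 := by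
  have hz : (fderiv ℂ H 0 (1, 0)).2.2 = 0 := by
    have := S.fderiv_refl (1, 0, 0)
    rw [this]
    change (fderiv ℂ (cj H) 0 0).2.2 = 0
    simp
  have e : ∀ v, fderiv ℂ (fun p => (H p).2.2) 0 v = (fderiv ℂ H 0 v).2.2 := by
    intro v
    have h1 : HasFDerivAt (fun p => (H p).2.2) (pr22.comp (fderiv ℂ H 0)) 0 :=
      pr22.hasFDerivAt.comp (0 : ℂ × ℂ) S.hHa.differentiableAt.hasFDerivAt
    rw [h1.fderiv]; rfl
  have ht := S.hHtr
  rw [TransversalAt, e, e, hz] at ht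
  intro h
  apply ht
  rw [cj_fderiv S.hHa.differentiableAt] at h
  have h9 : star (((0:ℂ),(1:ℂ))) = (0,1) := by ext <;> simp
  rw [h9] at h
  simp at h
  rw [h]
end PartOfG

section PartOfH
open Complex Filter Topology Metric
open scoped ContDiff

variable {φ : ℂ × ℝ → ℝ} {ψ : ℂ × ℂ × ℝ → ℝ} {H : ℂ × ℂ → ℂ × ℂ × ℂ}
    {Φ : ℂ × ℂ × ℂ → ℂ} {Ψ : ℂ × ℂ × ℂ × ℂ × ℂ → ℂ} {U : ℂ × ℂ × ℂ → ℂ}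

lemma Setup.dR_analytic (S : Setup φ ψ H Φ Ψ U) {P : Type*} [NormedAddCommGroup P] [NormedSpace ℂ P]
    {m : P → (ℂ × ℂ × ℂ) × (ℂ × ℂ × ℂ)} (hm : AnalyticAt ℂ m 0) (hm0 : m 0 = 0) :
    AnalyticAt ℂ (fun p => (fderiv ℂ (Rc Ψ) (m p)).comp (ContinuousLinearMap.inl ℂ (ℂ × ℂ × ℂ) (ℂ × ℂ × ℂ))) 0 := by
  have h1 : AnalyticAt ℂ (fun p => fderiv ℂ (Rc Ψ) (m p)) 0 :=
    AnalyticAt.comp (g := fderiv ℂ (Rc Ψ)) (f := m) (by rw [hm0]; exact (Rc_analytic S.hΨa).fderiv) hm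
  let L := (ContinuousLinearMap.compL ℂ (ℂ × ℂ × ℂ) ((ℂ × ℂ × ℂ) × (ℂ × ℂ × ℂ)) ℂ).flip (ContinuousLinearMap.inl ℂ (ℂ × ℂ × ℂ) (ℂ × ℂ × ℂ))
  exact (L.analyticAt _).comp h1

lemma Setup.theta (S : Setup φ ψ H Φ Ψ U) : AnalyticAt ℂ (fun s => Tc Φ U (0, s, 0)) 0 ∧
    ∀ᶠ s in 𝓝 (0:ℂ), rc Φ (0, (s, Tc Φ U (0, s, 0))) = 0 := by
  have h0 : AnalyticAt ℂ (fun s : ℂ => ((0:ℂ), s, (0:ℂ))) 0 :=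
    analyticAt_const.prod (analyticAt_id.prod analyticAt_const)
  refine ⟨AnalyticAt.comp (g := Tc Φ U) (f := fun s : ℂ => ((0:ℂ), s, (0:ℂ))) S.Tc_an h0, ?_⟩
  have ht : Tendsto (fun s : ℂ => ((0:ℂ), s, (0:ℂ))) (𝓝 0) (𝓝 0) := h0.continuousAt
  filter_upwards [ht.eventually S.hU] with s hs
  exact rc_Tc (0, s, 0) hs

lemma Setup.N0' (S : Setup φ ψ H Φ Ψ U) (d : ℂ × ℂ × ℂ)
    (hd : ∀ᶠ s in 𝓝 (0:ℂ), fderiv ℂ (Rc Ψ) (0, cj H (s, Tc Φ U (0, s, 0))) (d, 0) = 0) : d = 0 :=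
  N0 S.hΦa S.hΦ S.hΨa S.hΨ S.hHa S.hH0 S.hnd (θ := fun s => Tc Φ U (0, s, 0)) S.theta.1 S.Tc_0 S.theta.2 d hd

lemma Setup.N (S : Setup φ ψ H Φ Ψ U) : ∃ ε > (0:ℝ), ∀ᶠ p in 𝓝 (0 : ℂ × ℂ), ∀ s0 ∈ ball (0:ℂ) ε, ∀ d ≠ 0,
    ∃ᶠ s in 𝓝 s0, fderiv ℂ (Rc Ψ) (H p, cj H (s, Tc Φ U (p.1, s, p.2))) (d, 0) ≠ 0 := by
  let m : (ℂ × ℂ) × ℂ → (ℂ × ℂ × ℂ) × (ℂ × ℂ × ℂ) := fun x => (H x.1, cj H (x.2, Tc Φ U (x.1.1, x.2, x.1.2)))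
  have hx : AnalyticAt ℂ (fun x : (ℂ × ℂ) × ℂ => (x.1.1, x.2, x.1.2)) 0 :=
    ContDiffAt.analyticAt (by fun_prop)
  have hT : AnalyticAt ℂ (fun x : (ℂ × ℂ) × ℂ => Tc Φ U (x.1.1, x.2, x.1.2)) 0 :=
    AnalyticAt.comp (g := Tc Φ U) (f := fun x : (ℂ × ℂ) × ℂ => (x.1.1, x.2, x.1.2)) S.Tc_an hx
  have hT0 : Tc Φ U (0, 0, 0) = 0 := S.Tc_0
  have hm : AnalyticAt ℂ m 0 := by
    refine AnalyticAt.prod ?_ ?_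
    · exact AnalyticAt.comp (g := H) (f := Prod.fst) (x := (0 : (ℂ × ℂ) × ℂ)) S.hHa analyticAt_fst
    · refine AnalyticAt.comp (g := cj H) (f := fun x : (ℂ × ℂ) × ℂ => (x.2, Tc Φ U (x.1.1, x.2, x.1.2))) ?_ (analyticAt_snd.prod hT)
      change AnalyticAt ℂ (cj H) (0, Tc Φ U (0, 0, 0))
      rw [hT0]; exact S.cjH_analytic
  have hm0 : m 0 = 0 := by
    change (H 0, cj H (0, Tc Φ U (0, 0, 0))) = 0
    rw [hT0, S.hH0, show ((0:ℂ),(0:ℂ)) = 0 from rfl, S.cjH_zero]; rfl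
  refine N_abs _ (S.dR_analytic hm hm0) ?_
  intro d hd
  refine S.N0' d ?_
  filter_upwards [hd] with s hs
  simpa [m, S.hH0] using hs

lemma Setup.inj (S : Setup φ ψ H Φ Ψ U) {X : ℂ × ℂ × ℂ → ℂ × ℂ × ℂ} (hX : AnalyticAt ℂ X 0)
    (hXM : ∀ᶠ q in 𝓝 (0 : ℂ × ℂ × ℂ), q ∈ M'set ψ →
        ((X q).1 * (gradRho' ψ q).1 + (X q).2.1 * (gradRho' ψ q).2.1
          + (X q).2.2 * (gradRho' ψ q).2.2).re = 0)
    (hXH : ∀ᶠ p in 𝓝 (0 : ℂ × ℂ), X (H p) = 0) : ∀ᶠ q in 𝓝 0, X q = 0 := by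
  let J : (ℂ × ℂ × ℂ) × (ℂ × ℂ × ℂ) → ℂ := fun x => fderiv ℂ (Rc Ψ) x (X x.1, star (X (star x.2)))
  have hstar : Tendsto (star : ℂ × ℂ × ℂ → ℂ × ℂ × ℂ) (𝓝 0) (𝓝 0) := by
    have := (continuous_star : Continuous (star : ℂ × ℂ × ℂ → ℂ × ℂ × ℂ)).tendsto 0
    simpa using this
  have hfst : Tendsto (Prod.fst : (ℂ × ℂ × ℂ) × (ℂ × ℂ × ℂ) → _) (𝓝 0) (𝓝 0) := continuous_fst.tendsto 0
  have hsnd : Tendsto (Prod.snd : (ℂ × ℂ × ℂ) × (ℂ × ℂ × ℂ) → _) (𝓝 0) (𝓝 0) := continuous_snd.tendsto 0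
  have hJ : ∀ᶠ x in 𝓝 0, DifferentiableAt ℂ J x := by
    filter_upwards [(Rc_analytic S.hΨa).fderiv.eventually_analyticAt, hfst.eventually hX.eventually_analyticAt,
      (hstar.comp hsnd).eventually hX.eventually_analyticAt] with x h1 h2 h3
    refine h1.differentiableAt.clm_apply (DifferentiableAt.prodMk ?_ ?_)
    · exact DifferentiableAt.comp (g := X) x h2.differentiableAt differentiableAt_fst
    · have h4 : DifferentiableAt ℂ X (star x.2) := h3.differentiableAt
      have h5 := h4.star_star
      rw [star_star] at h5
      exact DifferentiableAt.comp (g := star ∘ X ∘ star) x h5 differentiableAt_snd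
  have hJ0 : ∀ᶠ q in 𝓝 (0 : ℂ × ℂ × ℂ), q ∈ M'set ψ → J (q, star q) = 0 := by
    filter_upwards [hXM, diag_real S.hΨa S.hΨ] with q h1 h2 hq
    simp only [J, star_star]
    rw [h2, h1 hq]; simp
  have hN := Rc_nullst S.hΨa S.hΨ0 S.hΨ J hJ hJ0
  -- solve for τ
  let f : ((ℂ × ℂ × ℂ) × ℂ) × ℂ → ℂ := fun x => Rc Ψ (x.1.1, cj H (x.1.2, x.2))
  let n : ((ℂ × ℂ × ℂ) × ℂ) × ℂ → (ℂ × ℂ × ℂ) × (ℂ × ℂ × ℂ) := fun x => (x.1.1, cj H (x.1.2, x.2))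
  let ℓ : ((ℂ × ℂ × ℂ) × ℂ) × ℂ →L[ℂ] ℂ × ℂ :=
    ((ContinuousLinearMap.snd ℂ (ℂ × ℂ × ℂ) ℂ).comp (ContinuousLinearMap.fst ℂ _ _)).prod (ContinuousLinearMap.snd ℂ _ _)
  let ℓ1 : ((ℂ × ℂ × ℂ) × ℂ) × ℂ →L[ℂ] (ℂ × ℂ × ℂ) :=
    ((ContinuousLinearMap.fst ℂ (ℂ × ℂ × ℂ) ℂ).comp (ContinuousLinearMap.fst ℂ _ _))
  have hna : AnalyticAt ℂ n 0 := by
    refine AnalyticAt.prod (ℓ1.analyticAt _) ?_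
    exact AnalyticAt.comp (g := cj H) (f := ℓ) (by rw [map_zero]; exact S.cjH_analytic) (ℓ.analyticAt _)
  have hn0 : n 0 = 0 := by
    change ((0 : ℂ × ℂ × ℂ), cj H 0) = 0
    rw [S.cjH_zero]; rfl
  have hnd : HasFDerivAt n (ℓ1.prod ((fderiv ℂ (cj H) 0).comp ℓ)) 0 := by
    refine ℓ1.hasFDerivAt.prodMk ?_
    exact HasFDerivAt.comp (g := cj H) (f := ℓ) 0 (by rw [map_zero]; exact S.cjH_analytic.differentiableAt.hasFDerivAt) ℓ.hasFDerivAt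
  have hfa : AnalyticAt ℂ f 0 := AnalyticAt.comp (g := Rc Ψ) (f := n) (by rw [hn0]; exact Rc_analytic S.hΨa) hna
  have hfd : HasFDerivAt f ((fderiv ℂ (Rc Ψ) 0).comp (ℓ1.prod ((fderiv ℂ (cj H) 0).comp ℓ))) 0 :=
    HasFDerivAt.comp (g := Rc Ψ) (f := n) 0 (by rw [hn0]; exact (Rc_analytic S.hΨa).differentiableAt.hasFDerivAt) hnd
  have hf0 : f 0 = 0 := by
    change Rc Ψ (n 0) = 0
    rw [hn0]; exact Rc_zero S.hΨ0
  have hinv : (fderiv ℂ f 0 ∘L .inr ℂ ((ℂ × ℂ × ℂ) × ℂ) ℂ).IsInvertible := by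
    set c : ℂ := (fderiv ℂ (cj H) 0 (0, 1)).2.2 with hc
    have hc0 : c ≠ 0 := S.dw_ne
    have he : fderiv ℂ f 0 ∘L .inr ℂ ((ℂ × ℂ × ℂ) × ℂ) ℂ
        = ((ContinuousLinearEquiv.unitsEquivAut ℂ (Units.mk0 (-c / (2 * I)) (by simp [hc0])) : ℂ ≃L[ℂ] ℂ) : ℂ →L[ℂ] ℂ) := by
      ext
      rw [hfd.fderiv]
      simp [Rc_fderiv S.hΨa S.hΨ1, ℓ, ℓ1, hc]
    exact ⟨_, he.symm⟩
  obtain ⟨τ, hτa, hτ0, hτu, hτ⟩ := analytic_ift hfa hf0 hinv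
  have hθ : ∀ᶠ s in 𝓝 (0:ℂ), τ (0, s) = Tc Φ U (0, s, 0) := by
    have hc : Tendsto (fun s : ℂ => ((((0 : ℂ × ℂ × ℂ), s), Tc Φ U (0, s, 0)) : ((ℂ × ℂ × ℂ) × ℂ) × ℂ)) (𝓝 0) (𝓝 0) := by
      have h1 : ContinuousAt (fun s : ℂ => ((((0 : ℂ × ℂ × ℂ), s), Tc Φ U (0, s, 0)) : ((ℂ × ℂ × ℂ) × ℂ) × ℂ)) 0 :=
        (continuousAt_const.prodMk continuousAt_id).prodMk S.theta.1.continuousAt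
      have h2 := h1.tendsto
      rw [show Tc Φ U (0, 0, 0) = 0 from S.Tc_0] at h2
      exact h2
    have hc2 : Tendsto (fun s : ℂ => ((0:ℂ), s, (0:ℂ))) (𝓝 0) (𝓝 0) := by
      have : Continuous (fun s : ℂ => ((0:ℂ), s, (0:ℂ))) := by fun_prop
      exact this.tendsto 0
    filter_upwards [hc.eventually hτu, hc2.eventually S.refl_H] with s h1 h2
    refine h1.1 ?_
    rw [show ((0:ℂ),(0:ℂ)) = 0 from rfl, S.hH0] at h2
    exact h2
  let m : (ℂ × ℂ × ℂ) × ℂ → (ℂ × ℂ × ℂ) × (ℂ × ℂ × ℂ) := fun x => (x.1, cj H (x.2, τ x))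
  have hτ0' : τ 0 = 0 := hτ0
  have hp : AnalyticAt ℂ (fun x : (ℂ × ℂ × ℂ) × ℂ => (x.2, τ x)) 0 := analyticAt_snd.prod hτa
  have hp0 : ((0 : (ℂ × ℂ × ℂ) × ℂ).2, τ 0) = 0 := by rw [hτ0']; rfl
  have hm : AnalyticAt ℂ m 0 := by
    refine analyticAt_fst.prod ?_
    exact AnalyticAt.comp (g := cj H) (f := fun x : (ℂ × ℂ × ℂ) × ℂ => (x.2, τ x)) (by simp only [hp0]; exact S.cjH_analytic) hp
  have hm0 : m 0 = 0 := by
    simp only [m]; rw [hp0, S.cjH_zero]; rfl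
  obtain ⟨ε, hε, hfin⟩ := N_abs _ (S.dR_analytic hm hm0) (by
    intro d hd
    refine S.N0' d ?_
    filter_upwards [hd, hθ] with s hs h2
    simp only [m, h2] at hs
    exact hs)
  have hmt : Tendsto m (𝓝 0) (𝓝 0) := by have := hm.continuousAt.tendsto; rwa [hm0] at this
  have hpt : Tendsto (fun x : (ℂ × ℂ × ℂ) × ℂ => (x.2, τ x)) (𝓝 0) (𝓝 0) := by
    have := hp.continuousAt.tendsto; simp only [hp0] at this; exact this
  have hst2 : Tendsto (star : ℂ × ℂ → ℂ × ℂ) (𝓝 0) (𝓝 0) := by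
    have := (continuous_star : Continuous (star : ℂ × ℂ → ℂ × ℂ)).tendsto 0
    simpa using this
  have hev : ∀ᶠ x in 𝓝 (0 : (ℂ × ℂ × ℂ) × ℂ), fderiv ℂ (Rc Ψ) (m x) (X x.1, 0) = 0 := by
    filter_upwards [hmt.eventually hN, (hst2.comp hpt).eventually hXH, hτ] with x h1 h2 h3
    have h4 := h1 h3
    simp only [J] at h4
    have h5 : X (star (m x).2) = 0 := by
      simp only [m, cj, star_star]; exact h2
    rw [h5, star_zero] at h4
    exact h4
  have hev2 : ∀ᶠ Z in 𝓝 (0 : ℂ × ℂ × ℂ), ∀ᶠ s in 𝓝 (0:ℂ), fderiv ℂ (Rc Ψ) (m (Z, s)) (X Z, 0) = 0 := by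
    have := hev
    rw [show (0 : (ℂ × ℂ × ℂ) × ℂ) = (0, 0) from rfl, nhds_prod_eq] at this
    exact this.curry
  filter_upwards [hev2, hfin] with Z h1 h2
  by_contra hne
  refine h2 0 (mem_ball_self hε) (X Z) hne ?_
  filter_upwards [h1] with s hs
  simpa using hs
end PartOfH

section PartOfI
open Complex Filter Topology Metric
open scoped ContDiff

variable {φ : ℂ × ℝ → ℝ} {ψ : ℂ × ℂ × ℝ → ℝ} {H : ℂ × ℂ → ℂ × ℂ × ℂ}
    {Φ : ℂ × ℂ × ℂ → ℂ} {Ψ : ℂ × ℂ × ℂ × ℂ × ℂ → ℂ} {U : ℂ × ℂ × ℂ → ℂ}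

/-- real part of the pairing, as a real linear form -/
noncomputable def pairR (g : ℂ × ℂ × ℂ) : (ℂ × ℂ × ℂ) →ₗ[ℝ] ℝ where
  toFun v := (v.1 * g.1 + v.2.1 * g.2.1 + v.2.2 * g.2.2).re
  map_add' v w := by
    simp only [Prod.fst_add, Prod.snd_add, ← Complex.add_re]
    congr 1; ring
  map_smul' t v := by
    simp [mul_assoc]; ring

lemma germ_sum {β : Type*} {l : Filter β} {E : Type*} [NormedAddCommGroup E] [NormedSpace ℝ E] {d : ℕ}
    (f : Fin d → β → E) (t : Fin d → ℝ) :
    (∑ i, t i • ((f i : β → E) : Filter.Germ l E)) = ((fun b => ∑ i, t i • f i b : β → E) : Filter.Germ l E) := by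
  have h : (fun b => ∑ i, t i • f i b : β → E) = ∑ i, t i • f i := by ext b; simp
  rw [h]
  have := map_sum (Filter.Germ.coeAddHom l : (β → E) →+ Filter.Germ l E) (fun i => t i • f i) Finset.univ
  simpa using this.symm

lemma Setup.basis (S : Setup φ ψ H Φ Ψ U)
    (hdim : ∃ (S1 : Submodule ℝ (Filter.Germ (𝓝 (0 : ℂ × ℂ)) (ℂ × ℂ × ℂ)))
        (S2 : Submodule ℝ (Filter.Germ (𝓝 (0 : ℂ × ℂ × ℂ)) (ℂ × ℂ × ℂ))),
      (S1 : Set (Filter.Germ (𝓝 (0 : ℂ × ℂ)) (ℂ × ℂ × ℂ))) = infDefGermSet φ ψ H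
      ∧ (S2 : Set (Filter.Germ (𝓝 (0 : ℂ × ℂ × ℂ)) (ℂ × ℂ × ℂ))) = holGermSet ψ
      ∧ FiniteDimensional ℝ S1 ∧ FiniteDimensional ℝ S2
      ∧ Module.finrank ℝ S1 = Module.finrank ℝ S2) :
    ∃ (d : ℕ) (X : Fin d → ℂ × ℂ × ℂ → ℂ × ℂ × ℂ), (∀ i, AnalyticAt ℂ (X i) 0) ∧ (∀ i, X i 0 = 0) ∧
      (∀ i, ∀ᶠ q in 𝓝 (0 : ℂ × ℂ × ℂ), q ∈ M'set ψ → pairR (gradRho' ψ q) (X i q) = 0) ∧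
      (∀ α, IsInfDef φ ψ H α → ∃ t : Fin d → ℝ, ∀ᶠ p in 𝓝 0, α p = ∑ i, t i • X i (H p)) ∧
      (∀ t : Fin d → ℝ, (∀ᶠ p in 𝓝 0, ∑ i, t i • X i (H p) = 0) → t = 0) := by
  obtain ⟨S1, S2, hS1, hS2, hf1, hf2, hrank⟩ := hdim
  let d := Module.finrank ℝ S2
  let b := Module.finBasis ℝ S2
  have hb : ∀ i, ((b i : S2) : Filter.Germ (𝓝 (0 : ℂ × ℂ × ℂ)) (ℂ × ℂ × ℂ)) ∈ holGermSet ψ := by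
    intro i; rw [← hS2]; exact (b i).2
  choose X hXb hXa hX0 hXM using hb
  have ht : Tendsto H (𝓝 0) (𝓝 0) := by have := S.hHa.continuousAt.tendsto; rwa [S.hH0] at this
  have hY : ∀ i, ((fun p => X i (H p) : ℂ × ℂ → ℂ × ℂ × ℂ) : Filter.Germ (𝓝 (0 : ℂ × ℂ)) (ℂ × ℂ × ℂ)) ∈ S1 := by
    intro i
    rw [← SetLike.mem_coe, hS1]
    refine ⟨_, rfl, ?_, ?_, ?_⟩
    · exact AnalyticAt.comp (g := X i) (f := H) (by rw [S.hH0]; exact hXa i) S.hHa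
    · simp only [S.hH0, hX0]
    · filter_upwards [ht.eventually (hXM i), S.hHmap] with p h1 h2 hp
      exact h1 (h2 hp)
  let Y : Fin d → S1 := fun i => ⟨_, hY i⟩
  have hinj : ∀ t : Fin d → ℝ, (∀ᶠ p in 𝓝 0, ∑ i, t i • X i (H p) = 0) → t = 0 := by
    intro t h
    have h1 : ∀ᶠ q in 𝓝 0, ∑ i, t i • X i q = 0 := by
      refine S.inj (X := fun q => ∑ i, t i • X i q) ?_ ?_ h
      · refine Finset.analyticAt_fun_sum _ fun i _ => ?_
        have := (hXa i).fun_const_smul (c := (t i : ℂ))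
        simpa using this
      · have : ∀ᶠ q in 𝓝 (0 : ℂ × ℂ × ℂ), ∀ i, q ∈ M'set ψ → pairR (gradRho' ψ q) (X i q) = 0 :=
          eventually_all.2 hXM
        filter_upwards [this] with q hq hqM
        change pairR (gradRho' ψ q) (∑ i, t i • X i q) = 0
        rw [map_sum]
        refine Finset.sum_eq_zero fun i _ => ?_
        rw [map_smul, hq i hqM, smul_zero]
    have h2 : ∑ i, t i • b i = 0 := by
      apply Subtype.ext
      push_cast
      simp only [hXb]
      rw [germ_sum]
      exact Filter.Germ.coe_eq.2 h1
    have := linearIndependent_iff'.1 b.linearIndependent Finset.univ t h2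
    ext i; exact this i (Finset.mem_univ _)
  have hli : LinearIndependent ℝ Y := by
    rw [Fintype.linearIndependent_iff]
    intro t h
    have h1 := congrArg (Subtype.val) h
    push_cast at h1
    simp only [Y] at h1
    rw [germ_sum] at h1
    have := hinj t (Filter.Germ.coe_eq.1 h1)
    intro i; rw [this]; rfl
  refine ⟨d, X, hXa, hX0, hXM, ?_, hinj⟩
  intro α hα
  have hαm : (α : Filter.Germ (𝓝 (0 : ℂ × ℂ)) (ℂ × ℂ × ℂ)) ∈ S1 := by
    rw [← SetLike.mem_coe, hS1]; exact ⟨α, rfl, hα⟩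
  let B := basisOfLinearIndependentOfCardEqFinrank' Y hli (by simp [d, hrank])
  have hrep := B.sum_repr ⟨_, hαm⟩
  refine ⟨fun i => B.repr ⟨_, hαm⟩ i, ?_⟩
  have h1 := congrArg (Subtype.val) hrep
  push_cast at h1
  simp only [B, coe_basisOfLinearIndependentOfCardEqFinrank', Y] at h1
  rw [germ_sum] at h1
  filter_upwards [Filter.Germ.coe_eq.1 h1] with p hp using hp.symm
end PartOfI

section PartOfJ
open Complex Filter Topology Metric
open scoped ContDiff

section flow
set_option linter.unusedSectionVars false
variable {W : Type*} [NormedAddCommGroup W] [NormedSpace ℂ W]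
  {F : Type*} [NormedAddCommGroup F] [NormedSpace ℂ F]

noncomputable def nemP (p : FormalMultilinearSeries ℂ W F) :
    FormalMultilinearSeries ℂ C(unitInterval, W) C(unitInterval, F) := fun n =>
  MultilinearMap.mkContinuous
    { toFun := fun y => ⟨fun s => p n (fun i => y i s), (p n).cont.comp (continuous_pi fun i => (y i).continuous)⟩
      map_update_add' := by
        intro _ m i x y
        ext s
        have h : ∀ z : C(unitInterval, W), (fun j => (Function.update m i z) j s) = Function.update (fun j => m j s) i (z s) := by
          intro z; ext j
          by_cases hj : j = i
          · subst hj; simp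
          · simp [hj]
        simp [h]
      map_update_smul' := by
        intro _ m i c x
        ext s
        have h : ∀ z : C(unitInterval, W), (fun j => (Function.update m i z) j s) = Function.update (fun j => m j s) i (z s) := by
          intro z; ext j
          by_cases hj : j = i
          · subst hj; simp
          · simp [hj]
        simp [h] } ‖p n‖ (by
    intro y
    rw [ContinuousMap.norm_le _ (by positivity)]
    intro s
    refine ((p n).le_opNorm _).trans ?_
    gcongr with i
    exact (y i).norm_coe_le_norm s)

lemma nemP_apply (p : FormalMultilinearSeries ℂ W F) (n : ℕ) (y : Fin n → C(unitInterval, W)) (s : unitInterval) :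
    nemP p n y s = p n (fun i => y i s) := rfl

lemma nemP_norm (p : FormalMultilinearSeries ℂ W F) (n : ℕ) : ‖nemP p n‖ ≤ ‖p n‖ :=
  MultilinearMap.mkContinuous_norm_le _ (norm_nonneg _) _

lemma nemytskii [CompleteSpace F] {f : W → F} (hf : AnalyticAt ℂ f 0) :
    ∃ N : C(unitInterval, W) → C(unitInterval, F), AnalyticAt ℂ N 0 ∧ (fderiv ℂ f 0 = 0 → fderiv ℂ N 0 = 0) ∧
      ∀ᶠ y in 𝓝 0, ∀ s, N y s = f (y s) := by
  obtain ⟨p, r, hp⟩ := hf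
  obtain ⟨r', hr'0, hr'⟩ := ENNReal.lt_iff_exists_nnreal_btwn.1 (hp.r_pos)
  have hr0 : 0 < r' := by simpa using hr'0
  have hle : (r' : ENNReal) ≤ (nemP p).radius := by
    refine FormalMultilinearSeries.le_radius_of_summable _ ?_
    refine Summable.of_nonneg_of_le (fun n => by positivity) (fun n => ?_)
      (p.summable_norm_mul_pow (hr'.trans_le hp.r_le))
    gcongr
    exact nemP_norm p n
  have hP := (nemP p).hasFPowerSeriesOnBall (hr'0.trans_le hle)
  refine ⟨(nemP p).sum, hP.analyticAt, ?_, ?_⟩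
  · intro h0
    rw [hP.hasFPowerSeriesAt.fderiv_eq]
    rw [hp.hasFPowerSeriesAt.fderiv_eq] at h0
    ext y s
    have := congrArg (fun L => L (y s)) h0
    simp only [continuousMultilinearCurryFin1_apply, zero_apply] at this ⊢
    change nemP p 1 _ s = 0
    rw [nemP_apply, ← this]
    congr 1
  · filter_upwards [ball_mem_nhds (0 : C(unitInterval, W)) hr0] with y hy s
    have hy1 : ‖y‖ < r' := by simpa using hy
    have h1 := hP.hasSum (y := y) (by
      refine Metric.eball_subset_eball hle ?_
      rw [Metric.eball_coe]; exact hy)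
    rw [zero_add] at h1
    have h2 := hp.hasSum (y := y s) (by
      refine Metric.eball_subset_eball hr'.le ?_
      rw [Metric.eball_coe]; simpa using (y.norm_coe_le_norm s).trans_lt hy1)
    rw [zero_add] at h2
    have h3 := h1.mapL (ContinuousMap.evalCLM ℂ s)
    exact h3.unique h2

variable [CompleteSpace W] [NormedSpace ℝ W] [IsScalarTower ℝ ℂ W]

noncomputable def volt : C(unitInterval, W) →L[ℂ] C(unitInterval, W) :=
  LinearMap.mkContinuous
    { toFun := fun y => ⟨fun s => ∫ τ in (0:ℝ)..s, y (Set.projIcc 0 1 zero_le_one τ), by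
          have h : Continuous (fun τ : ℝ => y (Set.projIcc 0 1 zero_le_one τ)) := by fun_prop
          exact (intervalIntegral.continuous_primitive (fun a b => h.intervalIntegrable a b) 0).comp continuous_subtype_val⟩
      map_add' := by
        intro x y
        ext s
        have h : ∀ y : C(unitInterval, W), Continuous (fun τ : ℝ => y (Set.projIcc 0 1 zero_le_one τ)) := by
          intro y; fun_prop
        simpa using intervalIntegral.integral_add ((h x).intervalIntegrable 0 s) ((h y).intervalIntegrable 0 s)
      map_smul' := by
        intro c x
        ext s
        simp [intervalIntegral.integral_smul] } 1 (by
    intro y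
    rw [ContinuousMap.norm_le _ (by positivity)]
    intro s
    have := intervalIntegral.norm_integral_le_of_norm_le_const (a := 0) (b := (s:ℝ)) (C := ‖y‖)
      (f := fun τ => y (Set.projIcc 0 1 zero_le_one τ)) (fun τ _ => y.norm_coe_le_norm _)
    refine this.trans ?_
    rw [one_mul, sub_zero, abs_of_nonneg s.2.1]
    exact mul_le_of_le_one_right (norm_nonneg _) s.2.2)

lemma volt_apply (y : C(unitInterval, W)) (s : unitInterval) :
    volt y s = ∫ τ in (0:ℝ)..s, y (Set.projIcc 0 1 zero_le_one τ) := rfl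

/-- local flow of an analytic field -/
lemma flow_exists {Y : W → W} (hY : AnalyticAt ℂ Y 0) (hY0 : Y 0 = 0) (hY1 : fderiv ℂ Y 0 = 0) :
    ∃ y : W → C(unitInterval, W), AnalyticAt ℂ y 0 ∧ y 0 = 0 ∧
      (∀ᶠ x in 𝓝 0, ∀ s : unitInterval, y x s = x + ∫ τ in (0:ℝ)..s, Y (y x (Set.projIcc 0 1 zero_le_one τ))) ∧
      (∀ᶠ v in 𝓝 (0 : W × C(unitInterval, W)),
        (∀ s : unitInterval, v.2 s = v.1 + ∫ τ in (0:ℝ)..s, Y (v.2 (Set.projIcc 0 1 zero_le_one τ))) → y v.1 = v.2) := by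
  obtain ⟨N, hN, hN1, hNe⟩ := nemytskii hY
  have hN1 := hN1 hY1
  have hN0 : N 0 = 0 := by
    ext s; rw [hNe.self_of_nhds s]; simpa using hY0
  let cst : W →L[ℂ] C(unitInterval, W) := ContinuousLinearMap.const ℂ unitInterval
  let Θ : W × C(unitInterval, W) → C(unitInterval, W) := fun v => v.2 - cst v.1 - volt (N v.2)
  let L0 : W × C(unitInterval, W) →L[ℂ] C(unitInterval, W) :=
    ContinuousLinearMap.snd ℂ _ _ - cst.comp (ContinuousLinearMap.fst ℂ _ _)
  have hNs : AnalyticAt ℂ (fun v : W × C(unitInterval, W) => N v.2) 0 :=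
    AnalyticAt.comp (g := N) (f := Prod.snd) (x := (0 : W × C(unitInterval, W))) hN analyticAt_snd
  have hΘ : AnalyticAt ℂ Θ 0 := (L0.analyticAt _).sub (((volt (W := W)).analyticAt _).comp hNs)
  have hd : HasFDerivAt Θ L0 0 := by
    have h1 : HasFDerivAt N (0 : C(unitInterval, W) →L[ℂ] C(unitInterval, W)) 0 := by
      rw [← hN1]; exact hN.differentiableAt.hasFDerivAt
    have h2 := HasFDerivAt.comp (g := N) (f := Prod.snd) (0 : W × C(unitInterval, W)) h1 hasFDerivAt_snd
    have h3 := (volt (W := W)).hasFDerivAt.comp (0 : W × C(unitInterval, W)) h2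
    have h4 := L0.hasFDerivAt.sub h3 (x := 0)
    rw [ContinuousLinearMap.zero_comp, ContinuousLinearMap.comp_zero, sub_zero] at h4
    exact h4
  have hΘ0 : Θ 0 = 0 := by simp [Θ, hN0]
  have hinv : (fderiv ℂ Θ 0 ∘L .inr ℂ W C(unitInterval, W)).IsInvertible := by
    rw [hd.fderiv]
    refine ⟨ContinuousLinearEquiv.refl ℂ _, ?_⟩
    ext; simp [L0]
  obtain ⟨y, hya, hy0, hyu, hy⟩ := analytic_ift hΘ hΘ0 hinv
  have hΘi : ∀ᶠ v in 𝓝 (0 : W × C(unitInterval, W)),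
      (Θ v = 0 ↔ ∀ s : unitInterval, v.2 s = v.1 + ∫ τ in (0:ℝ)..s, Y (v.2 (Set.projIcc 0 1 zero_le_one τ))) := by
    have : Tendsto (Prod.snd : W × C(unitInterval, W) → _) (𝓝 0) (𝓝 0) := continuous_snd.tendsto 0
    filter_upwards [this.eventually hNe] with v hv
    rw [ContinuousMap.ext_iff]
    refine forall_congr' fun s => ?_
    have : Θ v s = v.2 s - v.1 - ∫ τ in (0:ℝ)..s, Y (v.2 (Set.projIcc 0 1 zero_le_one τ)) := by
      change v.2 s - v.1 - volt (N v.2) s = _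
      rw [volt_apply]
      simp only [hv]
    rw [this, ContinuousMap.zero_apply, sub_sub, sub_eq_zero]
  have hy0' : y 0 = 0 := hy0
  refine ⟨y, hya, hy0', ?_, ?_⟩
  · have ht : Tendsto (fun x => (x, y x)) (𝓝 (0:W)) (𝓝 0) := by
      have h1 : ContinuousAt (fun x => (x, y x)) (0:W) := continuousAt_id.prodMk hya.continuousAt
      have := h1.tendsto
      rw [hy0'] at this
      exact this
    have hy' : ∀ᶠ x in 𝓝 (0:W), Θ (x, y x) = 0 := hy
    filter_upwards [ht.eventually hΘi, hy'] with x h1 h2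
    exact h1.1 h2
  · filter_upwards [hyu, hΘi] with v h1 h2 h3
    exact h1.1 (h2.2 h3)
end flow
end PartOfJ

section PartOfK
open Complex Filter Topology Metric
open scoped ContDiff

section flow2
variable {d : ℕ} {X : Fin d → ℂ × ℂ × ℂ → ℂ × ℂ × ℂ}

/-- linear combination of the fields -/
noncomputable def XX (X : Fin d → ℂ × ℂ × ℂ → ℂ × ℂ × ℂ) (t : Fin d → ℂ) (q : ℂ × ℂ × ℂ) : ℂ × ℂ × ℂ :=
  ∑ i, t i • X i q

noncomputable def YY (X : Fin d → ℂ × ℂ × ℂ → ℂ × ℂ × ℂ) (x : (Fin d → ℂ) × (ℂ × ℂ × ℂ)) :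
    (Fin d → ℂ) × (ℂ × ℂ × ℂ) := (0, XX X x.1 x.2)

lemma XX_analytic {x : (Fin d → ℂ) × (ℂ × ℂ × ℂ)} (hX : ∀ i, AnalyticAt ℂ (X i) x.2) :
    AnalyticAt ℂ (fun x : (Fin d → ℂ) × (ℂ × ℂ × ℂ) => XX X x.1 x.2) x := by
  refine Finset.analyticAt_fun_sum _ fun i _ => ?_
  have h1 : AnalyticAt ℂ (fun x : (Fin d → ℂ) × (ℂ × ℂ × ℂ) => x.1 i) x :=
    ((ContinuousLinearMap.proj (R := ℂ) (φ := fun _ : Fin d => ℂ) i).comp (ContinuousLinearMap.fst ℂ _ _)).analyticAt x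
  have h2 : AnalyticAt ℂ (fun x : (Fin d → ℂ) × (ℂ × ℂ × ℂ) => X i x.2) x :=
    AnalyticAt.comp (g := X i) (f := Prod.snd) (x := x) (hX i) analyticAt_snd
  exact h1.smul h2

lemma YY_analytic {x : (Fin d → ℂ) × (ℂ × ℂ × ℂ)} (hX : ∀ i, AnalyticAt ℂ (X i) x.2) :
    AnalyticAt ℂ (YY X) x := analyticAt_const.prod (XX_analytic hX)

lemma XX_zero (q) : XX X 0 q = 0 := by simp [XX]
lemma XX_zero' (hX0 : ∀ i, X i 0 = 0) (t) : XX X t 0 = 0 := by simp [XX, hX0]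

lemma YY_fderiv (hXa : ∀ i, AnalyticAt ℂ (X i) 0) (hX0 : ∀ i, X i 0 = 0) : fderiv ℂ (YY X) 0 = 0 := by
  have h : ∀ i, HasFDerivAt (fun x : (Fin d → ℂ) × (ℂ × ℂ × ℂ) => x.1 i • X i x.2)
      (0 : (Fin d → ℂ) × (ℂ × ℂ × ℂ) →L[ℂ] ℂ × ℂ × ℂ) 0 := by
    intro i
    have h1 : HasFDerivAt (fun x : (Fin d → ℂ) × (ℂ × ℂ × ℂ) => x.1 i)
      ((ContinuousLinearMap.proj (R := ℂ) (φ := fun _ : Fin d => ℂ) i).comp (ContinuousLinearMap.fst ℂ (Fin d → ℂ) (ℂ × ℂ × ℂ))) 0 :=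
      ((ContinuousLinearMap.proj (R := ℂ) (φ := fun _ : Fin d => ℂ) i).comp (ContinuousLinearMap.fst ℂ (Fin d → ℂ) (ℂ × ℂ × ℂ))).hasFDerivAt
    have h2 := HasFDerivAt.comp (g := X i) (f := Prod.snd) (0 : (Fin d → ℂ) × (ℂ × ℂ × ℂ)) (hXa i).differentiableAt.hasFDerivAt hasFDerivAt_snd
    have h3 := h1.smul h2
    refine h3.congr_fderiv ?_
    ext <;> simp [hX0]
  have h2 : HasFDerivAt (YY X) (0 : (Fin d → ℂ) × (ℂ × ℂ × ℂ) →L[ℂ] (Fin d → ℂ) × (ℂ × ℂ × ℂ)) 0 := by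
    have h3 := HasFDerivAt.fun_sum (u := Finset.univ) (fun i _ => h i)
    have h4 := (hasFDerivAt_const (0 : Fin d → ℂ) (0 : (Fin d → ℂ) × (ℂ × ℂ × ℂ))).prodMk h3
    refine h4.congr_fderiv ?_
    simp
    rfl
  exact h2.fderiv

lemma YY_path {r : ℝ} (hr : ∀ q ∈ ball (0 : ℂ × ℂ × ℂ) r, ∀ i, AnalyticAt ℂ (X i) q)
    (t : Fin d → ℂ) (γ : ℝ → ℂ × ℂ × ℂ) (p : C(unitInterval, (Fin d → ℂ) × (ℂ × ℂ × ℂ)))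
    (hp : ∀ s : unitInterval, p s = (t, γ s))
    (hb : ∀ s ∈ Set.Icc (0:ℝ) 1, γ s ∈ ball (0 : ℂ × ℂ × ℂ) r)
    (hd : ∀ s ∈ Set.Icc (0:ℝ) 1, HasDerivAt γ (XX X t (γ s)) s) (s : unitInterval) :
    p s = (t, γ 0) + ∫ τ in (0:ℝ)..s, YY X (p (Set.projIcc 0 1 zero_le_one τ)) := by
  have hc : Continuous (fun τ : ℝ => YY X (p (Set.projIcc 0 1 zero_le_one τ))) := by
    rw [continuous_iff_continuousAt]
    intro τ
    have h1 : ContinuousAt (YY X) (p (Set.projIcc 0 1 zero_le_one τ)) := by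
      refine (YY_analytic (hr _ ?_)).continuousAt
      rw [hp]
      exact hb _ (Subtype.mem _)
    have h2 : Continuous (fun τ : ℝ => p (Set.projIcc 0 1 zero_le_one τ)) := by fun_prop
    exact ContinuousAt.comp (g := YY X) h1 h2.continuousAt
  have h := intervalIntegral.integral_eq_sub_of_hasDerivAt (a := 0) (b := (s:ℝ)) (f := fun τ => (t, γ τ))
    (f' := fun τ : ℝ => YY X (p (Set.projIcc 0 1 zero_le_one τ))) (by
      intro τ hτ
      rw [Set.uIcc_of_le s.2.1] at hτ
      have hτ1 : τ ∈ Set.Icc (0:ℝ) 1 := ⟨hτ.1, hτ.2.trans s.2.2⟩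
      rw [Set.projIcc_of_mem _ hτ1, hp]
      exact (hasDerivAt_const τ t).prodMk (hd τ hτ1)) (hc.intervalIntegrable _ _)
  rw [h, hp]
  simp

lemma flow_facts {r : ℝ} (hr : ∀ q ∈ ball (0 : ℂ × ℂ × ℂ) r, ∀ i, AnalyticAt ℂ (X i) q)
    (x : (Fin d → ℂ) × (ℂ × ℂ × ℂ)) (p : C(unitInterval, (Fin d → ℂ) × (ℂ × ℂ × ℂ)))
    (hp : ∀ s : unitInterval, p s = x + ∫ τ in (0:ℝ)..s, YY X (p (Set.projIcc 0 1 zero_le_one τ)))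
    (hb : ‖p‖ < r) :
    ∃ γ : ℝ → ℂ × ℂ × ℂ, γ 0 = x.2 ∧ (∀ s : unitInterval, p s = (x.1, γ s)) ∧
      ∀ s ∈ Set.Icc (0:ℝ) 1, HasDerivAt γ (XX X x.1 (γ s)) s := by
  have hpb : ∀ s, (p s).2 ∈ ball (0 : ℂ × ℂ × ℂ) r := by
    intro s
    rw [mem_ball_zero_iff]
    exact ((norm_snd_le _).trans (p.norm_coe_le_norm s)).trans_lt hb
  have hc : Continuous (fun τ : ℝ => YY X (p (Set.projIcc 0 1 zero_le_one τ))) := by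
    rw [continuous_iff_continuousAt]
    intro τ
    have h1 : ContinuousAt (YY X) (p (Set.projIcc 0 1 zero_le_one τ)) :=
      (YY_analytic (hr _ (hpb _))).continuousAt
    have h2 : Continuous (fun τ : ℝ => p (Set.projIcc 0 1 zero_le_one τ)) := by fun_prop
    exact ContinuousAt.comp (g := YY X) h1 h2.continuousAt
  have hfst : ∀ s : unitInterval, (p s).1 = x.1 := by
    intro s
    have h1 := (ContinuousLinearMap.fst ℝ (Fin d → ℂ) (ℂ × ℂ × ℂ)).intervalIntegral_comp_comm (μ := MeasureTheory.volume) (hc.intervalIntegrable 0 (s:ℝ))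
    simp only [ContinuousLinearMap.coe_fst', YY, intervalIntegral.integral_zero] at h1
    rw [hp s, Prod.fst_add]
    simp only [YY]
    rw [← h1, add_zero]
  refine ⟨fun s => x.2 + ∫ τ in (0:ℝ)..s, XX X x.1 (p (Set.projIcc 0 1 zero_le_one τ)).2, by simp, ?_, ?_⟩
  all_goals
    have hsnd : ∀ s : unitInterval, (p s).2 = x.2 + ∫ τ in (0:ℝ)..s, XX X x.1 (p (Set.projIcc 0 1 zero_le_one τ)).2 := by
      intro s
      have h1 := (ContinuousLinearMap.snd ℝ (Fin d → ℂ) (ℂ × ℂ × ℂ)).intervalIntegral_comp_comm (μ := MeasureTheory.volume) (hc.intervalIntegrable 0 (s:ℝ))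
      simp only [ContinuousLinearMap.coe_snd', YY, hfst] at h1
      rw [h1]
      conv_lhs => rw [hp s, Prod.snd_add]
      simp only [YY, hfst]
  · intro s
    exact Prod.ext (hfst s) (hsnd s)
  · intro s hs
    have hc2 : Continuous (fun τ : ℝ => XX X x.1 (p (Set.projIcc 0 1 zero_le_one τ)).2) := by
      have := continuous_snd.comp hc
      simp only [YY, hfst, Function.comp_def] at this
      exact this
    have h1 := (intervalIntegral.integral_hasDerivAt_right (hc2.intervalIntegrable 0 s)
      hc2.aestronglyMeasurable.stronglyMeasurableAtFilter hc2.continuousAt).const_add x.2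
    have h2 := hsnd ⟨s, hs⟩
    rw [Set.projIcc_of_mem _ hs, h2] at h1
    exact h1
end flow2
end PartOfK

section PartOfL
open Complex Filter Topology Metric
open scoped ContDiff

section flow3
variable {d : ℕ} {X : Fin d → ℂ × ℂ × ℂ → ℂ × ℂ × ℂ}

lemma flow_core (hXa : ∀ i, AnalyticAt ℂ (X i) 0) (hX0 : ∀ i, X i 0 = 0) :
    ∃ σ : (Fin d → ℂ) × (ℂ × ℂ × ℂ) → ℂ × ℂ × ℂ, AnalyticAt ℂ σ 0 ∧
      (∃ ε > 0, ∀ (t : Fin d → ℂ) (γ : ℝ → ℂ × ℂ × ℂ), ‖t‖ < ε →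
        (∀ s ∈ Set.Icc (0:ℝ) 1, ‖γ s‖ < ε) →
        (∀ s ∈ Set.Icc (0:ℝ) 1, HasDerivAt γ (XX X t (γ s)) s) → σ (t, γ 0) = γ 1) ∧
      (∀ Ω ∈ 𝓝 (0 : ℂ × ℂ × ℂ), ∀ᶠ x in 𝓝 (0 : (Fin d → ℂ) × (ℂ × ℂ × ℂ)),
        ∃ γ : ℝ → ℂ × ℂ × ℂ, γ 0 = x.2 ∧ γ 1 = σ x ∧
          ∀ s ∈ Set.Icc (0:ℝ) 1, γ s ∈ Ω ∧ HasDerivAt γ (XX X x.1 (γ s)) s) := by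
  obtain ⟨r, hr0, hr⟩ : ∃ r > 0, ∀ q ∈ ball (0 : ℂ × ℂ × ℂ) r, ∀ i, AnalyticAt ℂ (X i) q :=
    Metric.eventually_nhds_iff_ball.1 (eventually_all.2 fun i => (hXa i).eventually_analyticAt)
  obtain ⟨y, hya, hy0, hy1, hy2⟩ := flow_exists (Y := YY X) (YY_analytic (x := 0) hXa)
    (by simp [YY, XX_zero]) (YY_fderiv hXa hX0)
  refine ⟨fun x => (y x 1).2, ?_, ?_, ?_⟩
  · have h1 : AnalyticAt ℂ (fun x => ContinuousMap.evalCLM ℂ (1 : unitInterval) (y x)) 0 :=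
      AnalyticAt.comp (g := fun v : C(unitInterval, (Fin d → ℂ) × (ℂ × ℂ × ℂ)) => ContinuousMap.evalCLM ℂ (1 : unitInterval) v) (f := y) (ContinuousLinearMap.analyticAt _ _) hya
    exact AnalyticAt.comp (g := Prod.snd) (f := fun x => y x 1) analyticAt_snd h1
  · obtain ⟨ε, hε, hu⟩ := Metric.eventually_nhds_iff_ball.1 hy2
    refine ⟨min ε r, lt_min hε hr0, fun t γ ht hγ hd => ?_⟩
    have hcont : Continuous (fun s : unitInterval => (t, γ s)) := by
      refine continuous_const.prodMk ?_
      rw [continuous_iff_continuousAt]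
      intro s
      exact ContinuousAt.comp (g := γ) (hd s s.2).continuousAt continuous_subtype_val.continuousAt
    have h := hu ((t, γ 0), ⟨_, hcont⟩) (by
      rw [mem_ball_zero_iff, Prod.norm_def, max_lt_iff]
      refine ⟨?_, ?_⟩
      · rw [Prod.norm_def, max_lt_iff]
        exact ⟨ht.trans_le (min_le_left _ _), (hγ 0 (by simp)).trans_le (min_le_left _ _)⟩
      · rw [ContinuousMap.norm_lt_iff _ hε]
        intro s
        change ‖(t, γ s)‖ < ε
        rw [Prod.norm_def, max_lt_iff]
        exact ⟨ht.trans_le (min_le_left _ _), (hγ s s.2).trans_le (min_le_left _ _)⟩) (by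
      intro s
      exact YY_path hr t γ _ (fun _ => rfl) (fun s hs => by
        rw [mem_ball_zero_iff]; exact (hγ s hs).trans_le (min_le_right _ _)) hd s)
    simp only at h
    simp only [h]
    simp
  · intro Ω hΩ
    obtain ⟨ρ, hρ, hρΩ⟩ := Metric.mem_nhds_iff.1 hΩ
    have h1 : ∀ᶠ x in 𝓝 (0 : (Fin d → ℂ) × (ℂ × ℂ × ℂ)), ‖y x‖ < min ρ r := by
      have := hya.continuousAt.norm
      have h2 : (fun x => ‖y x‖) 0 < min ρ r := by simp [hy0, hρ, hr0]
      exact this.eventually_lt_const h2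
    filter_upwards [h1, hy1] with x hx hx1
    obtain ⟨γ, hγ0, hγ1, hγ2⟩ := flow_facts hr x (y x) hx1 (hx.trans_le (min_le_right _ _))
    refine ⟨γ, hγ0, ?_, fun s hs => ⟨hρΩ ?_, hγ2 s hs⟩⟩
    · rw [hγ1]; simp
    · rw [mem_ball_zero_iff]
      have h3 := (y x).norm_coe_le_norm ⟨s, hs⟩
      rw [hγ1] at h3
      exact ((norm_snd_le (x.1, γ s)).trans h3).trans_lt (hx.trans_le (min_le_left _ _))

lemma XX_neg (t : Fin d → ℂ) (q) : XX X (-t) q = - XX X t q := by simp [XX]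
lemma XX_smul (c : ℂ) (t : Fin d → ℂ) (q) : XX X (c • t) q = c • XX X t q := by
  simp [XX, Finset.smul_sum, mul_smul]

lemma flow_pkg (hXa : ∀ i, AnalyticAt ℂ (X i) 0) (hX0 : ∀ i, X i 0 = 0) :
    ∃ σ : (Fin d → ℂ) × (ℂ × ℂ × ℂ) → ℂ × ℂ × ℂ, AnalyticAt ℂ σ 0 ∧
      (∀ᶠ q in 𝓝 (0 : ℂ × ℂ × ℂ), σ (0, q) = q) ∧
      (∀ᶠ t in 𝓝 (0 : Fin d → ℂ), σ (t, 0) = 0) ∧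
      (∀ᶠ x in 𝓝 (0 : (Fin d → ℂ) × (ℂ × ℂ × ℂ)), σ (-x.1, σ x) = x.2) ∧
      (∀ᶠ q in 𝓝 (0 : ℂ × ℂ × ℂ), ∀ t, fderiv ℂ σ (0, q) (t, 0) = XX X t q) ∧
      (∀ Ω ∈ 𝓝 (0 : ℂ × ℂ × ℂ), ∀ᶠ x in 𝓝 (0 : (Fin d → ℂ) × (ℂ × ℂ × ℂ)),
        ∃ γ : ℝ → ℂ × ℂ × ℂ, γ 0 = x.2 ∧ γ 1 = σ x ∧
          ∀ s ∈ Set.Icc (0:ℝ) 1, γ s ∈ Ω ∧ HasDerivAt γ (XX X x.1 (γ s)) s) := by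
  obtain ⟨σ, hσa, ⟨ε, hε, hu⟩, hf⟩ := flow_core hXa hX0
  have hball : ∀ᶠ q in 𝓝 (0 : ℂ × ℂ × ℂ), ‖q‖ < ε := by
    filter_upwards [ball_mem_nhds (0 : ℂ × ℂ × ℂ) hε] with q hq
    simpa using hq
  have hballt : ∀ᶠ q in 𝓝 (0 : Fin d → ℂ), ‖q‖ < ε := by
    filter_upwards [ball_mem_nhds (0 : Fin d → ℂ) hε] with q hq
    simpa using hq
  have ha : ∀ᶠ q in 𝓝 (0 : ℂ × ℂ × ℂ), σ (0, q) = q := by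
    filter_upwards [hball] with q hq
    exact hu 0 (fun _ => q) (by simpa using hε) (fun s _ => hq) (fun s _ => by
      rw [XX_zero]; exact hasDerivAt_const _ _)
  refine ⟨σ, hσa, ha, ?_, ?_, ?_, hf⟩
  · filter_upwards [hballt] with t ht
    exact hu t (fun _ => 0) ht (fun s _ => by simpa using hε) (fun s _ => by
      rw [XX_zero' hX0]; exact hasDerivAt_const _ _)
  · have h1 := hf _ (ball_mem_nhds (0 : ℂ × ℂ × ℂ) hε)
    have h2 : ∀ᶠ x in 𝓝 (0 : (Fin d → ℂ) × (ℂ × ℂ × ℂ)), ‖x.1‖ < ε :=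
      (continuous_fst.tendsto' (0 : (Fin d → ℂ) × (ℂ × ℂ × ℂ)) 0 rfl).eventually hballt
    filter_upwards [h1, h2] with x ⟨γ, hγ0, hγ1, hγ⟩ hx
    have h := hu (-x.1) (fun s => γ (1 - s)) (by simpa using hx) (fun s hs => by
      have := (hγ (1 - s) ⟨by linarith [hs.2], by linarith [hs.1]⟩).1
      simpa using this) (fun s hs => by
      have := (hγ (1 - s) ⟨by linarith [hs.2], by linarith [hs.1]⟩).2
      have h3 := this.scomp s ((hasDerivAt_id s).const_sub 1)
      rw [XX_neg]
      simpa [Function.comp_def] using h3)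
    simp only [sub_zero, sub_self] at h
    rw [hγ1, hγ0] at h
    exact h
  · have h1 := hf _ (ball_mem_nhds (0 : ℂ × ℂ × ℂ) hε)
    obtain ⟨η, hη, h1⟩ := Metric.eventually_nhds_iff_ball.1 h1
    have hdiff : ∀ᶠ q in 𝓝 (0 : ℂ × ℂ × ℂ), DifferentiableAt ℂ σ (0, q) := by
      have h3 : Tendsto (fun q : ℂ × ℂ × ℂ => ((0 : Fin d → ℂ), q)) (𝓝 0) (𝓝 0) :=
        Continuous.tendsto' (by fun_prop) _ _ rfl
      filter_upwards [h3.eventually hσa.eventually_analyticAt] with q hq using hq.differentiableAt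
    filter_upwards [hdiff, ball_mem_nhds (0 : ℂ × ℂ × ℂ) hη] with q hq hqη t
    have key : ∀ t : Fin d → ℂ, ‖t‖ < min η ε → fderiv ℂ σ (0, q) (t, 0) = XX X t q := by
      intro t ht
      obtain ⟨γ, hγ0, hγ1, hγ⟩ := h1 (t, q) (by
        rw [mem_ball_zero_iff, Prod.norm_def, max_lt_iff]
        exact ⟨ht.trans_le (min_le_left _ _), by simpa using hqη⟩)
      have h4 : ∀ s ∈ Set.Icc (0:ℝ) 1, σ ((s:ℂ) • t, q) = γ s := by
        intro s hs
        have h := hu ((s:ℂ) • t) (fun τ => γ (s * τ)) (by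
          rw [norm_smul, Complex.norm_real, Real.norm_of_nonneg hs.1]
          calc s * ‖t‖ ≤ 1 * ‖t‖ := by gcongr; exact hs.2
            _ < ε := by rw [one_mul]; exact ht.trans_le (min_le_right _ _)) (fun τ hτ => by
          have := (hγ (s * τ) ⟨mul_nonneg hs.1 hτ.1, mul_le_one₀ hs.2 hτ.1 hτ.2⟩).1
          simpa using this) (fun τ hτ => by
          have := (hγ (s * τ) ⟨mul_nonneg hs.1 hτ.1, mul_le_one₀ hs.2 hτ.1 hτ.2⟩).2
          have h3 := this.scomp τ ((hasDerivAt_id τ).const_mul s)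
          rw [XX_smul]
          simpa [Function.comp_def] using h3)
        simp only [mul_zero, mul_one] at h
        rw [hγ0] at h
        exact h
      have h5 : HasDerivAt (fun s : ℝ => σ ((s:ℂ) • t, q)) (fderiv ℂ σ (0, q) (t, 0)) 0 := by
        have h6 : HasDerivAt (fun s : ℝ => ((s:ℂ) • t, q)) (t, 0) 0 := by
          have := ((Complex.ofRealCLM.hasDerivAt (x := (0:ℝ))).smul_const t).prodMk (hasDerivAt_const 0 q)
          simpa using this
        have h7 : HasFDerivAt σ ((fderiv ℂ σ (0, q)).restrictScalars ℝ) ((((0:ℝ):ℂ) • t, q)) := by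
          simpa using hq.hasFDerivAt.restrictScalars ℝ
        exact h7.comp_hasDerivAt (0:ℝ) h6
      have h8 := (hγ 0 (by simp)).2
      rw [hγ0] at h8
      have h9 : HasDerivWithinAt (fun s : ℝ => σ ((s:ℂ) • t, q)) (XX X t q) (Set.Icc 0 1) 0 :=
        h8.hasDerivWithinAt.congr (fun s hs => h4 s hs) (h4 0 (by simp))
      exact (uniqueDiffOn_Icc zero_lt_one 0 (by simp)).eq_deriv _ h5.hasDerivWithinAt h9
    obtain ⟨c, hc0, hc⟩ : ∃ c : ℂ, c ≠ 0 ∧ ‖c • t‖ < min η ε := by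
      have h : Tendsto (fun c : ℂ => ‖c • t‖) (𝓝[≠] 0) (𝓝 0) := by
        refine Tendsto.mono_left ?_ nhdsWithin_le_nhds
        exact Continuous.tendsto' (by fun_prop) _ _ (by simp)
      have h2 := h.eventually_lt_const (lt_min hη hε)
      obtain ⟨c, hc1, hc2⟩ := (h2.and self_mem_nhdsWithin).exists
      exact ⟨c, hc2, hc1⟩
    have h := key _ hc
    rw [XX_smul, show ((c • t, 0) : (Fin d → ℂ) × (ℂ × ℂ × ℂ)) = c • (t, 0) by simp, map_smul] at h
    exact smul_right_injective _ hc0 h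
end flow3
end PartOfL

section PartOfM
open Complex Filter Topology Metric
open scoped ContDiff

section inv
variable {d : ℕ} {X : Fin d → ℂ × ℂ × ℂ → ℂ × ℂ × ℂ} {ψ : ℂ × ℂ × ℝ → ℝ} {Ψ : ℂ × ℂ × ℂ × ℂ × ℂ → ℂ}

lemma field_bound (hΨa : AnalyticAt ℂ Ψ 0)
    (hΨ : ∀ᶠ x in 𝓝 (0 : ℂ × ℂ × ℝ), Ψ (x.1, x.2.1, star x.1, star x.2.1, (x.2.2 : ℂ)) = ((ψ x : ℝ) : ℂ))
    (hψc : ContinuousAt ψ 0) (hψ0 : ψ 0 = 0)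
    {Z : ℂ × ℂ × ℂ → ℂ × ℂ × ℂ} (hZ : AnalyticAt ℂ Z 0)
    (htan : ∀ᶠ q in 𝓝 (0 : ℂ × ℂ × ℂ), q ∈ M'set ψ → pairR (gradRho' ψ q) (Z q) = 0) :
    ∃ K : ℝ, 0 ≤ K ∧ ∀ᶠ q in 𝓝 (0 : ℂ × ℂ × ℂ), |pairR (gradRho' ψ q) (Z q)| ≤ K * ‖rhoC' ψ q‖ := by
  have h1 : ContDiffAt ℝ 1 (fun q => pairR (gradRho' ψ q) (Z q)) 0 := by
    have h2 : ContDiffAt ℝ 1 (fun q => 2⁻¹ * (fderiv ℂ (Rc Ψ) (q, star q) (Z q, star (Z q))).re) 0 := by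
      have hZr : ContDiffAt ℝ 1 Z 0 := hZ.contDiffAt.restrict_scalars ℝ
      have hst : ContDiff ℝ 1 (fun q : ℂ × ℂ × ℂ => star q) := (starL' ℝ (A := ℂ × ℂ × ℂ)).contDiff
      have h3 : ContDiffAt ℝ 1 (fun q : ℂ × ℂ × ℂ => ((q, star q), (Z q, star (Z q)))) 0 :=
        (contDiffAt_id.prodMk hst.contDiffAt).prodMk (hZr.prodMk (hst.contDiffAt.comp 0 hZr))
      have h4 : ContDiffAt ℂ 1 (fun x : ((ℂ × ℂ × ℂ) × (ℂ × ℂ × ℂ)) × ((ℂ × ℂ × ℂ) × (ℂ × ℂ × ℂ)) => fderiv ℂ (Rc Ψ) x.1 x.2)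
         ((0, star 0), (Z 0, star (Z 0))) := by
        rw [star_zero]
        refine ContDiffAt.clm_apply ?_ contDiffAt_snd
        exact (AnalyticAt.comp (g := fderiv ℂ (Rc Ψ)) (f := Prod.fst) (Rc_analytic hΨa).fderiv analyticAt_fst).contDiffAt
      have h5 : ContDiffAt ℝ 1 (fun x : ((ℂ × ℂ × ℂ) × (ℂ × ℂ × ℂ)) × ((ℂ × ℂ × ℂ) × (ℂ × ℂ × ℂ)) => fderiv ℂ (Rc Ψ) x.1 x.2)
         ((0, star 0), (Z 0, star (Z 0))) := h4.restrict_scalars ℝ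
      have h6 := h5.comp (0 : ℂ × ℂ × ℂ) h3
      exact contDiffAt_const.mul (Complex.reCLM.contDiff.contDiffAt.comp 0 h6)
    refine h2.congr_of_eventuallyEq ?_
    filter_upwards [diag_real hΨa hΨ] with q hq
    rw [hq, Complex.ofReal_re]
    simp only [pairR, LinearMap.coe_mk, AddHom.coe_mk]
    ring
  obtain ⟨K, t, ht, hL⟩ := h1.exists_lipschitzOnWith
  refine ⟨K, K.2, ?_⟩
  have hq : Tendsto (fun q : ℂ × ℂ × ℂ => (q.1, q.2.1, (⟨q.2.2.re, ψ (q.1, q.2.1, q.2.2.re)⟩ : ℂ))) (𝓝 0) (𝓝 0) := by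
    have h7 : ContinuousAt (fun q : ℂ × ℂ × ℂ => (q.1, q.2.1, ((q.2.2.re : ℂ) + (ψ (q.1, q.2.1, q.2.2.re) : ℂ) * I))) 0 := by
      have h8 : ContinuousAt (fun q : ℂ × ℂ × ℂ => ψ (q.1, q.2.1, q.2.2.re)) 0 :=
        ContinuousAt.comp (g := ψ) (f := fun q : ℂ × ℂ × ℂ => (q.1, q.2.1, q.2.2.re)) hψc (by fun_prop)
      fun_prop
    have h9 := h7.tendsto
    have e : ψ (0, 0, 0) = 0 := hψ0
    simp only [Prod.fst_zero, Prod.snd_zero, Complex.zero_re, e, Complex.ofReal_zero, zero_mul, add_zero] at h9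
    refine h9.congr fun q => ?_
    simp only [Prod.mk.injEq, true_and]
    apply Complex.ext <;> simp
  filter_upwards [ht, hq.eventually ht, hq.eventually htan] with q hq1 hq2 hq3
  have h10 := hL.dist_le_mul q hq1 _ hq2
  rw [hq3 (by simp [M'set]), Real.dist_eq, sub_zero] at h10
  refine h10.trans (mul_le_mul_of_nonneg_left ?_ K.2)
  rw [dist_eq_norm]
  have e : q - (q.1, q.2.1, (⟨q.2.2.re, ψ (q.1, q.2.1, q.2.2.re)⟩ : ℂ)) = (0, 0, rhoC' ψ q * I) := by
    refine Prod.ext (by simp) (Prod.ext (by simp) ?_)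
    apply Complex.ext <;> simp [rhoC']
  rw [e]
  simp [Prod.norm_def]

lemma M'set_iff (q : ℂ × ℂ × ℂ) : q ∈ M'set ψ ↔ rhoC' ψ q = 0 := by
  simp only [M'set, rhoC', Set.mem_ofPred_eq, Complex.ofReal_eq_zero, sub_eq_zero]

lemma flow_inv (hΨa : AnalyticAt ℂ Ψ 0)
    (hΨ : ∀ᶠ x in 𝓝 (0 : ℂ × ℂ × ℝ), Ψ (x.1, x.2.1, star x.1, star x.2.1, (x.2.2 : ℂ)) = ((ψ x : ℝ) : ℂ))
    (hψc : ContinuousAt ψ 0) (hψ0 : ψ 0 = 0) (hXa : ∀ i, AnalyticAt ℂ (X i) 0)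
    (htan : ∀ i, ∀ᶠ q in 𝓝 (0 : ℂ × ℂ × ℂ), q ∈ M'set ψ → pairR (gradRho' ψ q) (X i q) = 0)
    {σ : (Fin d → ℂ) × (ℂ × ℂ × ℂ) → ℂ × ℂ × ℂ}
    (hf : ∀ Ω ∈ 𝓝 (0 : ℂ × ℂ × ℂ), ∀ᶠ x in 𝓝 (0 : (Fin d → ℂ) × (ℂ × ℂ × ℂ)),
        ∃ γ : ℝ → ℂ × ℂ × ℂ, γ 0 = x.2 ∧ γ 1 = σ x ∧
          ∀ s ∈ Set.Icc (0:ℝ) 1, γ s ∈ Ω ∧ HasDerivAt γ (XX X x.1 (γ s)) s) :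
    ∀ᶠ x in 𝓝 (0 : (Fin d → ℝ) × (ℂ × ℂ × ℂ)), x.2 ∈ M'set ψ →
      σ ((fun i => (x.1 i : ℂ)), x.2) ∈ M'set ψ := by
  choose K hK0 hK using fun i => field_bound hΨa hΨ hψc hψ0 (hXa i) (htan i)
  have hΩ := hf _ (((eventually_all.2 hK).and ((diag_real hΨa hΨ).and ((Rc_diag hΨ).and
    (star_cont_zero.eventually (Rc_analytic hΨa).eventually_analyticAt)))).and (Rc_diag hΨ).eventually_nhds)
  have ht : Tendsto (fun x : (Fin d → ℝ) × (ℂ × ℂ × ℂ) => ((fun i => (x.1 i : ℂ)), x.2)) (𝓝 0) (𝓝 0) := by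
    refine Continuous.tendsto' (by fun_prop) _ _ ?_
    ext <;> simp
  filter_upwards [ht.eventually hΩ] with x ⟨γ, hγ0, hγ1, hγ⟩ hx
  rw [← hγ1, M'set_iff]
  have hder : ∀ s ∈ Set.Icc (0:ℝ) 1, HasDerivAt (fun s => rhoC' ψ (γ s))
      (((2 * ∑ i, x.1 i * pairR (gradRho' ψ (γ s)) (X i (γ s)) : ℝ)) : ℂ) s := by
    intro s hs
    obtain ⟨⟨h1, ⟨h2, h3, h4⟩⟩, h5⟩ := (hγ s hs).1
    have h6 := (hγ s hs).2
    have h7 : HasDerivAt (fun s => (γ s, star (γ s))) (XX X (fun i => (x.1 i : ℂ)) (γ s), star (XX X (fun i => (x.1 i : ℂ)) (γ s))) s :=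
      h6.prodMk h6.star
    have h8 := (h4.differentiableAt.hasFDerivAt.restrictScalars ℝ).comp_hasDerivAt s h7
    have h9 : HasDerivAt (fun s => rhoC' ψ (γ s)) _ s :=
      h8.congr_of_eventuallyEq (by
        filter_upwards [h6.continuousAt.eventually h5] with τ hτ
        exact hτ.symm)
    refine h9.congr_deriv ?_
    change fderiv ℂ (Rc Ψ) (γ s, star (γ s)) _ = _
    rw [h2]
    congr 2
    change pairR (gradRho' ψ (γ s)) (XX X (fun i => (x.1 i : ℂ)) (γ s)) = _
    simp only [XX]
    rw [map_sum]
    refine Finset.sum_congr rfl fun i _ => ?_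
    rw [Complex.coe_smul, map_smul, smul_eq_mul]
  refine eq_zero_of_abs_deriv_le_mul_abs_self_of_eq_zero_right (f := fun s => rhoC' ψ (γ s))
    (K := 2 * ∑ i, |x.1 i| * K i) (a := 0) (b := 1) (fun s hs => (hder s hs).continuousAt.continuousWithinAt)
    (fun s hs => (hder s ⟨hs.1, hs.2.le⟩).hasDerivWithinAt) (by simp only [hγ0]; rwa [← M'set_iff]) ?_ 1 (by simp)
  intro s hs
  have h1 := (hγ s ⟨hs.1, hs.2.le⟩).1.1.1
  rw [Complex.norm_real, norm_mul, Real.norm_of_nonneg (by norm_num : (0:ℝ) ≤ 2), mul_assoc, Finset.sum_mul]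
  gcongr
  refine (norm_sum_le _ _).trans (Finset.sum_le_sum fun i _ => ?_)
  rw [norm_mul, mul_assoc]
  exact mul_le_mul_of_nonneg_left (h1 i) (norm_nonneg _)
end inv
end PartOfM

section PartOfN
open Complex Filter Topology Metric
open scoped ContDiff

section geo
variable {φ : ℂ × ℝ → ℝ} {Φ U : ℂ × ℂ × ℂ → ℂ}

noncomputable def hatp (p : ℂ × ℝ) : ℂ × ℂ × ℂ := (p.1, star p.1, (p.2 : ℂ))

lemma wz_of_analytic {F : ℂ × ℂ × ℂ → ℂ} {g : ℂ × ℝ → ℂ} {p : ℂ × ℝ} (hF : AnalyticAt ℂ F (hatp p))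
    (hg : ∀ᶠ q in 𝓝 p, F (hatp q) = g q) :
    wzPhi g p = fderiv ℂ F (hatp p) (1, 0, 0) ∧ wzBarPhi g p = fderiv ℂ F (hatp p) (0, 1, 0) := by
  have hd : HasFDerivAt hatp ((ContinuousLinearMap.fst ℝ ℂ ℝ).prod
    (((starL' ℝ (A := ℂ) : ℂ →L[ℝ] ℂ).comp (ContinuousLinearMap.fst ℝ ℂ ℝ)).prod
      (Complex.ofRealCLM.comp (ContinuousLinearMap.snd ℝ ℂ ℝ)))) p :=
    ((ContinuousLinearMap.fst ℝ ℂ ℝ).prod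
    (((starL' ℝ (A := ℂ) : ℂ →L[ℝ] ℂ).comp (ContinuousLinearMap.fst ℝ ℂ ℝ)).prod
      (Complex.ofRealCLM.comp (ContinuousLinearMap.snd ℝ ℂ ℝ)))).hasFDerivAt
  have h1 := (hF.differentiableAt.hasFDerivAt.restrictScalars ℝ).comp p hd
  have h2 : HasFDerivAt g _ p := h1.congr_of_eventuallyEq (by
    filter_upwards [hg] with q hq
    exact hq.symm)
  unfold wzPhi wzBarPhi
  rw [h2.fderiv]
  have e1 : ∀ v : ℂ × ℝ, (((fderiv ℂ F (hatp p)).restrictScalars ℝ).comp ((ContinuousLinearMap.fst ℝ ℂ ℝ).prod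
    (((starL' ℝ (A := ℂ) : ℂ →L[ℝ] ℂ).comp (ContinuousLinearMap.fst ℝ ℂ ℝ)).prod
      (Complex.ofRealCLM.comp (ContinuousLinearMap.snd ℝ ℂ ℝ))))) v = v.1 * fderiv ℂ F (hatp p) (1, 0, 0) +
        star v.1 * fderiv ℂ F (hatp p) (0, 1, 0) + (v.2 : ℂ) * fderiv ℂ F (hatp p) (0, 0, 1) := by
    intro v
    simp only [← smul_eq_mul, ← map_smul, ← map_add]
    change fderiv ℂ F (hatp p) _ = _
    congr 1
    simp
  rw [e1, e1]
  constructor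
  · simp
    linear_combination (-1/2 * fderiv ℂ F (hatp p) (1, 0, 0) + 1/2 * fderiv ℂ F (hatp p) (0, 1, 0)) * I_mul_I
  · simp
    linear_combination (1/2 * fderiv ℂ F (hatp p) (1, 0, 0) - 1/2 * fderiv ℂ F (hatp p) (0, 1, 0)) * I_mul_I

lemma levi_eq (hΦa : AnalyticAt ℂ Φ 0)
    (hΦ : ∀ᶠ x in 𝓝 (0 : ℂ × ℝ), Φ (x.1, star x.1, (x.2 : ℂ)) = ((φ x : ℝ) : ℂ)) :
    wzPhi (fun p => wzBarPhi (fun q => ((φ q : ℝ) : ℂ)) p) 0 = fderiv ℂ (fderiv ℂ Φ) 0 (1, 0, 0) (0, 1, 0) := by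
  have e0 : hatp 0 = 0 := by simp [hatp]
  have ht : Tendsto hatp (𝓝 0) (𝓝 0) := by
    refine Continuous.tendsto' ?_ _ _ e0
    unfold hatp; fun_prop
  have h1 : ∀ᶠ p in 𝓝 (0 : ℂ × ℝ), (fun x => fderiv ℂ Φ x (0, 1, 0)) (hatp p) = wzBarPhi (fun q => ((φ q : ℝ) : ℂ)) p := by
    filter_upwards [hΦ.eventually_nhds, ht.eventually hΦa.eventually_analyticAt] with p hp hp2
    exact (wz_of_analytic hp2 hp).2.symm
  have hF : AnalyticAt ℂ (fun x => fderiv ℂ Φ x (0, 1, 0)) (hatp 0) := by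
    rw [e0]; exact fderiv_apply_analytic hΦa _
  rw [(wz_of_analytic hF h1).1, e0]
  have h2 := (hΦa.fderiv.differentiableAt.hasFDerivAt).clm_apply (hasFDerivAt_const ((0:ℂ), (1:ℂ), (0:ℂ)) (0 : ℂ × ℂ × ℂ))
  rw [h2.fderiv]
  simp

lemma taylor2 (hΦa : AnalyticAt ℂ Φ 0) (h0 : Φ 0 = 0) (h1 : fderiv ℂ Φ 0 = 0) (η : ℝ) (hη : 0 < η) :
    ∀ᶠ x in 𝓝 (0 : ℂ × ℂ × ℂ), ‖Φ x - 2⁻¹ * fderiv ℂ (fderiv ℂ Φ) 0 x x‖ ≤ η * ‖x‖ ^ 2 := by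
  set B := fderiv ℂ (fderiv ℂ Φ) 0 with hB
  have hsymm : ∀ v w, B v w = B w v := by
    have := (hΦa.contDiffAt (n := ⊤)).isSymmSndFDerivAt (by simp)
    exact fun v w => this v w
  have hlo : ∀ᶠ x in 𝓝 (0 : ℂ × ℂ × ℂ), ‖fderiv ℂ Φ x - B x‖ ≤ η * ‖x‖ := by
    have := (hΦa.fderiv.differentiableAt.hasFDerivAt).isLittleO.bound hη
    simpa [h1] using this
  obtain ⟨r, hr, hb⟩ := Metric.eventually_nhds_iff_ball.1 (hlo.and hΦa.eventually_analyticAt)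
  filter_upwards [ball_mem_nhds (0 : ℂ × ℂ × ℂ) hr] with x hx
  rw [mem_ball_zero_iff] at hx
  have hd : ∀ y ∈ closedBall (0 : ℂ × ℂ × ℂ) ‖x‖, HasFDerivWithinAt (fun y => Φ y - 2⁻¹ * B y y)
      (fderiv ℂ Φ y - B y) (closedBall 0 ‖x‖) y := by
    intro y hy
    rw [mem_closedBall_zero_iff] at hy
    have hy2 := hb y (by rw [mem_ball_zero_iff]; exact hy.trans_lt hx)
    have h3 := ((B.hasFDerivAt (x := y)).clm_apply (hasFDerivAt_id y)).const_mul (2⁻¹ : ℂ)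
    have h4 := hy2.2.differentiableAt.hasFDerivAt.sub h3
    refine (h4.congr_fderiv ?_).hasFDerivWithinAt
    refine ContinuousLinearMap.ext fun v => ?_
    simp
    rw [hsymm v y]
    ring
  have h5 := (convex_closedBall (0 : ℂ × ℂ × ℂ) ‖x‖).norm_image_sub_le_of_norm_hasFDerivWithin_le (𝕜 := ℂ) hd
    (C := η * ‖x‖) (fun y hy => by
      rw [mem_closedBall_zero_iff] at hy
      refine (hb y (by rw [mem_ball_zero_iff]; exact hy.trans_lt hx)).1.trans ?_
      gcongr) (x := 0) (y := x) (by simp) (by simp)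
  simp [h0] at h5
  calc _ ≤ _ := h5
    _ = _ := by ring

lemma taylor3 (hΦa : AnalyticAt ℂ Φ 0) (h0 : Φ 0 = 0) (h1 : fderiv ℂ Φ 0 = 0) :
    ∃ e e' : ℂ, ∃ C : ℝ, 0 ≤ C ∧ ∀ η > (0:ℝ), ∀ᶠ x in 𝓝 (0 : ℂ × ℂ × ℂ),
      ‖Φ x - (e * x.1 ^ 2 + fderiv ℂ (fderiv ℂ Φ) 0 (1, 0, 0) (0, 1, 0) * (x.1 * x.2.1) + e' * x.2.1 ^ 2)‖
        ≤ η * ‖x‖ ^ 2 + C * (‖x‖ * ‖x.2.2‖) := by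
  set B := fderiv ℂ (fderiv ℂ Φ) 0 with hB
  have hsymm : ∀ v w, B v w = B w v := by
    have := (hΦa.contDiffAt (n := ⊤)).isSymmSndFDerivAt (by simp)
    exact fun v w => this v w
  refine ⟨2⁻¹ * B (1, 0, 0) (1, 0, 0), 2⁻¹ * B (0, 1, 0) (0, 1, 0), ‖B‖ + ‖B‖, by positivity, fun η hη => ?_⟩
  filter_upwards [taylor2 hΦa h0 h1 η hη] with x hx
  have e : Φ x - (2⁻¹ * B (1, 0, 0) (1, 0, 0) * x.1 ^ 2 + B (1, 0, 0) (0, 1, 0) * (x.1 * x.2.1) +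
      2⁻¹ * B (0, 1, 0) (0, 1, 0) * x.2.1 ^ 2) = (Φ x - 2⁻¹ * B x x) + (B x (0, 0, x.2.2) - 2⁻¹ * B (0, 0, x.2.2) (0, 0, x.2.2)) := by
    have ex : x = x.1 • ((1:ℂ), (0:ℂ), (0:ℂ)) + x.2.1 • ((0:ℂ), (1:ℂ), (0:ℂ)) + ((0:ℂ), (0:ℂ), x.2.2) := by
      refine Prod.ext (by simp) (Prod.ext (by simp) (by simp))
    generalize x.1 = z at *
    generalize x.2.1 = χ at *
    generalize ((0:ℂ), (0:ℂ), x.2.2) = y at *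
    generalize ((0:ℂ), (1:ℂ), (0:ℂ)) = e2 at *
    generalize ((1:ℂ), (0:ℂ), (0:ℂ)) = e1 at *
    have e3 : B x x = z ^ 2 * B e1 e1 + 2 * (z * χ) * B e1 e2 + χ ^ 2 * B e2 e2 + 2 * (z * B e1 y) + 2 * (χ * B e2 y) + B y y := by
      rw [ex]
      simp only [map_add, map_smul, add_apply, smul_apply, smul_eq_mul]
      rw [hsymm e2 e1, hsymm y e1, hsymm y e2]; ring
    have e4 : B x y = z * B e1 y + χ * B e2 y + B y y := by
      rw [ex]
      simp only [map_add, map_smul, add_apply, smul_apply, smul_eq_mul]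
    rw [e3, e4]; ring
  rw [e]
  have hu : ‖((0:ℂ), (0:ℂ), x.2.2)‖ = ‖x.2.2‖ := by simp [Prod.norm_def]
  have hu2 : ‖x.2.2‖ ≤ ‖x‖ := (norm_snd_le x.2).trans (norm_snd_le x)
  have b1 : ‖B x (0, 0, x.2.2)‖ ≤ ‖B‖ * (‖x‖ * ‖x.2.2‖) := by
    have := B.le_opNorm₂ x (0, 0, x.2.2)
    rw [hu, mul_assoc] at this; exact this
  have b2 : ‖2⁻¹ * B (0, 0, x.2.2) (0, 0, x.2.2)‖ ≤ ‖B‖ * (‖x‖ * ‖x.2.2‖) := by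
    have := B.le_opNorm₂ (0, 0, x.2.2) (0, 0, x.2.2)
    rw [hu, mul_assoc] at this
    rw [norm_mul]
    calc _ ≤ 1 * (‖B‖ * (‖x.2.2‖ * ‖x.2.2‖)) := by
          gcongr; simp; norm_num
      _ ≤ ‖B‖ * (‖x‖ * ‖x.2.2‖) := by rw [one_mul]; gcongr
  calc _ ≤ ‖Φ x - 2⁻¹ * B x x‖ + (‖B x (0, 0, x.2.2)‖ + ‖2⁻¹ * B (0, 0, x.2.2) (0, 0, x.2.2)‖) :=
        (norm_add_le _ _).trans (by gcongr; exact norm_sub_le _ _)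
    _ ≤ _ := by linarith
end geo
end PartOfN

section PartOfO
open Complex Filter Topology Metric
open scoped ContDiff

section geo2
variable {φ : ℂ × ℝ → ℝ} {Φ U : ℂ × ℂ × ℂ → ℂ}

set_option maxHeartbeats 1600000 in
lemma geo (hΦa : AnalyticAt ℂ Φ 0) (h0 : Φ 0 = 0) (h1 : fderiv ℂ Φ 0 = 0)
    (hUa : AnalyticAt ℂ U 0) (hU0 : U 0 = 0)
    (hU : ∀ᶠ x in 𝓝 (0 : ℂ × ℂ × ℂ), U x + I * Φ (x.1, x.2.1, U x) = x.2.2)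
    (hc : fderiv ℂ (fderiv ℂ Φ) 0 (1, 0, 0) (0, 1, 0) ≠ 0) :
    ∃ e : ℂ, ∀ R > (0:ℝ), ∃ a β : ℝ, 0 < a ∧ a < R ∧ 0 < β ∧ β < R ∧ ∀ z ϖ : ℂ, ‖z‖ = a → ‖ϖ‖ ≤ β →
      ∃ χ : ℂ, ‖χ‖ < a / 2 ∧ ‖star (Tc Φ U (z, χ, ϖ + 2 * I * e * z ^ 2)) - 2 * I * e * (star χ) ^ 2‖ < β / 2 := by
  obtain ⟨e, e', C, hC, hT⟩ := taylor3 hΦa h0 h1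
  set c := fderiv ℂ (fderiv ℂ Φ) 0 (1, 0, 0) (0, 1, 0) with hcdef
  have hc0 : 0 < ‖c‖ := norm_pos_iff.2 hc
  refine ⟨e, fun R hR => ?_⟩
  obtain ⟨K, hK⟩ := (hUa.differentiableAt.isBigO_sub).bound
  rw [hU0] at hK
  simp only [sub_zero] at hK
  have t0 : ∀ (f : ℝ → ℝ) (m : ℝ), Continuous f → f 0 = 0 → 0 < m → ∀ᶠ a in 𝓝[>] (0:ℝ), f a < m := by
    intro f m hf hf0 hm
    exact (Tendsto.mono_left (hf.tendsto' 0 0 hf0) nhdsWithin_le_nhds).eventually_lt_const hm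
  obtain ⟨b, hb0, hb1, hb2, hb3⟩ : ∃ b : ℝ, 0 < b ∧ b ≤ 1 ∧ b < ‖c‖ ∧ (‖e‖ + ‖e'‖) * b ≤ ‖c‖ ^ 2 / 4 := by
    have t1 : ∀ᶠ b in 𝓝[>] (0:ℝ), b < 1 := (tendsto_id.mono_left nhdsWithin_le_nhds).eventually_lt_const one_pos
    have t2 : ∀ᶠ b in 𝓝[>] (0:ℝ), b < ‖c‖ := (tendsto_id.mono_left nhdsWithin_le_nhds).eventually_lt_const hc0
    have t3 : ∀ᶠ b in 𝓝[>] (0:ℝ), (‖e‖ + ‖e'‖) * b < ‖c‖ ^ 2 / 4 :=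
      t0 (fun b => (‖e‖ + ‖e'‖) * b) _ (by fun_prop) (by simp) (by positivity)
    obtain ⟨b, ⟨⟨h1, h2⟩, h3⟩, h4⟩ := (((t1.and t2).and t3).and self_mem_nhdsWithin).exists
    exact ⟨b, h4, h1.le, h2, h3.le⟩
  set K' := max 1 K with hK'
  have hK1 : 1 ≤ K' := le_max_left _ _
  have hK0 : 0 < K' := by linarith
  set A0 := 1 + 2 * ‖e‖ with hA0
  set C2 := ‖e‖ + ‖c‖ + ‖e'‖ + 1 + C with hC2
  set C3 := A0 + C2 * K' ^ 2 with hC3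
  have hC20 : 0 ≤ C2 := by positivity
  have hC30 : 0 ≤ C3 := by positivity
  set η := b / (16 * K' ^ 2) with hηdef
  have hη : 0 < η := by positivity
  obtain ⟨ρ, hρ, hρb⟩ := Metric.eventually_nhds_iff_ball.1 ((hK.and hU).and ((hT η hη).and (hT 1 one_pos)))
  obtain ⟨a, ha0, ha1, ha2, ha3, ha4, ha5⟩ : ∃ a : ℝ, 0 < a ∧ a < R ∧ b * a ^ 2 < R ∧ A0 * a ≤ 1 ∧ K' * a < ρ ∧ C * K' * C3 * a ≤ b / 16 := by
    obtain ⟨a, ⟨⟨⟨⟨s1, s2⟩, s3⟩, s4⟩, s5⟩, s6⟩ := (((((t0 (fun a => a) R (by fun_prop) (by simp) hR).and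
      (t0 (fun a => b * a ^ 2) R (by fun_prop) (by simp) hR)).and
      (t0 (fun a => A0 * a) 1 (by fun_prop) (by simp) one_pos)).and
      (t0 (fun a => K' * a) ρ (by fun_prop) (by simp) hρ)).and
      (t0 (fun a => C * K' * C3 * a) (b / 16) (by fun_prop) (by simp) (by positivity))).and self_mem_nhdsWithin |>.exists
    exact ⟨a, s6, s1, s2, s3.le, s4, s5.le⟩
  refine ⟨a, b * a ^ 2, ha0, ha1, by positivity, ha2, fun z ϖ hz hϖ => ?_⟩
  have hzne : z ≠ 0 := by rw [← norm_pos_iff, hz]; exact ha0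
  set χ := ϖ / (2 * I * c * z) with hχdef
  have hχ : ‖χ‖ ≤ b * a / (2 * ‖c‖) := by
    rw [hχdef, norm_div]
    simp only [norm_mul, Complex.norm_ofNat, Complex.norm_I, mul_one, hz]
    rw [div_le_div_iff₀ (by positivity) (by positivity)]
    calc ‖ϖ‖ * (2 * ‖c‖) ≤ (b * a ^ 2) * (2 * ‖c‖) := by gcongr
      _ = b * a * (2 * ‖c‖ * a) := by ring
  have hχ2 : ‖χ‖ < a / 2 := by
    refine hχ.trans_lt ?_
    rw [div_lt_div_iff₀ (by positivity) (by norm_num)]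
    have : b * a < ‖c‖ * a := by gcongr
    linarith
  refine ⟨χ, hχ2, ?_⟩
  set w := ϖ + 2 * I * e * z ^ 2 with hw
  have hwb : ‖w‖ ≤ A0 * a ^ 2 := by
    calc ‖w‖ ≤ ‖ϖ‖ + ‖2 * I * e * z ^ 2‖ := norm_add_le _ _
      _ ≤ b * a ^ 2 + 2 * ‖e‖ * a ^ 2 := by
        simp only [norm_mul, Complex.norm_ofNat, Complex.norm_I, mul_one, norm_pow, hz]
        gcongr
      _ ≤ 1 * a ^ 2 + 2 * ‖e‖ * a ^ 2 := by gcongr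
      _ = _ := by rw [hA0]; ring
  have hwa : ‖w‖ ≤ a := hwb.trans (by nlinarith)
  have hx0 : ‖((z, χ, w) : ℂ × ℂ × ℂ)‖ ≤ a := by
    simp only [Prod.norm_def]
    refine max_le hz.le (max_le (by linarith) hwa)
  have haρ : a < ρ := lt_of_le_of_lt (by nlinarith) ha4
  obtain ⟨⟨g1, g2⟩, -⟩ := hρb (z, χ, w) (by rw [mem_ball_zero_iff]; exact hx0.trans_lt haρ)
  simp only at g2
  set u := U (z, χ, w) with hu
  have hua : ‖u‖ ≤ K' * a := by
    refine g1.trans ?_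
    have : K ≤ K' := le_max_right _ _
    gcongr
  have hx : ‖((z, χ, u) : ℂ × ℂ × ℂ)‖ ≤ K' * a := by
    simp only [Prod.norm_def]
    refine max_le ?_ (max_le ?_ hua)
    · rw [hz]; nlinarith
    · nlinarith
  obtain ⟨-, g3, g4⟩ := hρb (z, χ, u) (by rw [mem_ball_zero_iff]; exact hx.trans_lt ha4)
  simp only at g3 g4
  have n1 : ‖z‖ ≤ ‖((z, χ, u) : ℂ × ℂ × ℂ)‖ := norm_fst_le (z, χ, u)
  have n2 : ‖χ‖ ≤ ‖((z, χ, u) : ℂ × ℂ × ℂ)‖ := (norm_fst_le (χ, u)).trans (norm_snd_le (z, χ, u))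
  have n3 : ‖u‖ ≤ ‖((z, χ, u) : ℂ × ℂ × ℂ)‖ := (norm_snd_le (χ, u)).trans (norm_snd_le (z, χ, u))
  set N := ‖((z, χ, u) : ℂ × ℂ × ℂ)‖ with hN
  have hN0 : 0 ≤ N := norm_nonneg _
  have hPhi : ‖Φ (z, χ, u)‖ ≤ C2 * N ^ 2 := by
    have q1 : ‖e * z ^ 2 + c * (z * χ) + e' * χ ^ 2‖ ≤ (‖e‖ + ‖c‖ + ‖e'‖) * N ^ 2 := by
      calc _ ≤ ‖e * z ^ 2‖ + ‖c * (z * χ)‖ + ‖e' * χ ^ 2‖ := norm_add₃_le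
        _ = ‖e‖ * ‖z‖ ^ 2 + ‖c‖ * (‖z‖ * ‖χ‖) + ‖e'‖ * ‖χ‖ ^ 2 := by simp only [norm_mul, norm_pow]
        _ ≤ ‖e‖ * N ^ 2 + ‖c‖ * (N * N) + ‖e'‖ * N ^ 2 := by gcongr
        _ = _ := by ring
    calc ‖Φ (z, χ, u)‖ ≤ ‖Φ (z, χ, u) - (e * z ^ 2 + c * (z * χ) + e' * χ ^ 2)‖ + ‖e * z ^ 2 + c * (z * χ) + e' * χ ^ 2‖ := by
          have := norm_add_le (Φ (z, χ, u) - (e * z ^ 2 + c * (z * χ) + e' * χ ^ 2)) (e * z ^ 2 + c * (z * χ) + e' * χ ^ 2)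
          rwa [sub_add_cancel] at this
      _ ≤ (1 * N ^ 2 + C * (N * N)) + (‖e‖ + ‖c‖ + ‖e'‖) * N ^ 2 := by
          refine add_le_add (g4.trans ?_) q1
          gcongr
      _ = _ := by rw [hC2]; ring
  have hu2 : ‖u‖ ≤ C3 * a ^ 2 := by
    have : u = w - I * Φ (z, χ, u) := by rw [← g2]; ring
    calc ‖u‖ = ‖w - I * Φ (z, χ, u)‖ := by rw [← this]
      _ ≤ ‖w‖ + ‖I * Φ (z, χ, u)‖ := norm_sub_le _ _
      _ ≤ A0 * a ^ 2 + C2 * (K' * a) ^ 2 := by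
        rw [norm_mul, Complex.norm_I, one_mul]
        refine add_le_add hwb (hPhi.trans ?_)
        gcongr
      _ = _ := by rw [hC3]; ring
  have hE : ‖Φ (z, χ, u) - (e * z ^ 2 + c * (z * χ) + e' * χ ^ 2)‖ ≤ b * a ^ 2 / 8 := by
    calc _ ≤ η * N ^ 2 + C * (N * ‖u‖) := g3
      _ ≤ η * (K' * a) ^ 2 + C * ((K' * a) * (C3 * a ^ 2)) := by gcongr
      _ = b * a ^ 2 / 16 + (C * K' * C3 * a) * a ^ 2 := by
        rw [hηdef]; field_simp
      _ ≤ b * a ^ 2 / 16 + (b / 16) * a ^ 2 := by gcongr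
      _ = _ := by ring
  have hid : star (Tc Φ U (z, χ, w)) - 2 * I * e * (star χ) ^ 2 =
      star (-2 * I * (Φ (z, χ, u) - (e * z ^ 2 + c * (z * χ) + e' * χ ^ 2)) + (2 * I * (star e - e') * χ ^ 2)) := by
    have e1 : 2 * I * e * (star χ) ^ 2 = star (-2 * I * star e * χ ^ 2) := by
      simp only [star_mul', star_pow, star_neg, Complex.star_def, Complex.conj_I, Complex.conj_ofNat, Complex.conj_conj]
      ring
    rw [e1, ← star_sub]
    congr 1
    have e2 : ϖ = 2 * I * c * z * χ := by
      rw [hχdef]; field_simp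
    simp only [Tc]
    rw [← hu]
    linear_combination e2
  rw [hid, norm_star]
  have hlast : ‖2 * I * (star e - e') * χ ^ 2‖ ≤ b * a ^ 2 / 8 := by
    have q : ‖star e - e'‖ ≤ ‖e‖ + ‖e'‖ := by
      have := norm_sub_le (star e) e'
      rwa [norm_star] at this
    simp only [norm_mul, norm_pow, Complex.norm_ofNat, Complex.norm_I, mul_one]
    calc 2 * ‖star e - e'‖ * ‖χ‖ ^ 2 ≤ 2 * (‖e‖ + ‖e'‖) * (b * a / (2 * ‖c‖)) ^ 2 := by gcongr
      _ = ((‖e‖ + ‖e'‖) * b) * (b * a ^ 2) / (2 * ‖c‖ ^ 2) := by field_simp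
      _ ≤ (‖c‖ ^ 2 / 4) * (b * a ^ 2) / (2 * ‖c‖ ^ 2) := by gcongr
      _ = _ := by field_simp; ring
  have hba : 0 < b * a ^ 2 := by positivity
  calc _ ≤ ‖-2 * I * (Φ (z, χ, u) - (e * z ^ 2 + c * (z * χ) + e' * χ ^ 2))‖ + ‖2 * I * (star e - e') * χ ^ 2‖ := norm_add_le _ _
    _ ≤ 2 * (b * a ^ 2 / 8) + b * a ^ 2 / 8 := by
      refine add_le_add ?_ hlast
      rw [norm_mul]
      simp only [norm_mul, norm_neg, Complex.norm_ofNat, Complex.norm_I, mul_one]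
      gcongr
    _ < b * a ^ 2 / 2 := by linarith
end geo2
end PartOfO

section PartOfP
open Complex Filter Topology Metric
open scoped ContDiff

lemma strict_lim {ι E F : Type*} [NormedAddCommGroup E] [NormedSpace ℂ E] [NormedAddCommGroup F] [NormedSpace ℂ F]
    {f : E → F} {f' : E →L[ℂ] F} {x0 : E} (hf : HasStrictFDerivAt f f' x0) {l : Filter ι} [l.NeBot]
    {x y : ι → E} {c : ι → ℂ} {v : E} (hx : Tendsto x l (𝓝 x0)) (hy : Tendsto y l (𝓝 x0))
    (hv : Tendsto (fun n => c n • (y n - x n)) l (𝓝 v)) (he : ∀ᶠ n in l, f (y n) = f (x n)) : f' v = 0 := by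
  have h1 : ∀ η > (0:ℝ), ‖f' v‖ ≤ η * ‖v‖ := by
    intro η hη
    have h2 : ∀ᶠ n in l, ‖f' (c n • (y n - x n))‖ ≤ η * ‖c n • (y n - x n)‖ := by
      have h3 : Tendsto (fun n => (y n, x n)) l (𝓝 (x0, x0)) := hy.prodMk_nhds hx
      filter_upwards [h3.eventually (hf.isLittleO.bound hη), he] with n hn hn2
      rw [hn2, sub_self, zero_sub, norm_neg] at hn
      rw [map_smul, norm_smul, norm_smul]
      calc _ ≤ ‖c n‖ * (η * ‖y n - x n‖) := by gcongr
        _ = _ := by ring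
    exact le_of_tendsto_of_tendsto ((f'.continuous.tendsto v).comp hv).norm (hv.norm.const_mul η) h2
  have h4 : ‖f' v‖ ≤ 0 := by
    have h5 : Tendsto (fun η : ℝ => η * ‖v‖) (𝓝[>] 0) (𝓝 0) := by
      refine Tendsto.mono_left ?_ nhdsWithin_le_nhds
      exact Continuous.tendsto' (by fun_prop) _ _ (by simp)
    refine ge_of_tendsto h5 ?_
    filter_upwards [self_mem_nhdsWithin] with η hη using h1 η hη
  simpa using h4

lemma points {d : ℕ} {X : Fin d → ℂ × ℂ × ℂ → ℂ × ℂ × ℂ} {H : ℂ × ℂ → ℂ × ℂ × ℂ}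
    (hinj : ∀ t : Fin d → ℝ, (∀ᶠ p in 𝓝 (0 : ℂ × ℂ), ∑ i, t i • X i (H p) = 0) → t = 0)
    {V : Set (ℂ × ℂ)} (hV : V ∈ 𝓝 0) :
    ∃ s : Finset (ℂ × ℂ), (↑s : Set (ℂ × ℂ)) ⊆ V ∧ ∃ π : (s → ℂ × ℂ × ℂ) →ₗ[ℝ] (Fin d → ℝ),
      ∀ t : Fin d → ℝ, π (fun p => ∑ i, t i • X i (H p)) = t := by
  let L : ℂ × ℂ → (Fin d → ℝ) →ₗ[ℝ] ℂ × ℂ × ℂ := fun p =>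
    ∑ i, (LinearMap.proj (R := ℝ) (φ := fun _ : Fin d => ℝ) i).smulRight (X i (H p))
  have hL : ∀ p t, L p t = ∑ i, t i • X i (H p) := by
    intro p t; simp [L]
  obtain ⟨s0, hs0⟩ := Finset.exists_inf_le (fun p : V => LinearMap.ker (L p))
  classical
  refine ⟨s0.image Subtype.val, by simp, ?_⟩
  let Λ : (Fin d → ℝ) →ₗ[ℝ] (↥(s0.image Subtype.val) → ℂ × ℂ × ℂ) := LinearMap.pi fun p => L p
  have hΛ : LinearMap.ker Λ = ⊥ := by
    rw [LinearMap.ker_eq_bot']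
    intro t ht
    refine hinj t ?_
    have h1 : t ∈ s0.inf (fun p : V => LinearMap.ker (L p)) := by
      rw [Submodule.mem_finsetInf]
      intro p hp
      have := congrFun ht ⟨p, Finset.mem_image_of_mem _ hp⟩
      exact this
    filter_upwards [hV] with p hp
    have h2 := hs0 ⟨p, hp⟩ h1
    rw [LinearMap.mem_ker, hL] at h2
    exact h2
  obtain ⟨π, hπ⟩ := LinearMap.exists_leftInverse_of_injective Λ hΛ
  refine ⟨π, fun t => ?_⟩
  have := LinearMap.congr_fun hπ t
  simp only [LinearMap.comp_apply, LinearMap.id_apply] at this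
  rw [← this]
  congr 1
  funext p
  rw [this]
  exact (hL p t).symm

noncomputable def kap (e : ℂ) (v : ℂ × ℂ) : ℂ × ℂ := (v.1, v.2 + 2 * I * e * v.1 ^ 2)
noncomputable def kapi (e : ℂ) (v : ℂ × ℂ) : ℂ × ℂ := (v.1, v.2 - 2 * I * e * v.1 ^ 2)
lemma kap_kapi (e v) : kap e (kapi e v) = v := by simp [kap, kapi]
lemma kapi_kap (e v) : kapi e (kap e v) = v := by simp [kap, kapi]
lemma kap_diff (e : ℂ) : ContDiff ℂ ω (kap e) := by unfold kap; fun_prop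
lemma kapi_diff (e : ℂ) : ContDiff ℂ ω (kapi e) := by unfold kapi; fun_prop
lemma kap_zero (e : ℂ) : kap e 0 = 0 := by simp [kap]
lemma kapi_zero (e : ℂ) : kapi e 0 = 0 := by simp [kapi]

lemma extract (e : ℂ) (a β r1 : ℝ) (ha : 0 < a)
    (hk : ∀ v : ℂ × ℂ, ‖v.1‖ ≤ a → ‖v.2‖ ≤ β → kap e v ∈ ball (0 : ℂ × ℂ) r1)
    (h : ℕ → ℂ × ℂ → ℂ × ℂ × ℂ) (H : ℂ × ℂ → ℂ × ℂ × ℂ)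
    (hd : ∀ n, DifferentiableOn ℂ (h n) (ball 0 r1)) (hH : DifferentiableOn ℂ H (ball 0 r1))
    (hne : ∀ n, ∃ v : ℂ × ℂ, ‖v.1‖ ≤ a ∧ ‖v.2‖ ≤ β ∧ h n (kap e v) ≠ H (kap e v)) (U : Ultrafilter ℕ) :
    ∃ (ε : ℕ → ℝ) (v : ℕ → ℂ × ℂ) (v0 : ℂ × ℂ) (d0 : ℂ × ℂ × ℂ) (α : ℂ × ℂ → ℂ × ℂ × ℂ),
      (∀ n, 0 < ε n) ∧ (∀ n, ‖(v n).1‖ = a ∧ ‖(v n).2‖ ≤ β) ∧ ‖v0.1‖ = a ∧ ‖v0.2‖ ≤ β ∧ ‖d0‖ = 1 ∧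
      Tendsto v U (𝓝 v0) ∧
      Tendsto (fun n => (ε n : ℂ)⁻¹ • (h n (kap e (v n)) - H (kap e (v n)))) U (𝓝 d0) ∧
      AnalyticOnNhd ℂ α (ball 0 a ×ˢ ball 0 β) ∧ ∀ p ∈ (ball (0:ℂ) a ×ˢ ball (0:ℂ) β),
        Tendsto (fun x : ℕ × (ℂ × ℂ) => (ε x.1 : ℂ)⁻¹ • (h x.1 (kap e x.2) - H (kap e x.2))) ((U : Filter ℕ) ×ˢ 𝓝 p) (𝓝 (α p)) := by
  let D : ℕ → ℂ × ℂ → ℂ × ℂ × ℂ := fun n v => h n (kap e v) - H (kap e v)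
  have hDd : ∀ n (v : ℂ × ℂ), ‖v.1‖ ≤ a → ‖v.2‖ ≤ β → DifferentiableAt ℂ (D n) v := by
    intro n v h1 h2
    have hm := isOpen_ball.mem_nhds (hk v h1 h2)
    have hkd : DifferentiableAt ℂ (kap e) v := (kap_diff e).contDiffAt.differentiableAt (by simp)
    exact (((hd n _ (hk v h1 h2)).differentiableAt hm).comp v hkd).sub (((hH _ (hk v h1 h2)).differentiableAt hm).comp v hkd)
  have hmax : ∀ n, ∃ v : ℂ × ℂ, ‖v.1‖ = a ∧ ‖v.2‖ ≤ β ∧ 0 < ‖D n v‖ ∧ ∀ u : ℂ × ℂ, ‖u.1‖ ≤ a → ‖u.2‖ ≤ β → ‖D n u‖ ≤ ‖D n v‖ := by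
    intro n
    obtain ⟨u, hu1, hu2, hu3⟩ := hne n
    have hcpt : IsCompact ((closedBall (0:ℂ) a) ×ˢ (closedBall (0:ℂ) β)) := (isCompact_closedBall _ _).prod (isCompact_closedBall _ _)
    obtain ⟨m, hm, hmm⟩ := hcpt.exists_isMaxOn (f := fun v => ‖D n v‖) ⟨u, by simp [hu1, hu2]⟩ (fun v hv => by
      simp only [Set.mem_prod, mem_closedBall_zero_iff] at hv
      exact (hDd n v hv.1 hv.2).continuousAt.norm.continuousWithinAt)
    have hm' := hm
    simp only [Set.mem_prod, mem_closedBall_zero_iff] at hm'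
    have hcl : closure (ball (0:ℂ) a) = closedBall 0 a := closure_ball _ ha.ne'
    have hdc : DiffContOnCl ℂ (fun z => D n (z, m.2)) (ball 0 a) := by
      refine DifferentiableOn.diffContOnCl ?_
      rw [hcl]
      intro z hz
      rw [mem_closedBall_zero_iff] at hz
      have hpm : DifferentiableAt ℂ (fun z : ℂ => (z, m.2)) z := by fun_prop
      exact (DifferentiableAt.comp (g := D n) (f := fun z : ℂ => (z, m.2)) z (hDd n (z, m.2) hz hm'.2) hpm).differentiableWithinAt
    obtain ⟨z, hz, hzm⟩ := Complex.exists_mem_frontier_isMaxOn_norm isBounded_ball ⟨0, by simpa using ha⟩ hdc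
    rw [frontier_ball _ ha.ne', mem_sphere_zero_iff_norm] at hz
    have hle : ∀ u : ℂ × ℂ, ‖u.1‖ ≤ a → ‖u.2‖ ≤ β → ‖D n u‖ ≤ ‖D n (z, m.2)‖ := by
      intro u h1 h2
      have q1 : ‖D n u‖ ≤ ‖D n m‖ := hmm (a := u) (by simp [h1, h2])
      have q2 : ‖D n m‖ ≤ ‖D n (z, m.2)‖ := hzm (a := m.1) (by rw [hcl]; simpa using hm'.1)
      exact q1.trans q2
    refine ⟨(z, m.2), hz, hm'.2, ?_, hle⟩
    refine lt_of_lt_of_le (norm_pos_iff.2 ?_) (hle u hu1 hu2)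
    exact sub_ne_zero.2 hu3
  choose v hv1 hv2 hv3 hv4 using hmax
  have hcs : IsCompact ((sphere (0:ℂ) a) ×ˢ (closedBall (0:ℂ) β)) := (isCompact_sphere _ _).prod (isCompact_closedBall _ _)
  obtain ⟨v0, hv0, hv0t⟩ := hcs.ultrafilter_le_nhds (U.map v) (by
    rw [le_principal_iff]
    refine (Filter.univ_mem' fun n => ?_ : _ ∈ (U : Filter ℕ))
    simp [hv1 n, hv2 n])
  obtain ⟨d0, hd0, hd0t⟩ := (isCompact_sphere (0 : ℂ × ℂ × ℂ) 1).ultrafilter_le_nhds (U.map fun n => ((‖D n (v n)‖ : ℝ) : ℂ)⁻¹ • D n (v n)) (by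
    rw [le_principal_iff]
    refine (Filter.univ_mem' fun n => ?_ : _ ∈ (U : Filter ℕ))
    simp only [Set.mem_preimage, mem_sphere_zero_iff_norm]
    rw [norm_smul, norm_inv, Complex.norm_real, norm_norm, inv_mul_cancel₀ (hv3 n).ne'])
  obtain ⟨α, hα, hαt⟩ := montel (ball (0:ℂ) a ×ˢ ball (0:ℂ) β) (isOpen_ball.prod isOpen_ball)
    (fun n p => ((‖D n (v n)‖ : ℝ) : ℂ)⁻¹ • D n p) (fun n p hp => by
      simp only [Set.mem_prod, mem_ball_zero_iff] at hp
      have := (hDd n p hp.1.le hp.2.le).const_smul (((‖D n (v n)‖ : ℝ) : ℂ)⁻¹)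
      exact this.differentiableWithinAt) (fun n p hp => by
      simp only [Set.mem_prod, mem_ball_zero_iff] at hp
      rw [norm_smul, norm_inv, Complex.norm_real, norm_norm]
      rw [inv_mul_le_iff₀ (hv3 n), mul_one]
      exact hv4 n p hp.1.le hp.2.le) U
  simp only [Set.mem_prod, mem_sphere_zero_iff_norm, mem_closedBall_zero_iff] at hv0 hd0
  exact ⟨fun n => ‖D n (v n)‖, v, v0, d0, α, hv3, fun n => ⟨hv1 n, hv2 n⟩, hv0.1, hv0.2, hd0, hv0t, hd0t, hα, hαt⟩
end PartOfP

section PartOfQ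
open Complex Filter Topology Metric
open scoped ContDiff

section claimA
variable {φ : ℂ × ℝ → ℝ} {ψ : ℂ × ℂ × ℝ → ℝ} {H : ℂ × ℂ → ℂ × ℂ × ℂ}
    {Φ : ℂ × ℂ × ℂ → ℂ} {Ψ : ℂ × ℂ × ℂ × ℂ × ℂ → ℂ} {U : ℂ × ℂ × ℂ → ℂ}

lemma real_smul_star (c : ℝ) (v : ℂ × ℂ × ℂ) : (c : ℂ)⁻¹ • star v = star ((c : ℂ)⁻¹ • v) := by
  rw [star_smul]
  simp

lemma Setup.lim_infDef (S : Setup φ ψ H Φ Ψ U) {l : Filter ℕ} [l.NeBot] {h : ℕ → ℂ × ℂ → ℂ × ℂ × ℂ}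
    {ε : ℕ → ℝ} {α : ℂ × ℂ → ℂ × ℂ × ℂ} (hαa : AnalyticAt ℂ α 0) (hα0 : α 0 = 0)
    (hM : ∀ᶠ p in 𝓝 (0 : ℂ × ℂ), p ∈ Mset φ → ∀ n, h n p ∈ M'set ψ)
    (hlim : ∀ᶠ p in 𝓝 (0 : ℂ × ℂ), Tendsto (fun n => h n p) l (𝓝 (H p)))
    (hc : ∀ᶠ p in 𝓝 (0 : ℂ × ℂ), Tendsto (fun n => (ε n : ℂ)⁻¹ • (h n p - H p)) l (𝓝 (α p))) :
    IsInfDef φ ψ H α := by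
  refine ⟨hαa, hα0, ?_⟩
  have hHt : Tendsto H (𝓝 0) (𝓝 0) := by
    have := S.hHa.continuousAt.tendsto
    rwa [S.hH0] at this
  have h1 := hHt.eventually (star_cont_zero.eventually (Rc_analytic S.hΨa).eventually_analyticAt)
  have h2 := hHt.eventually (diag_real S.hΨa S.hΨ)
  have h3 := hHt.eventually (Rc_diag S.hΨ).eventually_nhds
  filter_upwards [h1, h2, h3, hM, hlim, hc, S.hHmap] with p h1 h2 h3 hM hlim hc hHp hp
  have hst : Continuous (fun q : ℂ × ℂ × ℂ => (q, star q)) := by fun_prop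
  have hR0 : Rc Ψ (H p, star (H p)) = 0 := by
    rw [h3.self_of_nhds, ← M'set_iff]; exact hHp hp
  have h4 := strict_lim h1.hasStrictFDerivAt (l := l) (x := fun _ => (H p, star (H p)))
    (y := fun n => (h n p, star (h n p))) (c := fun n => (ε n : ℂ)⁻¹) (v := (α p, star (α p))) tendsto_const_nhds
    ((hst.tendsto _).comp hlim) (by
      refine ((hst.tendsto _).comp hc).congr fun n => ?_
      simp only [Function.comp_apply, Prod.mk_sub_mk, Prod.smul_mk]
      rw [← star_sub, real_smul_star]) (by
      filter_upwards [hlim.eventually h3] with n hn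
      rw [hR0, hn, ← M'set_iff]
      exact hM hp n)
  rw [h2] at h4
  have h5 := Complex.ofReal_eq_zero.1 h4
  linarith

lemma Setup.claimA (S : Setup φ ψ H Φ Ψ U) (hcne : fderiv ℂ (fderiv ℂ Φ) 0 (1, 0, 0) (0, 1, 0) ≠ 0)
    {d : ℕ} {X : Fin d → ℂ × ℂ × ℂ → ℂ × ℂ × ℂ} (hXa : ∀ i, AnalyticAt ℂ (X i) 0)
    (hspan : ∀ α, IsInfDef φ ψ H α → ∃ t : Fin d → ℝ, ∀ᶠ p in 𝓝 (0 : ℂ × ℂ), α p = ∑ i, t i • X i (H p))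
    (hinj : ∀ t : Fin d → ℝ, (∀ᶠ p in 𝓝 (0 : ℂ × ℂ), ∑ i, t i • X i (H p) = 0) → t = 0)
    (r0 : ℝ) (hr0 : 0 < r0) :
    ∃ r1 > 0, r1 ≤ r0 ∧ ∃ s : Finset (ℂ × ℂ), (↑s : Set (ℂ × ℂ)) ⊆ ball 0 r1 ∧
      ∃ π : (s → ℂ × ℂ × ℂ) →ₗ[ℝ] (Fin d → ℝ), (∀ t : Fin d → ℝ, π (fun p => ∑ i, t i • X i (H p)) = t) ∧
      ∃ δ > (0:ℝ), ∀ h : ℂ × ℂ → ℂ × ℂ × ℂ, DifferentiableOn ℂ h (ball 0 r1) → h 0 = 0 →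
        (∀ p ∈ Mset φ ∩ ball 0 r1, h p ∈ M'set ψ) → (∀ p ∈ ball (0 : ℂ × ℂ) r1, ‖h p - H p‖ < δ) →
        π (fun p => h p - H p) = 0 → ∀ᶠ p in 𝓝 (0 : ℂ × ℂ), h p = H p := by
  obtain ⟨c1, hc1, hrefl⟩ := S.refl_map
  obtain ⟨cR, hcR, hRan⟩ := Metric.eventually_nhds_iff_ball.1 (Rc_analytic S.hΨa).eventually_analyticAt
  have hHt : Tendsto H (𝓝 0) (𝓝 0) := by
    have := S.hHa.continuousAt.tendsto
    rwa [S.hH0] at this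
  have hHs : ∀ m > (0:ℝ), ∀ᶠ p in 𝓝 (0 : ℂ × ℂ), ‖H p‖ < m := by
    intro m hm
    filter_upwards [hHt.eventually (ball_mem_nhds 0 hm)] with p hp
    simpa using hp
  obtain ⟨r1', hr1', hr1b⟩ := Metric.eventually_nhds_iff_ball.1 (((S.hHa.eventually_analyticAt.and
    (hHs (c1 / 2) (by positivity))).and ((hHs cR hcR).and S.hHmap)).and
      (hHt.eventually (eventually_all.2 fun i => (hXa i).eventually_analyticAt)))
  set r1 := min r0 r1' with hr1def
  have hr1 : 0 < r1 := lt_min hr0 hr1'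
  replace hr1b := fun p (hp : p ∈ ball (0 : ℂ × ℂ) r1) => hr1b p (ball_subset_ball (min_le_right _ _) hp)
  obtain ⟨ε, hε, hrefl⟩ := hrefl r1 hr1
  obtain ⟨ε2, hε2, hN⟩ := S.N
  obtain ⟨e, hgeo⟩ := geo S.hΦa S.hΦ0 S.hΦ1 S.hUa S.hU0 S.hU hcne
  -- choose the scale
  obtain ⟨εT, hεT, hTan⟩ := Metric.eventually_nhds_iff_ball.1 S.Tc_an.eventually_analyticAt
  have hkt : Tendsto (kap e) (𝓝 0) (𝓝 0) := (kap_diff e).continuous.tendsto' _ _ (kap_zero e)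
  obtain ⟨R', hR', hkR⟩ := Metric.eventually_nhds_iff_ball.1 ((hkt.eventually (ball_mem_nhds (0 : ℂ × ℂ) hr1)).and
    ((hkt.eventually hN).and ((hkt.eventually (ball_mem_nhds (0 : ℂ × ℂ) hε)).and (hkt.eventually (ball_mem_nhds (0 : ℂ × ℂ) hεT)))))
  obtain ⟨a, β, ha, haR, hβ, hβR, hgeo⟩ := hgeo (min R' (min ε (min εT ε2))) (lt_min hR' (lt_min hε (lt_min hεT hε2)))
  have haR' : a < R' := haR.trans_le (min_le_left _ _)
  have haε : a < ε := haR.trans_le ((min_le_right _ _).trans (min_le_left _ _))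
  have haεT : a < εT := haR.trans_le ((min_le_right _ _).trans ((min_le_right _ _).trans (min_le_left _ _)))
  have haε2 : a < ε2 := haR.trans_le ((min_le_right _ _).trans ((min_le_right _ _).trans (min_le_right _ _)))
  have hβR' : β < R' := hβR.trans_le (min_le_left _ _)
  replace hkR : ∀ v : ℂ × ℂ, ‖v.1‖ ≤ a → ‖v.2‖ ≤ β → _ := fun v h1 h2 => hkR v (by
    rw [mem_ball_zero_iff, Prod.norm_def]; exact max_lt (h1.trans_lt haR') (h2.trans_lt hβR'))
  have hkr : ∀ v : ℂ × ℂ, ‖v.1‖ ≤ a → ‖v.2‖ ≤ β → kap e v ∈ ball (0 : ℂ × ℂ) r1 := fun v h1 h2 => (hkR v h1 h2).1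
  set D : Set (ℂ × ℂ) := ball (0:ℂ) a ×ˢ ball (0:ℂ) β with hD
  have hDo : IsOpen D := isOpen_ball.prod isOpen_ball
  have h0D : (0 : ℂ × ℂ) ∈ D := by simp [hD, ha, hβ]
  have hDr : ∀ v ∈ D, kap e v ∈ ball (0 : ℂ × ℂ) r1 := by
    intro v hv
    simp only [hD, Set.mem_prod, mem_ball_zero_iff] at hv
    exact hkr v hv.1.le hv.2.le
  have hkit : Tendsto (kapi e) (𝓝 0) (𝓝 0) := (kapi_diff e).continuous.tendsto' _ _ (kapi_zero e)
  have hV : {p | kapi e p ∈ D} ∈ 𝓝 (0 : ℂ × ℂ) := hkit.eventually (hDo.mem_nhds h0D)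
  obtain ⟨s, hsV, π, hπ⟩ := points hinj hV
  refine ⟨r1, hr1, min_le_left _ _, s, fun p hp => ?_, π, hπ, ?_⟩
  · have := hDr _ (hsV hp)
    rwa [kap_kapi] at this
  by_contra hcon
  push Not at hcon
  have hcon' := fun n : ℕ => hcon (min (c1 / 2) (1 / ((n:ℝ) + 1))) (lt_min (by positivity) (by positivity))
  choose h hhd hh0 hhM hhδ hhπ hhne using hcon'
  have hHd : DifferentiableOn ℂ H (ball 0 r1) := fun p hp => (hr1b p hp).1.1.1.differentiableAt.differentiableWithinAt
  have hδ2 : ∀ n, ∀ p ∈ ball (0 : ℂ × ℂ) r1, ‖h n p - H p‖ ≤ 1 / ((n:ℝ) + 1) := fun n p hp =>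
    (hhδ n p hp).le.trans (min_le_right _ _)
  have hhc1 : ∀ n, ∀ p ∈ ball (0 : ℂ × ℂ) r1, ‖h n p‖ < c1 := by
    intro n p hp
    have q1 := (hhδ n p hp).trans_le (min_le_left _ _)
    have q2 := (hr1b p hp).1.1.2
    calc ‖h n p‖ = ‖(h n p - H p) + H p‖ := by rw [sub_add_cancel]
      _ ≤ ‖h n p - H p‖ + ‖H p‖ := norm_add_le _ _
      _ < c1 := by linarith
  have hne : ∀ n, ∃ v : ℂ × ℂ, ‖v.1‖ ≤ a ∧ ‖v.2‖ ≤ β ∧ h n (kap e v) ≠ H (kap e v) := by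
    intro n
    by_contra hall
    push Not at hall
    refine hhne n ?_
    filter_upwards [hV] with p hp
    have hp' := hp
    simp only [hD, Set.mem_prod, mem_ball_zero_iff] at hp'
    have := hall (kapi e p) hp'.1.le hp'.2.le
    rw [kap_kapi] at this
    exact not_not.2 this
  let 𝒰 : Ultrafilter ℕ := Filter.hyperfilter ℕ
  have h𝒰 : (𝒰 : Filter ℕ) ≤ atTop := by
    rw [← Nat.cofinite_eq_atTop]; exact Filter.hyperfilter_le_cofinite
  obtain ⟨η, v, v0, d0, α, hη, hv, hv01, hv02, hd0, hvt, hdt, hα, hαt⟩ := extract e a β r1 ha hkr h H hhd hHd hne 𝒰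
  have hδt : Tendsto (fun n : ℕ => 1 / ((n:ℝ) + 1)) 𝒰 (𝓝 0) := tendsto_one_div_add_atTop_nhds_zero_nat.mono_left h𝒰
  -- uniform convergence at moving points
  have hmove : ∀ (p : ℕ → ℂ × ℂ) (p0 : ℂ × ℂ), p0 ∈ ball (0 : ℂ × ℂ) r1 → Tendsto p 𝒰 (𝓝 p0) →
      Tendsto (fun n => H (p n)) 𝒰 (𝓝 (H p0)) ∧ Tendsto (fun n => h n (p n)) 𝒰 (𝓝 (H p0)) := by
    intro p p0 hp0 hp
    have q1 : Tendsto (fun n => H (p n)) 𝒰 (𝓝 (H p0)) := ((hr1b p0 hp0).1.1.1.continuousAt.tendsto).comp hp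
    refine ⟨q1, ?_⟩
    have q2 : Tendsto (fun n => h n (p n) - H (p n)) 𝒰 (𝓝 0) := by
      refine squeeze_zero_norm' ?_ hδt
      filter_upwards [hp.eventually (isOpen_ball.mem_nhds hp0)] with n hn using hδ2 n _ hn
    have := q2.add q1
    simpa using this
  have hαt' : ∀ (p : ℕ → ℂ × ℂ) (p0 : ℂ × ℂ), kapi e p0 ∈ D → Tendsto p 𝒰 (𝓝 p0) →
      Tendsto (fun n => (η n : ℂ)⁻¹ • (h n (p n) - H (p n))) 𝒰 (𝓝 (α (kapi e p0))) := by
    intro p p0 hp0 hp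
    have q1 : Tendsto (fun n => kapi e (p n)) 𝒰 (𝓝 (kapi e p0)) := ((kapi_diff e).continuous.tendsto _).comp hp
    have q2 := (hαt _ hp0).comp (tendsto_id.prodMk q1)
    refine q2.congr fun n => ?_
    simp only [Function.comp_apply, id_eq, kap_kapi]
  have hinf : IsInfDef φ ψ H (fun p => α (kapi e p)) := by
    refine S.lim_infDef (l := 𝒰) (h := h) (ε := η) ?_ ?_ ?_ ?_ ?_
    · refine AnalyticAt.comp (g := α) (f := kapi e) ?_ (kapi_diff e).contDiffAt.analyticAt
      rw [kapi_zero]; exact hα 0 h0D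
    · have q1 := hαt' (fun _ => 0) 0 (by rw [kapi_zero]; exact h0D) tendsto_const_nhds
      simp only [hh0, S.hH0, sub_zero, smul_zero] at q1
      exact (tendsto_nhds_unique q1 tendsto_const_nhds)
    · filter_upwards [ball_mem_nhds (0 : ℂ × ℂ) hr1] with p hp hpM n
      exact hhM n p ⟨hpM, hp⟩
    · filter_upwards [ball_mem_nhds (0 : ℂ × ℂ) hr1] with p hp
      exact (hmove (fun _ => p) p hp tendsto_const_nhds).2
    · filter_upwards [hV] with p hp
      exact hαt' (fun _ => p) p hp tendsto_const_nhds
  obtain ⟨t, ht⟩ := hspan _ hinf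
  have hαeq : Set.EqOn α (fun v => ∑ i, t i • X i (H (kap e v))) D := by
    refine hα.eqOn_of_preconnected_of_eventuallyEq (z₀ := 0) ?_ ?_ h0D ?_
    · intro v hv
      have hp := hr1b _ (hDr v hv)
      refine Finset.analyticAt_fun_sum _ fun i _ => ?_
      have q1 : AnalyticAt ℂ (fun v => H (kap e v)) v :=
        AnalyticAt.comp (g := H) (f := kap e) hp.1.1.1 (kap_diff e).contDiffAt.analyticAt
      have q2 : AnalyticAt ℂ (fun v => X i (H (kap e v))) v :=
        AnalyticAt.comp (g := X i) (f := fun v => H (kap e v)) (hp.2 i) q1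
      have q3 := (analyticAt_const (v := (t i : ℂ)) (𝕜 := ℂ) (x := v)).smul q2
      refine q3.congr (Eventually.of_forall fun u => ?_)
      simp only [Pi.smul_apply', Complex.coe_smul]
    · exact ((convex_ball (0:ℂ) a).prod (convex_ball (0:ℂ) β)).isPreconnected
    · filter_upwards [hkt.eventually ht] with u hu
      rwa [kapi_kap] at hu
  have ht0 : t = 0 := by
    rw [← hπ t]
    have q1 : Tendsto (fun n => (fun p : s => (η n : ℂ)⁻¹ • (h n p - H p))) 𝒰 (𝓝 (fun p : s => ∑ i, t i • X i (H p))) := by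
      rw [tendsto_pi_nhds]
      intro p
      have q2 := hαt' (fun _ => p) p (hsV p.2) tendsto_const_nhds
      rw [hαeq (hsV p.2)] at q2
      simp only [kap_kapi] at q2
      exact q2
    have q3 : Continuous π := π.continuous_of_finiteDimensional
    have q4 := (q3.tendsto _).comp q1
    have q5 : ∀ n, π (fun p : s => (η n : ℂ)⁻¹ • (h n p - H p)) = 0 := by
      intro n
      have : (fun p : s => (η n : ℂ)⁻¹ • (h n p - H p)) = (η n)⁻¹ • (fun p : s => (h n p - H p)) := by
        funext p
        rw [Pi.smul_apply, ← Complex.coe_smul, Complex.ofReal_inv]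
      rw [this, map_smul, hhπ, smul_zero]
    refine tendsto_nhds_unique q4 ?_
    simp only [Function.comp_def, q5]
    exact tendsto_const_nhds
  have hα0 : ∀ u ∈ D, α u = 0 := by
    intro u hu
    rw [hαeq hu, ht0]; simp
  -- contradiction at the limit point
  obtain ⟨χ, hχ, hχ2⟩ := hgeo v0.1 v0.2 hv01 hv02
  set p0 := kap e v0 with hp0
  obtain ⟨k1, k2, k3, k4⟩ := hkR v0 hv01.le hv02
  have hp01 : p0.1 = v0.1 := rfl
  have hd0ne : d0 ≠ 0 := by
    rw [← norm_pos_iff, hd0]; exact one_pos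
  have hfr := k2 χ (by rw [mem_ball_zero_iff]; linarith) d0 hd0ne
  have hxball : ∀ s : ℂ, ‖s‖ < a → ∀ m : ℝ, a < m → p0 ∈ ball (0 : ℂ × ℂ) m → (p0.1, s, p0.2) ∈ ball (0 : ℂ × ℂ × ℂ) m := by
    intro s hs m hm hp
    rw [mem_ball_zero_iff, Prod.norm_def, max_lt_iff] at hp
    rw [mem_ball_zero_iff, Prod.norm_def, max_lt_iff]
    refine ⟨hp.1, ?_⟩
    rw [Prod.norm_def]
    exact max_lt (hs.trans hm) hp.2
  have hTc : ∀ s : ℂ, ‖s‖ < a → ContinuousAt (Tc Φ U) (p0.1, s, p0.2) := fun s hs =>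
    (hTan _ (hxball s hs εT haεT k4)).continuousAt
  have hev : ∀ᶠ s in 𝓝 χ, ‖s‖ < a / 2 ∧ ‖star (Tc Φ U (p0.1, s, p0.2)) - 2 * I * e * (star s) ^ 2‖ < β / 2 := by
    refine Filter.Eventually.and ?_ ?_
    · exact continuousAt_id.norm.eventually_lt_const hχ
    · have q1 : ContinuousAt (fun s => ‖star (Tc Φ U (p0.1, s, p0.2)) - 2 * I * e * (star s) ^ 2‖) χ := by
        have q2 : ContinuousAt (fun s => Tc Φ U (p0.1, s, p0.2)) χ :=
          ContinuousAt.comp (g := Tc Φ U) (f := fun s : ℂ => (p0.1, s, p0.2)) (hTc χ (by linarith)) (by fun_prop)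
        fun_prop
      exact q1.eventually_lt_const hχ2
  obtain ⟨s1, hs1, hs2, hs3⟩ := (hfr.and_eventually hev).exists
  have hs1a : ‖s1‖ < a := by linarith
  set τ0 := Tc Φ U (p0.1, s1, p0.2) with hτ0
  have hpt : Tendsto (fun n => kap e (v n)) 𝒰 (𝓝 p0) := ((kap_diff e).continuous.tendsto _).comp hvt
  have hxt : Tendsto (fun n => ((kap e (v n)).1, s1, (kap e (v n)).2)) 𝒰 (𝓝 (p0.1, s1, p0.2)) := by
    have q : Continuous (fun p : ℂ × ℂ => (p.1, s1, p.2)) := by fun_prop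
    exact (q.tendsto p0).comp hpt
  have hτt : Tendsto (fun n => Tc Φ U ((kap e (v n)).1, s1, (kap e (v n)).2)) 𝒰 (𝓝 τ0) := (hTc s1 hs1a).tendsto.comp hxt
  have hqt : Tendsto (fun n => star ((s1, Tc Φ U ((kap e (v n)).1, s1, (kap e (v n)).2)) : ℂ × ℂ)) 𝒰 (𝓝 (star (s1, τ0))) := by
    have q : Continuous (fun τ : ℂ => star ((s1, τ) : ℂ × ℂ)) := by fun_prop
    exact (q.tendsto τ0).comp hτt
  have hq0D : kapi e (star (s1, τ0)) ∈ D := by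
    simp only [hD, kapi, Set.mem_prod, mem_ball_zero_iff, Prod.fst_star, Prod.snd_star, norm_star]
    exact ⟨hs1a, by linarith⟩
  have hq0r : star ((s1, τ0) : ℂ × ℂ) ∈ ball (0 : ℂ × ℂ) r1 := by
    have := hDr _ hq0D
    rwa [kap_kapi] at this
  have m1 := hmove _ _ k1 hpt
  have m2 := hmove _ _ hq0r hqt
  have m3 := hαt' _ _ hq0D hqt
  rw [hα0 _ hq0D] at m3
  have hst : Continuous (fun q : ℂ × ℂ × ℂ => star q) := by fun_prop
  have hRa : AnalyticAt ℂ (Rc Ψ) (H p0, star (H (star (s1, τ0)))) := by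
    refine hRan _ ?_
    rw [mem_ball_zero_iff, Prod.norm_def, max_lt_iff]
    refine ⟨(hr1b _ k1).1.2.1, ?_⟩
    rw [norm_star]
    exact (hr1b _ hq0r).1.2.1
  have hxε : ∀ᶠ n in (𝒰 : Filter ℕ), ((kap e (v n)).1, s1, (kap e (v n)).2) ∈ ball (0 : ℂ × ℂ × ℂ) ε :=
    hxt.eventually (isOpen_ball.mem_nhds (hxball s1 hs1a ε haε k3))
  have T1 : Tendsto (fun n => (H (kap e (v n)), star (H (star ((s1, Tc Φ U ((kap e (v n)).1, s1, (kap e (v n)).2)) : ℂ × ℂ)))))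
      (𝒰 : Filter ℕ) (𝓝 (H p0, star (H (star (s1, τ0))))) := m1.1.prodMk_nhds ((hst.tendsto _).comp m2.1)
  have T2 : Tendsto (fun n => (h n (kap e (v n)), star (h n (star ((s1, Tc Φ U ((kap e (v n)).1, s1, (kap e (v n)).2)) : ℂ × ℂ)))))
      (𝒰 : Filter ℕ) (𝓝 (H p0, star (H (star (s1, τ0))))) := m1.2.prodMk_nhds ((hst.tendsto _).comp m2.2)
  have hfin := strict_lim hRa.hasStrictFDerivAt (l := (𝒰 : Filter ℕ))
    (c := fun n => (η n : ℂ)⁻¹) (v := (d0, 0)) T1 T2 (by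
      have m4 := (hst.tendsto _).comp m3
      rw [star_zero] at m4
      refine (hdt.prodMk_nhds m4).congr fun n => ?_
      simp only [Function.comp_apply, Prod.mk_sub_mk, Prod.smul_mk]
      rw [← star_sub, real_smul_star]) (by
      filter_upwards [hxε] with n hn
      have g1 := hrefl (h n) (hhd n) (hhM n) (hhc1 n) _ hn
      have g2 := hrefl H hHd (fun p hp => (hr1b p hp.2).1.2.2 hp.1) (fun p hp => by
        have := (hr1b p hp).1.1.2
        linarith) _ hn
      exact g1.trans g2.symm)
  exact hs1 hfin
end claimA
end PartOfQ

section PartOfR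
open Complex Filter Topology Metric
open scoped ContDiff

section claimB

lemma solve {d : ℕ} {X : Fin d → ℂ × ℂ × ℂ → ℂ × ℂ × ℂ} {H : ℂ × ℂ → ℂ × ℂ × ℂ} {s : Finset (ℂ × ℂ)}
    {π : (s → ℂ × ℂ × ℂ) →ₗ[ℝ] (Fin d → ℝ)}
    (hπ : ∀ t : Fin d → ℝ, π (fun p => ∑ i, t i • X i (H p)) = t)
    {σ : (Fin d → ℂ) × (ℂ × ℂ × ℂ) → ℂ × ℂ × ℂ} (hσ : ∀ p ∈ s, AnalyticAt ℂ σ (0, H p))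
    (hσ0 : ∀ p ∈ s, σ (0, H p) = H p) (hσd : ∀ p ∈ s, ∀ t, fderiv ℂ σ (0, H p) (t, 0) = XX X t (H p))
    {η : ℝ} (hη : 0 < η) :
    ∃ δ > 0, ∀ x : s → ℂ × ℂ × ℂ, (∀ p : s, ‖x p - H p‖ < δ) →
      ∃ t : Fin d → ℝ, ‖t‖ < η ∧ π (fun p => σ (-(fun i => (t i : ℂ)), x p) - H p) = 0 := by
  let A : s → ((s → ℂ × ℂ × ℂ) × (Fin d → ℝ)) →L[ℝ] (Fin d → ℂ) × (ℂ × ℂ × ℂ) := fun p =>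
    (-(ContinuousLinearMap.pi fun i => ofRealCLM ∘L (ContinuousLinearMap.proj (R := ℝ) (φ := fun _ : Fin d => ℝ) i)
      ∘L (ContinuousLinearMap.snd ℝ (s → ℂ × ℂ × ℂ) (Fin d → ℝ)))).prod
    ((ContinuousLinearMap.proj (R := ℝ) (φ := fun _ : s => ℂ × ℂ × ℂ) p)
      ∘L (ContinuousLinearMap.fst ℝ (s → ℂ × ℂ × ℂ) (Fin d → ℝ)))
  have hA : ∀ p y, A p y = (-(fun i => (y.2 i : ℂ)), y.1 p) := fun p y => rfl
  let πc : (s → ℂ × ℂ × ℂ) →L[ℝ] (Fin d → ℝ) := ⟨π, π.continuous_of_finiteDimensional⟩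
  let u : (s → ℂ × ℂ × ℂ) × (Fin d → ℝ) := (fun p => H p, 0)
  have hAu : ∀ p, A p u = (0, H p) := by
    intro p
    rw [hA]
    simp only [u, Pi.zero_apply, ofReal_zero, Prod.mk.injEq, and_true]
    funext i
    simp
  let f : (s → ℂ × ℂ × ℂ) × (Fin d → ℝ) → Fin d → ℝ := fun y => πc (fun p => σ (A p y) - H p)
  have hin : ∀ p : s, AnalyticAt ℝ (fun y => σ (A p y) - H p) u := by
    intro p
    have h1 : AnalyticAt ℝ σ (A p u) := by
      rw [hAu]
      exact (hσ p p.2).restrictScalars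
    exact (AnalyticAt.comp (g := σ) (f := fun y => A p y) h1 ((A p).analyticAt u)).sub analyticAt_const
  have hin2 : AnalyticAt ℝ (fun y (p : s) => σ (A p y) - H p) u := analyticAt_pi_iff.2 hin
  have hf : AnalyticAt ℝ f u :=
    AnalyticAt.comp (g := πc) (f := fun y (p : s) => σ (A p y) - H p) (πc.analyticAt _) hin2
  have hf0 : f u = 0 := by
    simp only [f, hAu]
    convert map_zero πc using 2
    funext p
    simp [hσ0 p p.2]
  have hfd : HasFDerivAt f (πc ∘L ContinuousLinearMap.pi fun p : s =>
      ((fderiv ℂ σ (0, H p)).restrictScalars ℝ) ∘L A p) u := by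
    refine πc.hasFDerivAt.comp u (hasFDerivAt_pi.2 fun p => ?_)
    have h1 : HasFDerivAt σ ((fderiv ℂ σ (0, H p)).restrictScalars ℝ) (A p u) := by
      rw [hAu]
      exact (hσ p p.2).differentiableAt.hasFDerivAt.restrictScalars ℝ
    exact (h1.comp u (A p).hasFDerivAt).sub_const _
  have hinv : (fderiv ℝ f u ∘L .inr ℝ (s → ℂ × ℂ × ℂ) (Fin d → ℝ)) = -(ContinuousLinearMap.id ℝ (Fin d → ℝ)) := by
    rw [hfd.fderiv]
    refine ContinuousLinearMap.ext fun t => ?_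
    have h2 : (fun p : s => fderiv ℂ σ (0, H p) (A p (0, t))) = -(fun p : s => ∑ i, t i • X i (H p)) := by
      funext p
      rw [hA]
      have : ((-(fun i => (t i : ℂ)), (0 : s → ℂ × ℂ × ℂ) p) : (Fin d → ℂ) × (ℂ × ℂ × ℂ)) = -((fun i => (t i : ℂ)), 0) := by
        simp
      rw [this, map_neg, hσd p p.2]
      simp [XX]
    have h3 : πc (fun p : s => fderiv ℂ σ (0, H p) (A p (0, t))) = -t := by
      rw [h2, map_neg]
      exact congrArg _ (hπ t)
    exact h3
  obtain ⟨g, hga, hg0, -, hg⟩ := analytic_ift hf hf0 (by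
    rw [hinv]
    exact ⟨ContinuousLinearEquiv.neg ℝ, by ext; simp⟩)
  have hgs : ∀ᶠ x in 𝓝 u.1, ‖g x‖ < η := by
    have h1 := hga.continuousAt.norm
    refine h1.eventually_lt continuousAt_const ?_
    rw [hg0]
    simpa [u] using hη
  obtain ⟨δ, hδ, hb⟩ := Metric.eventually_nhds_iff_ball.1 (hg.and hgs)
  refine ⟨δ, hδ, fun x hx => ?_⟩
  have hx' : x ∈ ball u.1 δ := by
    rw [mem_ball, dist_pi_lt_iff hδ]
    intro p
    rw [dist_eq_norm]
    exact hx p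
  exact ⟨g x, (hb x hx').2, (hb x hx').1⟩

variable {φ : ℂ × ℝ → ℝ} {ψ : ℂ × ℂ × ℝ → ℝ} {H : ℂ × ℂ → ℂ × ℂ × ℂ}
    {Φ : ℂ × ℂ × ℂ → ℂ} {Ψ : ℂ × ℂ × ℂ × ℂ × ℂ → ℂ} {U : ℂ × ℂ × ℂ → ℂ}

lemma Setup.final (S : Setup φ ψ H Φ Ψ U) (hcne : fderiv ℂ (fderiv ℂ Φ) 0 (1, 0, 0) (0, 1, 0) ≠ 0)
    (hψc : ContinuousAt ψ 0) (hψ0 : ψ 0 = 0)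
    {d : ℕ} {X : Fin d → ℂ × ℂ × ℂ → ℂ × ℂ × ℂ} (hXa : ∀ i, AnalyticAt ℂ (X i) 0) (hX0 : ∀ i, X i 0 = 0)
    (htan : ∀ i, ∀ᶠ q in 𝓝 (0 : ℂ × ℂ × ℂ), q ∈ M'set ψ → pairR (gradRho' ψ q) (X i q) = 0)
    (hspan : ∀ α, IsInfDef φ ψ H α → ∃ t : Fin d → ℝ, ∀ᶠ p in 𝓝 (0 : ℂ × ℂ), α p = ∑ i, t i • X i (H p))
    (hinj : ∀ t : Fin d → ℝ, (∀ᶠ p in 𝓝 (0 : ℂ × ℂ), ∑ i, t i • X i (H p) = 0) → t = 0) :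
    ∃ r > (0 : ℝ), ∃ δ > (0 : ℝ), ∀ Hhat : ℂ × ℂ → ℂ × ℂ × ℂ,
      AnalyticOnNhd ℂ Hhat (ball (0 : ℂ × ℂ) r) → Hhat 0 = 0 →
      (∀ p ∈ Mset φ ∩ ball (0 : ℂ × ℂ) r, Hhat p ∈ M'set ψ) →
      (∀ p ∈ ball (0 : ℂ × ℂ) r, ‖Hhat p - H p‖ < δ) →
      ∃ σ' : ℂ × ℂ × ℂ → ℂ × ℂ × ℂ,
        IsBiholGerm σ' ∧ (∀ᶠ q in 𝓝 (0 : ℂ × ℂ × ℂ), q ∈ M'set ψ → σ' q ∈ M'set ψ)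
        ∧ ∀ᶠ p in 𝓝 (0 : ℂ × ℂ), Hhat p = σ' (H p) := by
  obtain ⟨σ, hσa, hσ0, hσz, hσi, hσd, hf⟩ := flow_pkg hXa hX0
  have hfi := flow_inv S.hΨa S.hΨ hψc hψ0 hXa htan hf
  obtain ⟨K, W, hW, hK⟩ := ((hσa.contDiffAt (n := 1)).restrict_scalars ℝ).exists_lipschitzOnWith
  obtain ⟨ρ1, hρ1, hb1⟩ := Metric.eventually_nhds_iff_ball.1 ((hσa.eventually_analyticAt.and hσi).and hW)
  obtain ⟨ρ2, hρ2, hb2⟩ := Metric.eventually_nhds_iff_ball.1 (hσ0.and hσd)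
  obtain ⟨ρ3, hρ3, hb3⟩ := Metric.eventually_nhds_iff_ball.1 hσz
  obtain ⟨ρ4, hρ4, hb4⟩ := Metric.eventually_nhds_iff_ball.1 hfi
  obtain ⟨ρ, hρ, hle1, hle2, hle3, hle4⟩ : ∃ ρ > 0, ρ ≤ ρ1 ∧ ρ ≤ ρ2 ∧ ρ ≤ ρ3 ∧ ρ ≤ ρ4 :=
    ⟨min (min ρ1 ρ2) (min ρ3 ρ4), by positivity, (min_le_left _ _).trans (min_le_left _ _),
      (min_le_left _ _).trans (min_le_right _ _), (min_le_right _ _).trans (min_le_left _ _),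
      (min_le_right _ _).trans (min_le_right _ _)⟩
  have B1 : ∀ (t : Fin d → ℂ) (q : ℂ × ℂ × ℂ), ‖t‖ < ρ → ‖q‖ < ρ →
      (AnalyticAt ℂ σ (t, q) ∧ σ (-t, σ (t, q)) = q) ∧ (t, q) ∈ W := fun t q ht hq => hb1 (t, q) (by
    rw [mem_ball_zero_iff, Prod.norm_def, max_lt_iff]
    exact ⟨ht.trans_le hle1, hq.trans_le hle1⟩)
  have B2 : ∀ q : ℂ × ℂ × ℂ, ‖q‖ < ρ → σ (0, q) = q ∧ ∀ t, fderiv ℂ σ (0, q) (t, 0) = XX X t q :=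
    fun q hq => hb2 q (by rw [mem_ball_zero_iff]; exact hq.trans_le hle2)
  have B3 : ∀ t : Fin d → ℂ, ‖t‖ < ρ → σ (t, 0) = 0 :=
    fun q hq => hb3 q (by rw [mem_ball_zero_iff]; exact hq.trans_le hle3)
  have B4 : ∀ (t : Fin d → ℝ) (q : ℂ × ℂ × ℂ), ‖t‖ < ρ → ‖q‖ < ρ → q ∈ M'set ψ →
      σ ((fun i => (t i : ℂ)), q) ∈ M'set ψ := fun t q ht hq => hb4 (t, q) (by
    rw [mem_ball_zero_iff, Prod.norm_def, max_lt_iff]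
    exact ⟨ht.trans_le hle4, hq.trans_le hle4⟩)
  have hHt : Tendsto H (𝓝 0) (𝓝 0) := by
    have := S.hHa.continuousAt.tendsto
    rwa [S.hH0] at this
  obtain ⟨r0, hr0, hHr⟩ := Metric.eventually_nhds_iff_ball.1 (hHt.eventually (ball_mem_nhds 0 (half_pos hρ)))
  obtain ⟨r1, hr1, hr10, s, hs, π, hπ, δA, hδA, hA⟩ := S.claimA hcne hXa hspan hinj r0 hr0
  have hHr1 : ∀ p ∈ ball (0 : ℂ × ℂ) r1, ‖H p‖ < ρ / 2 := fun p hp => by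
    simpa using hHr p (ball_subset_ball hr10 hp)
  let m : ℝ := min (ρ / 2) (δA / (K + 1))
  have hm : 0 < m := lt_min (half_pos hρ) (by positivity)
  have hmρ : m ≤ ρ / 2 := min_le_left _ _
  have hmK : K * m < δA := by
    have h1 : m ≤ δA / (K + 1) := min_le_right _ _
    have h2 : (K : ℝ) + 1 > 0 := by positivity
    rw [le_div_iff₀ h2] at h1
    nlinarith
  have hz : ‖(0 : Fin d → ℂ)‖ < ρ := by simpa using hρ
  obtain ⟨δ1, hδ1, hsolve⟩ := solve hπ (σ := σ) (fun p hp => (B1 0 (H p) hz (by linarith [hHr1 p (hs hp)])).1.1)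
    (fun p hp => (B2 (H p) (by linarith [hHr1 p (hs hp)])).1) (fun p hp => (B2 (H p) (by linarith [hHr1 p (hs hp)])).2) hm
  refine ⟨r1, hr1, min m δ1, lt_min hm hδ1, fun Hh hHa hH0 hHM hHδ => ?_⟩
  obtain ⟨t, ht, hπ0⟩ := hsolve (fun p => Hh p) (fun p => (hHδ p (hs p.2)).trans_le (min_le_right _ _))
  have hδm : ∀ p ∈ ball (0 : ℂ × ℂ) r1, ‖Hh p - H p‖ < m := fun p hp => (hHδ p hp).trans_le (min_le_left _ _)
  have hHρ : ∀ p ∈ ball (0 : ℂ × ℂ) r1, ‖Hh p‖ < ρ := by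
    intro p hp
    have q1 := hδm p hp
    have q2 := hHr1 p hp
    calc ‖Hh p‖ = ‖(Hh p - H p) + H p‖ := by rw [sub_add_cancel]
      _ ≤ ‖Hh p - H p‖ + ‖H p‖ := norm_add_le _ _
      _ < ρ := by linarith
  let tc : Fin d → ℂ := fun i => (t i : ℂ)
  have htc : ‖tc‖ < m := by
    rw [pi_norm_lt_iff hm] at ht ⊢
    intro i
    simpa [tc] using ht i
  have htcρ : ‖tc‖ < ρ := by linarith
  have htcn : ‖-tc‖ < ρ := by rwa [norm_neg]
  have hneg : -tc = fun i => (((-t) i : ℝ) : ℂ) := by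
    funext i
    simp [tc]
  have htn : ‖-t‖ < ρ := by rw [norm_neg]; linarith
  have key := hA (fun p => σ (-tc, Hh p)) (by
      intro p hp
      have h1 := (B1 (-tc) (Hh p) htcn (hHρ p hp)).1.1.differentiableAt
      have h2 := (hHa p hp).differentiableAt
      exact (h1.comp p (f := fun p => (-tc, Hh p)) ((differentiableAt_const _).prodMk h2)).differentiableWithinAt)
    (by simp only [hH0]; exact B3 _ htcn)
    (by
      intro p hp
      simp only [hneg]
      exact B4 (-t) (Hh p) htn (hHρ p hp.2) (hHM p hp))
    (by
      intro p hp
      have h0 : ‖H p‖ < ρ := by linarith [hHr1 p hp]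
      have h1 := hK.dist_le_mul _ (B1 (-tc) (Hh p) htcn (hHρ p hp)).2 _ (B1 0 (H p) hz h0).2
      have h2 : ((-tc, Hh p) : (Fin d → ℂ) × (ℂ × ℂ × ℂ)) - (0, H p) = (-tc, Hh p - H p) := by simp
      rw [(B2 _ h0).1, dist_eq_norm, dist_eq_norm, h2, Prod.norm_def (-tc, Hh p - H p), norm_neg] at h1
      refine h1.trans_lt (lt_of_le_of_lt ?_ hmK)
      exact mul_le_mul_of_nonneg_left (max_le htc.le (hδm p hp).le) K.2)
    hπ0
  have hsm : ∀ᶠ q in 𝓝 (0 : ℂ × ℂ × ℂ), ‖q‖ < ρ := by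
    filter_upwards [ball_mem_nhds (0 : ℂ × ℂ × ℂ) hρ] with q hq
    simpa using hq
  have hana : ∀ t' : Fin d → ℂ, ‖t'‖ < ρ → AnalyticAt ℂ (fun q => σ (t', q)) 0 := by
    intro t' ht'
    have h1 := (B1 t' 0 ht' (by simpa using hρ)).1.1
    exact AnalyticAt.comp (g := σ) (f := fun q : ℂ × ℂ × ℂ => (t', q)) h1 (ContDiffAt.analyticAt (by fun_prop))
  refine ⟨fun q => σ (tc, q), ⟨hana tc htcρ, B3 _ htcρ, fun q => σ (-tc, q), hana _ htcn, B3 _ htcn, ?_, ?_⟩, ?_, ?_⟩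
  · filter_upwards [hsm] with q hq
    exact (B1 tc q htcρ hq).1.2
  · filter_upwards [hsm] with q hq
    have := (B1 (-tc) q htcn hq).1.2
    rwa [neg_neg] at this
  · filter_upwards [hsm] with q hq
    exact B4 t q (by linarith) hq
  · filter_upwards [key, ball_mem_nhds (0 : ℂ × ℂ) hr1] with p hp hpr
    have := (B1 (-tc) (Hh p) htcn (hHρ p hpr)).1.2
    rw [neg_neg, hp] at this
    exact this.symm
end claimB
end PartOfR

/-- a `2`-nondegenerate transversal embedding of a strictly pseudoconvex
`M ⊂ ℂ²` into a Levi-nondegenerate `M' ⊂ ℂ³` with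
`dim 𝔥𝔬𝔩₀(H) = dim 𝔥𝔬𝔩₀(M') < ∞` is locally rigid. -/
theorem stmt_1 (φ : ℂ × ℝ → ℝ) (hφa : AnalyticAt ℝ φ 0) (hφ0 : φ 0 = 0)
    (hφ1 : fderiv ℝ φ 0 = 0)
    (hφspc : ∃ cℓ : ℝ, 0 < cℓ
      ∧ wzPhi (fun p => wzBarPhi (fun q => ((φ q : ℝ) : ℂ)) p) 0 = (cℓ : ℂ))
    (ψ : ℂ × ℂ × ℝ → ℝ) (hψa : AnalyticAt ℝ ψ 0) (hψ0 : ψ 0 = 0)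
    (hψ1 : fderiv ℝ ψ 0 = 0)
    (hψlevi : (leviPsi ψ).det ≠ 0)
    (H : ℂ × ℂ → ℂ × ℂ × ℂ) (hHa : AnalyticAt ℂ H 0) (hH0 : H 0 = 0)
    (hHinj : Function.Injective (fderiv ℂ H 0))
    (hHmap : ∀ᶠ p in 𝓝 (0 : ℂ × ℂ), p ∈ Mset φ → H p ∈ M'set ψ)
    (hHtr : TransversalAt H) (hHnd : TwoNondegAt φ ψ H)
    (hdim : ∃ (S1 : Submodule ℝ (Filter.Germ (𝓝 (0 : ℂ × ℂ)) (ℂ × ℂ × ℂ)))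
        (S2 : Submodule ℝ (Filter.Germ (𝓝 (0 : ℂ × ℂ × ℂ)) (ℂ × ℂ × ℂ))),
      (S1 : Set (Filter.Germ (𝓝 (0 : ℂ × ℂ)) (ℂ × ℂ × ℂ))) = infDefGermSet φ ψ H
      ∧ (S2 : Set (Filter.Germ (𝓝 (0 : ℂ × ℂ × ℂ)) (ℂ × ℂ × ℂ))) = holGermSet ψ
      ∧ FiniteDimensional ℝ S1 ∧ FiniteDimensional ℝ S2
      ∧ Module.finrank ℝ S1 = Module.finrank ℝ S2) :
    ∃ r > (0 : ℝ), ∃ δ > (0 : ℝ), ∀ Hhat : ℂ × ℂ → ℂ × ℂ × ℂ,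
      AnalyticOnNhd ℂ Hhat (ball (0 : ℂ × ℂ) r) → Hhat 0 = 0 →
      (∀ p ∈ Mset φ ∩ ball (0 : ℂ × ℂ) r, Hhat p ∈ M'set ψ) →
      TransversalAt Hhat → TwoNondegAt φ ψ Hhat →
      (∀ p ∈ ball (0 : ℂ × ℂ) r, ‖Hhat p - H p‖ < δ) →
      ∃ σ : ℂ × ℂ → ℂ × ℂ, ∃ σ' : ℂ × ℂ × ℂ → ℂ × ℂ × ℂ,
        IsBiholGerm σ ∧ (∀ᶠ p in 𝓝 (0 : ℂ × ℂ), p ∈ Mset φ → σ p ∈ Mset φ)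
        ∧ IsBiholGerm σ' ∧ (∀ᶠ q in 𝓝 (0 : ℂ × ℂ × ℂ), q ∈ M'set ψ → σ' q ∈ M'set ψ)
        ∧ ∀ᶠ p in 𝓝 (0 : ℂ × ℂ), Hhat (σ p) = σ' (H p) := by
  obtain ⟨Φ, hΦa, hΦ⟩ := complexify_phi φ hφa
  obtain ⟨Ψ, hΨa, hΨ⟩ := complexify_psi ψ hψa
  have hΦ0 := Phi_zero hΦ hφ0
  have hΦ1 := Phi_fderiv hΦa hΦ hφa hφ1
  obtain ⟨U, hUa, hU0, hU⟩ := exists_U hΦa hΦ0 hΦ1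
  have S : Setup φ ψ H Φ Ψ U := ⟨hΦa, hΦ0, hΦ1, hΦ, hUa, hU0, hU, hΨa, Psi_zero hΨ hψ0,
    Psi_fderiv hΨa hΨ hψa hψ1, hΨ, hHa, hH0, hHmap, hHtr, hHnd⟩
  have hcne : fderiv ℂ (fderiv ℂ Φ) 0 (1, 0, 0) (0, 1, 0) ≠ 0 := by
    obtain ⟨c, hc, hce⟩ := hφspc
    rw [← levi_eq hΦa hΦ, hce]
    exact_mod_cast hc.ne'
  obtain ⟨d, X, hXa, hX0, htan, hspan, hinj⟩ := S.basis hdim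
  obtain ⟨r, hr, δ, hδ, hfin⟩ := S.final hcne hψa.continuousAt hψ0 hXa hX0 htan hspan hinj
  refine ⟨r, hr, δ, hδ, fun Hhat h1 h2 h3 _ _ h4 => ?_⟩
  obtain ⟨σ', a1, a2, a3⟩ := hfin Hhat h1 h2 h3 h4
  refine ⟨fun p => p, σ', ⟨analyticAt_id, rfl, fun p => p, analyticAt_id, rfl, ?_, ?_⟩, ?_, a1, a2, a3⟩
  · exact Eventually.of_forall fun _ => rfl
  · exact Eventually.of_forall fun _ => rfl
  · exact Eventually.of_forall fun _ h => h
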